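/- For the Wright–Fisher diffusion with selection X on [0,1] (dX_t = −s X_t(1−X_t) dt + σ √(X_t(1−X_t)) dB_t) killed at the soft killing time τ_∂ associated with the bounded death rate −r ≥ 0 and at the hitting times τ_0, τ_1 of the absorbing boundaries 0 and 1, there exists a unique quasi-stationary distribution α ∈ 𝓜₁((0,1)) and a survival capacity η for the extinction time τ_{0,1,∂} = τ_∂ ∧ τ_0 ∧ τ_1, with extinction rate ρ_α, i.e. ℙ_α(X_t ∈ dx; t < τ_{0,1,∂}) = e^{−ρ_α t} α(dx) for all t > 0 and η(x) = e^{ρ_α t} 𝔼_x[η(X_t); t < τ_{0,1,∂}] for all x; moreover there exist ζ > 0 and constants C, C′ > 0 such that, uniformly over all μ ∈ 𝓜₁((0,1)): ‖μA^{01}_t − α‖_{TV} ≤ C e^{−ζ t} and |e^{ρ_α t} ℙ_μ(t < τ_{0,1,∂}) − ⟨μ|η⟩| ≤ C′ e^{−ζ t}; consequently η(x) = lim_{t→∞} e^{ρ_α t} ℙ_x(t < τ_{0,1,∂}) and sup_{x∈(0,1), t>0} e^{ρ_α t} ℙ_x(t < τ_{0,1,∂}) < ∞. -/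

import Mathlib

open MeasureTheory ProbabilityTheory Filter Set
open scoped ENNReal NNReal Topology

noncomputable section

/-- The Wright–Fisher generator with selection `s` and diffusion parameter `σ`:
`𝓛_WF f(x) = -s x (1-x) f'(x) + (σ²/2) x (1-x) f''(x)`. -/
def LWF (s σ : ℝ) (f : ℝ → ℝ) : ℝ → ℝ := fun x =>
  -s * x * (1 - x) * deriv f x + σ ^ 2 / 2 * (x * (1 - x)) * deriv (deriv f) x

/-- A (weak) solution of the Wright–Fisher SDE with selection
`dX_t = -s X_t (1-X_t) dt + σ √(X_t(1-X_t)) dB_t`, `X_0 ∼ μ₀`, characterized through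
the associated martingale problem for the generator `LWF s σ`, enriched with an
independent standard exponential random variable `Tkill` used for the soft killing at
rate `-r ≥ 0`:  `τ_∂ = inf{t ≥ 0 : ∫₀ᵗ (-r(X_u)) du ≥ Tkill}`. -/
structure WFKilled (s σ : ℝ) (r : ℝ → ℝ) (μ₀ : Measure ℝ) where
  (Ω : Type)
  [mΩ : MeasurableSpace Ω]
  (P : Measure Ω)
  (probP : IsProbabilityMeasure P)
  (X : ℝ → Ω → ℝ)
  (measX : ∀ t, Measurable (X t))
  (contX : ∀ ω, Continuous fun t => X t ω)
  (preZero : ∀ t ≤ (0:ℝ), X t = X 0)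
  (range01 : ∀ t ω, X t ω ∈ Icc (0:ℝ) 1)
  (initLaw : P.map (X 0) = μ₀)
  (ℱ : Filtration ℝ mΩ)
  (adaptedX : Adapted ℱ X)
  (martProblem : ∀ f : ℝ → ℝ, ContDiff ℝ 2 f →
    Martingale (fun t ω => f (X t ω) - ∫ u in Ioc (0:ℝ) t, LWF s σ f (X u ω)) ℱ P)
  (Tkill : Ω → ℝ)
  (measT : Measurable Tkill)
  (expLaw : ∀ t : ℝ, 0 ≤ t → P {ω | t < Tkill ω} = ENNReal.ofReal (Real.exp (-t)))
  (indepT : IndepFun (fun ω t => X t ω) Tkill P)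

attribute [instance] WFKilled.mΩ WFKilled.probP

variable {s σ : ℝ} {r : ℝ → ℝ} {μ₀ : Measure ℝ}

/-- The survival event `{t < τ_∂}` for the soft killing at rate `-r`. -/
def WFKilled.aliveSoft (W : WFKilled s σ r μ₀) (t : ℝ) : Set W.Ω :=
  {ω | ∫ u in Ioc (0:ℝ) t, (-(r (W.X u ω))) < W.Tkill ω}

/-- The event `{t < τ_0}`: the boundary point `0` has not been hit by time `t`. -/
def WFKilled.noHit0 (W : WFKilled s σ r μ₀) (t : ℝ) : Set W.Ω :=
  {ω | ∀ u ∈ Icc (0:ℝ) t, W.X u ω ≠ 0}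

/-- The event `{t < τ_1}`: the boundary point `1` has not been hit by time `t`. -/
def WFKilled.noHit1 (W : WFKilled s σ r μ₀) (t : ℝ) : Set W.Ω :=
  {ω | ∀ u ∈ Icc (0:ℝ) t, W.X u ω ≠ 1}

/-- The event `{t < τ_{0,1,∂}}`. -/
def WFKilled.aliveAll (W : WFKilled s σ r μ₀) (t : ℝ) : Set W.Ω :=
  W.aliveSoft t ∩ W.noHit0 t ∩ W.noHit1 t

/-- The law of `X_t` conditioned on an event `E` (e.g. survival up to time `t`). -/
def WFKilled.condLaw (W : WFKilled s σ r μ₀) (E : Set W.Ω) (t : ℝ) : Measure ℝ :=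
  (W.P E)⁻¹ • (W.P.restrict E).map (W.X t)

/-- The hitting time of `0`, as an element of `ℝ≥0∞`. -/
def WFKilled.hit0 (W : WFKilled s σ r μ₀) (ω : W.Ω) : ℝ≥0∞ :=
  sInf {t : ℝ≥0∞ | ∃ u : ℝ, 0 ≤ u ∧ t = ENNReal.ofReal u ∧ W.X u ω = 0}

/-- The hitting time of `1`, as an element of `ℝ≥0∞`. -/
def WFKilled.hit1 (W : WFKilled s σ r μ₀) (ω : W.Ω) : ℝ≥0∞ :=
  sInf {t : ℝ≥0∞ | ∃ u : ℝ, 0 ≤ u ∧ t = ENNReal.ofReal u ∧ W.X u ω = 1}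

/-- The soft killing time `τ_∂`, as an element of `ℝ≥0∞`. -/
def WFKilled.killT (W : WFKilled s σ r μ₀) (ω : W.Ω) : ℝ≥0∞ :=
  sInf {t : ℝ≥0∞ | ∃ u : ℝ, 0 ≤ u ∧ t = ENNReal.ofReal u ∧
    W.Tkill ω ≤ ∫ v in Ioc (0:ℝ) u, (-(r (W.X v ω)))}

/-- Quasi-stationary distribution on `(0,1)` for the extinction time `τ_{0,1,∂}`,
with extinction rate `ρ`: under any realization of the killed Wright–Fisher diffusion
started from `α`, one has `ℙ_α(X_t ∈ A ; t < τ_{0,1,∂}) = e^{-ρ t} α(A)`. -/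
def IsQSD (s σ : ℝ) (r : ℝ → ℝ) (α : Measure ℝ) (ρ : ℝ) : Prop :=
  IsProbabilityMeasure α ∧ α (Ioo (0:ℝ) 1)ᶜ = 0 ∧
  ∀ W : WFKilled s σ r α, ∀ t : ℝ, 0 < t → ∀ A : Set ℝ, MeasurableSet A →
    W.P ({ω | W.X t ω ∈ A} ∩ W.aliveAll t) = ENNReal.ofReal (Real.exp (-(ρ * t))) * α A

/-- Quasi-stationary distribution on `[0,1]` for the soft killing time `τ_∂` alone,
with extinction rate `ρ`. -/
def IsQSDsoft (s σ : ℝ) (r : ℝ → ℝ) (α : Measure ℝ) (ρ : ℝ) : Prop :=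
  IsProbabilityMeasure α ∧ α (Icc (0:ℝ) 1)ᶜ = 0 ∧
  ∀ W : WFKilled s σ r α, ∀ t : ℝ, 0 < t → ∀ A : Set ℝ, MeasurableSet A →
    W.P ({ω | W.X t ω ∈ A} ∩ W.aliveSoft t) = ENNReal.ofReal (Real.exp (-(ρ * t))) * α A

/-- Survival capacity `η` with extinction rate `ρ`:
`η(x) = e^{ρ t} 𝔼_x[η(X_t) ; t < τ_{0,1,∂}]`. -/
def IsSurvCap (s σ : ℝ) (r : ℝ → ℝ) (ρ : ℝ) (η : ℝ → ℝ) : Prop :=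
  Measurable η ∧ ∀ x ∈ Icc (0:ℝ) 1, ∀ W : WFKilled s σ r (Measure.dirac x), ∀ t : ℝ, 0 < t →
    η x = Real.exp (ρ * t) * ∫ ω in W.aliveAll t, η (W.X t ω) ∂W.P

/-- Total variation distance between two (finite) measures on `ℝ`. -/
def tvDist (μ ν : Measure ℝ) : ℝ :=
  ⨆ A : Set ℝ, |(μ A).toReal - (ν A).toReal|

/-- Existence of realizations of the killed Wright–Fisher diffusion from any initial law
on `[0,1]` (granted by the classical well-posedness of the Wright–Fisher SDE). -/
def WFExists (s σ : ℝ) (r : ℝ → ℝ) : Prop :=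
  ∀ μ : Measure ℝ, IsProbabilityMeasure μ → μ (Icc (0:ℝ) 1)ᶜ = 0 →
    Nonempty (WFKilled s σ r μ)


section
namespace WFA

def aa (x : ℝ) : ℝ := x * (1 - x)
def sa (x : ℝ) : ℝ := √(x * (1 - x))
def GG (x y : ℝ) : ℝ := min x y * (1 - max x y)
def nu : Measure ℝ := volume.restrict (Ioo (0:ℝ) 1)

instance instProbNu : IsProbabilityMeasure nu := ⟨by simp [nu]⟩

abbrev HH := Lp ℝ 2 nu

lemma ae_nu : ∀ᵐ x ∂nu, x ∈ Ioo (0:ℝ) 1 := ae_restrict_mem measurableSet_Ioo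

lemma aa_pos {x : ℝ} (hx : x ∈ Ioo (0:ℝ) 1) : 0 < aa x := mul_pos hx.1 (by linarith [hx.2])
lemma sa_pos {x : ℝ} (hx : x ∈ Ioo (0:ℝ) 1) : 0 < sa x := Real.sqrt_pos.2 (aa_pos hx)
lemma sa_sq {x : ℝ} (hx : x ∈ Ioo (0:ℝ) 1) : sa x * sa x = aa x :=
  Real.mul_self_sqrt (aa_pos hx).le
lemma aa_le_one (x : ℝ) : aa x ≤ 1 := by unfold aa; nlinarith [sq_nonneg (x - 1/2)]
lemma sa_le_one (x : ℝ) : sa x ≤ 1 := Real.sqrt_le_one.2 (aa_le_one x)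
lemma sa_nonneg (x : ℝ) : 0 ≤ sa x := Real.sqrt_nonneg _
lemma aa_le_sa {x : ℝ} (hx : x ∈ Ioo (0:ℝ) 1) : aa x ≤ sa x := by
  rw [← sa_sq hx]; nlinarith [sa_nonneg x, sa_le_one x]
lemma continuous_aa : Continuous aa := by unfold aa; fun_prop
lemma continuous_sa : Continuous sa := by unfold sa; fun_prop
lemma continuous_GG : Continuous (fun z : ℝ × ℝ => GG z.1 z.2) := by unfold GG; fun_prop
lemma measurable_aa : Measurable aa := continuous_aa.measurable
lemma measurable_sa : Measurable sa := continuous_sa.measurable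

lemma GG_symm (x y : ℝ) : GG x y = GG y x := by unfold GG; rw [min_comm, max_comm]

lemma GG_nonneg {x y : ℝ} (hx : x ∈ Icc (0:ℝ) 1) (hy : y ∈ Icc (0:ℝ) 1) : 0 ≤ GG x y :=
  mul_nonneg (le_min hx.1 hy.1) (by linarith [max_le hx.2 hy.2])

lemma GG_le_aa {x y : ℝ} (hx : x ∈ Icc (0:ℝ) 1) (hy : y ∈ Icc (0:ℝ) 1) : GG x y ≤ aa x := by
  unfold GG aa
  obtain ⟨h1, h2⟩ := hx; obtain ⟨h3, h4⟩ := hy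
  rcases le_total x y with h | h
  · rw [min_eq_left h, max_eq_right h]; nlinarith
  · rw [min_eq_right h, max_eq_left h]; nlinarith

lemma GG_le_sa {x y : ℝ} (hx : x ∈ Ioo (0:ℝ) 1) (hy : y ∈ Ioo (0:ℝ) 1) :
    GG x y ≤ sa x * sa y := by
  have h1 := GG_le_aa (Ioo_subset_Icc_self hx) (Ioo_subset_Icc_self hy)
  have h2 := GG_le_aa (Ioo_subset_Icc_self hy) (Ioo_subset_Icc_self hx)
  rw [GG_symm] at h2
  have h0 := GG_nonneg (Ioo_subset_Icc_self hx) (Ioo_subset_Icc_self hy)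
  rw [← sa_sq hx] at h1; rw [← sa_sq hy] at h2
  have hx' := sa_pos hx; have hy' := sa_pos hy
  apply abs_le_of_sq_le_sq' _ (by positivity) |>.2
  nlinarith [mul_le_mul h1 h2 h0 (by positivity)]

lemma GG_le_one {x y : ℝ} (hx : x ∈ Icc (0:ℝ) 1) (hy : y ∈ Icc (0:ℝ) 1) : GG x y ≤ 1 :=
  (GG_le_aa hx hy).trans (aa_le_one x)

lemma integrable_inv_sa : Integrable (fun x => 1 / sa x) nu := by
  have h1 : Integrable (fun x : ℝ => x ^ (-(1/2) : ℝ)) nu := by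
    have := (intervalIntegral.intervalIntegrable_rpow' (a := 0) (b := 1) (r := -(1/2)) (by norm_num))
    rw [intervalIntegrable_iff_integrableOn_Ioo_of_le (by norm_num)] at this
    exact this
  have h2 : Integrable (fun x : ℝ => (1 - x) ^ (-(1/2) : ℝ)) nu := by
    have := (intervalIntegral.intervalIntegrable_rpow' (a := 0) (b := 1) (r := -(1/2)) (by norm_num)).comp_sub_left 1
    have := this.symm
    simp only [sub_zero, sub_self] at this
    rw [intervalIntegrable_iff_integrableOn_Ioo_of_le (by norm_num)] at this
    exact this
  refine (h1.add h2).mono' (by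
    exact (measurable_const.div measurable_sa).aestronglyMeasurable) ?_
  filter_upwards [ae_nu] with x hx
  have hx1 : 0 < 1 - x := by linarith [hx.2]
  have e1 : x ^ (-(1/2) : ℝ) = 1 / √x := by
    rw [Real.rpow_neg hx.1.le, Real.sqrt_eq_rpow, ← one_div]
  have e2 : (1-x) ^ (-(1/2) : ℝ) = 1 / √(1-x) := by
    rw [Real.rpow_neg hx1.le, Real.sqrt_eq_rpow, ← one_div]
  simp only [Pi.add_apply]
  rw [e1, e2, Real.norm_of_nonneg (by have := sa_nonneg x; positivity)]
  have p1 : 0 < √x := Real.sqrt_pos.2 hx.1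
  have p2 : 0 < √(1-x) := Real.sqrt_pos.2 hx1
  have : sa x = √x * √(1-x) := by unfold sa; rw [Real.sqrt_mul hx.1.le]
  rw [this, div_add_div _ _ p1.ne' p2.ne']
  apply div_le_div_of_nonneg_right _ (by positivity)
  nlinarith [Real.sq_sqrt hx.1.le, Real.sq_sqrt hx1.le, mul_pos p1 p2]

def c1 : ℝ := ∫ x, 1 / sa x ∂nu
lemma c1_nonneg : 0 ≤ c1 := integral_nonneg fun x => by have := sa_nonneg x; positivity

lemma HH_integrable (f : HH) : Integrable f nu :=
  (Lp.memLp f).integrable (by norm_num)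

lemma HH_int_abs_le (f : HH) : ∫ x, |f x| ∂nu ≤ ‖f‖ := by
  have h := eLpNorm_le_eLpNorm_of_exponent_le (μ := nu) (p := 1) (q := 2) (by norm_num)
    (Lp.aestronglyMeasurable f)
  rw [Lp.norm_def]
  have e : ∫ x, |f x| ∂nu = (eLpNorm f 1 nu).toReal := by
    rw [eLpNorm_one_eq_lintegral_enorm, ← integral_norm_eq_lintegral_enorm (Lp.aestronglyMeasurable f)]
    rfl
  rw [e]
  exact ENNReal.toReal_mono (Lp.eLpNorm_ne_top f) h

lemma inner_HH (f g : HH) : inner ℝ f g = ∫ x, f x * g x ∂nu := by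
  rw [L2.inner_def]; congr 1; ext x; simp [mul_comm]

lemma norm_le_of_bdd {f : HH} {C : ℝ} (hC : 0 ≤ C) (h : ∀ᵐ x ∂nu, |f x| ≤ C) : ‖f‖ ≤ C := by
  have := Lp.norm_le_of_ae_bound (p := 2) (μ := nu) (f := f) hC (by simpa using h)
  simpa [measureUnivNNReal] using this

/-- bounded kernel operator -/
structure BKer (k : ℝ → ℝ → ℝ) (M : ℝ) : Prop where
  meas : Measurable (Function.uncurry k)
  bdd : ∀ x y, |k x y| ≤ M

lemma BKer.integrable {k M} (hk : BKer k M) (x : ℝ) {f : ℝ → ℝ} (hf : Integrable f nu) :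
    Integrable (fun y => k x y * f y) nu := by
  refine hf.bdd_mul (c := M) ?_ ?_
  · exact (hk.meas.comp (measurable_prodMk_left (x := x))).aestronglyMeasurable
  · exact Eventually.of_forall fun y => hk.bdd x y

lemma BKer.M_nonneg {k M} (hk : BKer k M) : 0 ≤ M := (abs_nonneg _).trans (hk.bdd 0 0)

lemma BKer.abs_int_le {k M} (hk : BKer k M) (x : ℝ) (f : HH) :
    |∫ y, k x y * f y ∂nu| ≤ M * ‖f‖ := by
  calc |∫ y, k x y * f y ∂nu| ≤ ∫ y, |k x y * f y| ∂nu := abs_integral_le_integral_abs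
    _ ≤ ∫ y, M * |f y| ∂nu := by
        refine integral_mono (hk.integrable x (HH_integrable f)).abs
          ((HH_integrable f).abs.const_mul M) fun y => ?_
        simp only [abs_mul]
        exact mul_le_mul_of_nonneg_right (hk.bdd x y) (abs_nonneg _)
    _ = M * ∫ y, |f y| ∂nu := integral_const_mul _ _
    _ ≤ _ := mul_le_mul_of_nonneg_left (HH_int_abs_le f) hk.M_nonneg

lemma BKer.aesm {k M} (hk : BKer k M) (f : HH) :
    StronglyMeasurable (fun x => ∫ y, k x y * f y ∂nu) := by
  have : StronglyMeasurable (Function.uncurry fun x y => k x y * f y) :=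
    (hk.meas.mul ((Lp.stronglyMeasurable f).measurable.comp measurable_snd)).stronglyMeasurable
  exact this.integral_prod_right

lemma BKer.memLp {k M} (hk : BKer k M) (f : HH) :
    MemLp (fun x => ∫ y, k x y * f y ∂nu) 2 nu :=
  MemLp.of_bound (hk.aesm f).aestronglyMeasurable (M * ‖f‖)
    (Eventually.of_forall fun x => hk.abs_int_le x f)

def BKer.op {k M} (hk : BKer k M) : HH →L[ℝ] HH :=
  LinearMap.mkContinuous
    { toFun := fun f => (hk.memLp f).toLp
      map_add' := fun f g => by
        ext1
        filter_upwards [MemLp.coeFn_toLp (hk.memLp (f+g)), MemLp.coeFn_toLp (hk.memLp f),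
          MemLp.coeFn_toLp (hk.memLp g), Lp.coeFn_add ((hk.memLp f).toLp) ((hk.memLp g).toLp)]
          with x h1 h2 h3 h4
        rw [h1, h4, Pi.add_apply, h2, h3, ← integral_add (hk.integrable x (HH_integrable f))
          (hk.integrable x (HH_integrable g))]
        apply integral_congr_ae
        filter_upwards [Lp.coeFn_add f g] with y hy
        rw [hy, Pi.add_apply, mul_add]
      map_smul' := fun c f => by
        ext1
        filter_upwards [MemLp.coeFn_toLp (hk.memLp (c • f)), MemLp.coeFn_toLp (hk.memLp f),
          Lp.coeFn_smul c ((hk.memLp f).toLp)] with x h1 h2 h4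
        simp only [RingHom.id_apply]
        rw [h1, h4, Pi.smul_apply, h2, smul_eq_mul, ← integral_const_mul]
        apply integral_congr_ae
        filter_upwards [Lp.coeFn_smul c f] with y hy
        rw [hy, Pi.smul_apply, smul_eq_mul]; ring } M
    (fun f => norm_le_of_bdd (by have := hk.M_nonneg; positivity) (by
      filter_upwards [MemLp.coeFn_toLp (hk.memLp f)] with x hx
      simp only [LinearMap.coe_mk, AddHom.coe_mk]
      rw [hx]; exact hk.abs_int_le x f))

lemma BKer.op_ae {k M} (hk : BKer k M) (f : HH) :
    hk.op f =ᵐ[nu] fun x => ∫ y, k x y * f y ∂nu := MemLp.coeFn_toLp (hk.memLp f)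

end WFA
end

section
namespace WFA

lemma norm_sq_HH (f : HH) : ‖f‖ ^ 2 = ∫ x, f x ^ 2 ∂nu := by
  rw [← real_inner_self_eq_norm_sq, inner_HH]; simp [sq]

lemma BKer.memLp_sec {k M} (hk : BKer k M) (x : ℝ) : MemLp (k x) 2 nu :=
  MemLp.of_bound (hk.meas.comp (measurable_prodMk_left (x := x))).aestronglyMeasurable M
    (Eventually.of_forall fun y => hk.bdd x y)

lemma BKer.int_eq_inner {k M} (hk : BKer k M) (x : ℝ) (f : HH) :
    ∫ y, k x y * f y ∂nu = inner ℝ ((hk.memLp_sec x).toLp) f := by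
  rw [inner_HH]
  apply integral_congr_ae
  filter_upwards [MemLp.coeFn_toLp (hk.memLp_sec x)] with y hy
  rw [hy]

lemma BKer.int_sq_le {k M} (hk : BKer k M) (x : ℝ) (f : HH) :
    (∫ y, k x y * f y ∂nu) ^ 2 ≤ (∫ y, k x y ^ 2 ∂nu) * ‖f‖ ^ 2 := by
  rw [hk.int_eq_inner x f]
  have e : ∫ y, k x y ^ 2 ∂nu = ‖(hk.memLp_sec x).toLp‖ ^ 2 := by
    rw [norm_sq_HH]
    apply integral_congr_ae
    filter_upwards [MemLp.coeFn_toLp (hk.memLp_sec x)] with y hy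
    rw [hy]
  rw [e, ← mul_pow, ← sq_abs]
  exact pow_le_pow_left₀ (abs_nonneg _) (abs_real_inner_le_norm _ _) 2

lemma BKer.op_norm_le {k M} (hk : BKer k M) :
    ‖hk.op‖ ≤ √(∫ x, ∫ y, k x y ^ 2 ∂nu ∂nu) := by
  apply ContinuousLinearMap.opNorm_le_bound _ (Real.sqrt_nonneg _)
  intro f
  apply le_of_sq_le_sq _ (by positivity)
  rw [mul_pow, Real.sq_sqrt (integral_nonneg fun x => integral_nonneg fun y => sq_nonneg _),
    norm_sq_HH, ← integral_mul_const]
  have hm : StronglyMeasurable (fun x => ∫ y, k x y ^ 2 ∂nu) :=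
    (StronglyMeasurable.integral_prod_right (f := fun x y => k x y ^ 2) (hk.meas.pow_const 2).stronglyMeasurable)
  have hb : ∀ x, ‖∫ y, k x y ^ 2 ∂nu‖ ≤ M ^ 2 := fun x => by
    refine (norm_integral_le_of_norm_le_const (μ := nu) (C := M ^ 2) (Eventually.of_forall fun y => ?_)).trans (by simp)
    rw [norm_pow]; exact pow_le_pow_left₀ (norm_nonneg _) (hk.bdd x y) 2
  refine integral_mono_ae ?_ ?_ ?_
  · exact (Lp.memLp (hk.op f)).integrable_sq
  · exact (Integrable.of_bound hm.aestronglyMeasurable (M^2) (Eventually.of_forall hb)).mul_const _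
  · filter_upwards [hk.op_ae f] with x hx
    rw [hx]; exact hk.int_sq_le x f

lemma BKer.sub {k k' M M'} (hk : BKer k M) (hk' : BKer k' M') :
    BKer (fun x y => k x y - k' x y) (M + M') where
  meas := hk.meas.sub hk'.meas
  bdd x y := (abs_sub _ _).trans (add_le_add (hk.bdd x y) (hk'.bdd x y))

lemma BKer.op_sub {k k' M M'} (hk : BKer k M) (hk' : BKer k' M') :
    (hk.sub hk').op = hk.op - hk'.op := by
  ext1 f
  ext1
  filter_upwards [(hk.sub hk').op_ae f, hk.op_ae f, hk'.op_ae f,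
    Lp.coeFn_sub (hk.op f) (hk'.op f)] with x h1 h2 h3 h4
  rw [sub_apply, h1, h4, Pi.sub_apply, h2, h3, ← integral_sub (hk.integrable x (HH_integrable f)) (hk'.integrable x (HH_integrable f))]
  congr 1; ext y; ring

/-- discretised kernel -/
def dk (k : ℝ → ℝ → ℝ) (n : ℕ) (x y : ℝ) : ℝ := k ((⌊(n+1 : ℝ) * x⌋ : ℝ) / (n+1)) y

lemma BKer.dk {k M} (hk : BKer k M) (n : ℕ) : BKer (dk k n) M where
  meas := by
    have : Measurable (fun z : ℝ × ℝ => (((⌊(n+1 : ℝ) * z.1⌋ : ℤ) : ℝ) / (n+1), z.2)) := by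
      refine Measurable.prodMk ?_ measurable_snd
      refine Measurable.div_const ?_ _
      exact measurable_from_top.comp (Int.measurable_floor.comp (measurable_fst.const_mul _))
    exact hk.meas.comp this
  bdd x y := hk.bdd _ y

lemma isCompact_rankOne (w z : HH) :
    IsCompactOperator (fun f : HH => (inner ℝ w f) • z) := by
  have h1 : IsCompactOperator (innerSL ℝ w : HH → ℝ) :=
    isCompactOperator_of_locallyCompactSpace_dom (innerSL ℝ w)
  exact h1.clm_comp (ContinuousLinearMap.toSpanSingleton ℝ z)

lemma BKer.dk_compact {k M} (hk : BKer k M) (n : ℕ) : IsCompactOperator (hk.dk n).op := by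
  have hI : ∀ j : ℕ, MemLp (indicator {x : ℝ | ⌊(n+1 : ℝ) * x⌋ = (j : ℤ)} (fun _ => (1:ℝ))) 2 nu := by
    intro j
    refine MemLp.indicator ?_ (memLp_const _)
    exact (Int.measurable_floor.comp (measurable_id.const_mul _)) (measurableSet_singleton _)
  let w : ℕ → HH := fun j => ((hk.memLp_sec ((j:ℝ)/(n+1))).toLp)
  let z : ℕ → HH := fun j => (hI j).toLp
  have e : ⇑((hk.dk n).op) = fun f => ∑ j ∈ Finset.range (n+1), (inner ℝ (w j) f) • z j := by
    funext f
    ext1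
    have hs : (∑ j ∈ Finset.range (n+1), (inner ℝ (w j) f) • z j : HH) =ᵐ[nu]
        fun x => ∑ j ∈ Finset.range (n+1), (inner ℝ (w j) f) * z j x := by
      have : ∀ᵐ x ∂nu, ∀ j ∈ Finset.range (n+1), ((inner ℝ (w j) f) • z j : HH) x = (inner ℝ (w j) f) * z j x := by
        rw [Filter.eventually_all_finset]
        intro j _
        filter_upwards [Lp.coeFn_smul (inner ℝ (w j) f) (z j)] with x hx
        rw [hx]; rfl
      filter_upwards [this, Lp.coeFn_finsetSum (Finset.range (n+1)) (fun j => (inner ℝ (w j) f) • z j)] with x h1 h2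
      rw [h2, Finset.sum_apply]
      exact Finset.sum_congr rfl h1
    have hz : ∀ᵐ x ∂nu, ∀ j ∈ Finset.range (n+1), z j x = indicator {x : ℝ | ⌊(n+1 : ℝ) * x⌋ = (j : ℤ)} (fun _ => (1:ℝ)) x := by
      rw [Filter.eventually_all_finset]
      intro j _
      exact MemLp.coeFn_toLp (hI j)
    filter_upwards [(hk.dk n).op_ae f, hs, hz, ae_nu] with x h1 h2 h3 hx
    rw [h1, h2]
    have hn : (0:ℝ) < n + 1 := by positivity
    obtain ⟨j, hj⟩ : ∃ j : ℕ, ⌊(n+1 : ℝ) * x⌋ = (j : ℤ) :=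
      Int.eq_ofNat_of_zero_le (Int.floor_nonneg.2 (by have := hx.1; positivity))
    have hjn : j ∈ Finset.range (n+1) := by
      rw [Finset.mem_range]
      have : ⌊(n+1 : ℝ) * x⌋ < (n+1 : ℤ) := by
        rw [Int.floor_lt]; push_cast; nlinarith [hx.2]
      omega
    rw [Finset.sum_eq_single j]
    · rw [h3 j hjn, indicator_of_mem (by exact hj), mul_one, ← hk.int_eq_inner]
      simp only [WFA.dk, hj, Int.cast_natCast]
    · intro i hi hij
      rw [h3 i hi, indicator_of_notMem, mul_zero]
      simp only [mem_ofPred_eq, hj]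
      exact_mod_cast hij.symm
    · exact fun h => absurd hjn h
  rw [e]
  have : ∀ N : ℕ, IsCompactOperator (fun f : HH => ∑ j ∈ Finset.range N, (inner ℝ (w j) f) • z j) := by
    intro N
    induction N with
    | zero => simp only [Finset.range_zero, Finset.sum_empty]; exact isCompactOperator_zero
    | succ N ih =>
      simp only [Finset.sum_range_succ]
      exact ih.add (isCompact_rankOne (w N) (z N))
  exact this _

lemma BKer.compact {k M} (hk : BKer k M)
    (hc : ∀ y ∈ Ioo (0:ℝ) 1, ∀ x ∈ Ioo (0:ℝ) 1, ContinuousAt (fun x => k x y) x) :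
    IsCompactOperator hk.op := by
  apply isCompactOperator_of_tendsto (F := fun n => (hk.dk n).op) (l := atTop) (f := hk.op) _
    (Eventually.of_forall fun n => hk.dk_compact n)
  rw [tendsto_iff_norm_sub_tendsto_zero]
  have hlim : ∀ x : ℝ, Tendsto (fun n : ℕ => (⌊(n+1 : ℝ) * x⌋ : ℝ) / (n+1)) atTop (𝓝 x) := by
    intro x
    have h0 : Tendsto (fun n : ℕ => x - 1 / ((n:ℝ) + 1)) atTop (𝓝 x) := by
      simpa using tendsto_const_nhds.sub (tendsto_one_div_add_atTop_nhds_zero_nat (𝕜 := ℝ))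
    refine tendsto_of_tendsto_of_tendsto_of_le_of_le h0 tendsto_const_nhds ?_ ?_
    · intro n
      have hn : (0:ℝ) < n + 1 := by positivity
      have := Int.lt_floor_add_one ((n+1 : ℝ) * x)
      simp only
      rw [le_div_iff₀ hn, sub_mul, one_div, inv_mul_cancel₀ hn.ne']; linarith
    · intro n
      have hn : (0:ℝ) < n + 1 := by positivity
      have := Int.floor_le ((n+1 : ℝ) * x)
      simp only
      rw [div_le_iff₀ hn]; linarith
  have hM := hk.M_nonneg
  have key : Tendsto (fun n => ∫ x, ∫ y, (WFA.dk k n x y - k x y) ^ 2 ∂nu ∂nu) atTop (𝓝 0) := by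
    have bd : ∀ n x y, ‖(WFA.dk k n x y - k x y) ^ 2‖ ≤ (M + M) ^ 2 := fun n x y => by
      rw [norm_pow]; exact pow_le_pow_left₀ (norm_nonneg _) (((hk.dk n).sub hk).bdd x y) 2
    have inner0 : ∀ x ∈ Ioo (0:ℝ) 1, Tendsto (fun n => ∫ y, (WFA.dk k n x y - k x y) ^ 2 ∂nu) atTop (𝓝 0) := by
      intro x hx
      have : (0:ℝ) = ∫ y, 0 ∂nu := by simp
      rw [this]
      refine tendsto_integral_of_dominated_convergence (fun _ => (M+M)^2) ?_ (integrable_const _) ?_ ?_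
      · intro n
        exact ((((hk.dk n).sub hk).meas.comp (measurable_prodMk_left (x := x))).pow_const 2).aestronglyMeasurable
      · intro n; exact Eventually.of_forall fun y => bd n x y
      · filter_upwards [ae_nu] with y hy
        have h1 : Tendsto (fun n => WFA.dk k n x y) atTop (𝓝 (k x y)) := (hc y hy x hx).tendsto.comp (hlim x)
        simpa using (h1.sub_const (k x y)).pow 2
    have : (0:ℝ) = ∫ y, 0 ∂nu := by simp
    rw [this]
    refine tendsto_integral_of_dominated_convergence (fun _ => (M+M)^2) ?_ (integrable_const _) ?_ ?_
    · intro n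
      exact (StronglyMeasurable.integral_prod_right (f := fun x y => (WFA.dk k n x y - k x y) ^ 2)
        ((((hk.dk n).sub hk).meas.pow_const 2).stronglyMeasurable)).aestronglyMeasurable
    · intro n; refine Eventually.of_forall fun x => ?_
      exact (norm_integral_le_of_norm_le_const (μ := nu) (C := (M+M) ^ 2) (Eventually.of_forall fun y => bd n x y)).trans (by simp)
    · filter_upwards [ae_nu] with x hx using inner0 x hx
  have key2 := (Real.continuous_sqrt.tendsto 0).comp key
  rw [Real.sqrt_zero] at key2
  refine squeeze_zero (fun n => norm_nonneg _) (fun n => ?_) key2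
  rw [← BKer.op_sub]
  exact ((hk.dk n).sub hk).op_norm_le

end WFA
end

section
namespace WFA

def Pot (g : ℝ → ℝ) (x : ℝ) : ℝ := ∫ y, GG x y * g y ∂nu
def PP (f : ℝ → ℝ) (x : ℝ) : ℝ := Pot (fun y => f y / sa y) x

open Classical in
def kk (x y : ℝ) : ℝ := if x ∈ Ioo (0:ℝ) 1 ∧ y ∈ Ioo (0:ℝ) 1 then GG x y / (sa x * sa y) else 0

lemma kk_of_mem {x y : ℝ} (hx : x ∈ Ioo (0:ℝ) 1) (hy : y ∈ Ioo (0:ℝ) 1) :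
    kk x y = GG x y / (sa x * sa y) := if_pos ⟨hx, hy⟩

lemma kk_symm (x y : ℝ) : kk x y = kk y x := by
  unfold kk; rw [GG_symm, mul_comm (sa x)]; simp only [and_comm]

lemma kkB : BKer kk 1 where
  meas := by
    unfold kk
    refine Measurable.ite ?_ ?_ measurable_const
    · exact measurableSet_Ioo.prod measurableSet_Ioo
    · exact continuous_GG.measurable.div ((measurable_sa.comp measurable_fst).mul (measurable_sa.comp measurable_snd))
  bdd x y := by
    unfold kk
    split_ifs with h
    · have := sa_pos h.1; have := sa_pos h.2
      rw [abs_of_nonneg (div_nonneg (GG_nonneg (Ioo_subset_Icc_self h.1) (Ioo_subset_Icc_self h.2)) (by positivity)), div_le_one (by positivity)]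
      exact GG_le_sa h.1 h.2
    · simp

lemma kk_contAt {y : ℝ} (hy : y ∈ Ioo (0:ℝ) 1) {x : ℝ} (hx : x ∈ Ioo (0:ℝ) 1) :
    ContinuousAt (fun x => kk x y) x := by
  have : (fun x => kk x y) =ᶠ[𝓝 x] fun x => GG x y / (sa x * sa y) := by
    filter_upwards [isOpen_Ioo.mem_nhds hx] with z hz using kk_of_mem hz hy
  refine ContinuousAt.congr ?_ this.symm
  refine ContinuousAt.div ?_ ?_ (mul_pos (sa_pos hx) (sa_pos hy)).ne'
  · exact (continuous_GG.comp (Continuous.prodMk continuous_id continuous_const)).continuousAt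
  · exact (continuous_sa.mul continuous_const).continuousAt

def TT : HH →L[ℝ] HH := kkB.op

lemma TT_compact : IsCompactOperator TT := kkB.compact fun _ hy _ hx => kk_contAt hy hx

lemma PP_eq (f : ℝ → ℝ) {x : ℝ} (hx : x ∈ Ioo (0:ℝ) 1) :
    PP f x = sa x * ∫ y, kk x y * f y ∂nu := by
  rw [← integral_const_mul]
  apply integral_congr_ae
  filter_upwards [ae_nu] with y hy
  rw [kk_of_mem hx hy]
  have := sa_pos hx; have := sa_pos hy
  field_simp

lemma PP_congr {f g : ℝ → ℝ} (h : f =ᵐ[nu] g) (x : ℝ) : PP f x = PP g x := by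
  apply integral_congr_ae
  filter_upwards [h] with y hy
  rw [hy]

lemma PP_inner (f : HH) {x : ℝ} (hx : x ∈ Ioo (0:ℝ) 1) :
    PP f x = sa x * inner ℝ ((kkB.memLp_sec x).toLp) f := by
  rw [PP_eq _ hx, kkB.int_eq_inner]

lemma TT_ae (f : HH) : TT f =ᵐ[nu] fun x => PP f x / sa x := by
  filter_upwards [kkB.op_ae f, ae_nu] with x h1 hx
  have := sa_pos hx
  rw [PP_eq _ hx]; unfold TT; rw [h1]; field_simp

lemma PP_le (f : HH) {x : ℝ} (hx : x ∈ Ioo (0:ℝ) 1) : |PP f x| ≤ sa x * ‖f‖ := by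
  rw [PP_eq _ hx, abs_mul, abs_of_pos (sa_pos hx)]
  have := kkB.abs_int_le x f
  rw [one_mul] at this
  exact mul_le_mul_of_nonneg_left this (sa_nonneg x)

lemma PP_le_of_bdd {f : ℝ → ℝ} {C : ℝ} (h : ∀ᵐ y ∂nu, |f y| ≤ C) {x : ℝ}
    (hx : x ∈ Ioo (0:ℝ) 1) : |PP f x| ≤ C * c1 * aa x := by
  have hxa := aa_pos hx
  have : ∀ᵐ y ∂nu, ‖GG x y * (f y / sa y)‖ ≤ C * aa x * (1 / sa y) := by
    filter_upwards [h, ae_nu] with y hy hy'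
    have hs := sa_pos hy'
    have h0 := GG_nonneg (Ioo_subset_Icc_self hx) (Ioo_subset_Icc_self hy')
    have h1 := GG_le_aa (Ioo_subset_Icc_self hx) (Ioo_subset_Icc_self hy')
    rw [Real.norm_eq_abs, abs_mul, abs_div, abs_of_nonneg h0, abs_of_pos hs, ← mul_div_assoc, mul_one_div]
    apply div_le_div_of_nonneg_right _ hs.le
    rw [mul_comm C]
    exact mul_le_mul h1 hy (abs_nonneg _) hxa.le
  have h2 := norm_integral_le_of_norm_le (integrable_inv_sa.const_mul (C * aa x)) this
  rw [integral_const_mul] at h2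
  calc |PP f x| ≤ C * aa x * c1 := h2
    _ = _ := by ring

lemma PP_meas {f : ℝ → ℝ} (hf : Measurable f) : Measurable (Pot f) := by
  have : StronglyMeasurable (Function.uncurry fun x y => GG x y * f y) :=
    (continuous_GG.measurable.mul (hf.comp measurable_snd)).stronglyMeasurable
  exact (this.integral_prod_right).measurable

lemma PP_contAt {f : ℝ → ℝ} (hf : Integrable f nu) {x : ℝ} (hx : x ∈ Ioo (0:ℝ) 1) :
    ContinuousAt (PP f) x := by
  have : PP f =ᶠ[𝓝 x] fun x => sa x * ∫ y, kk x y * f y ∂nu := by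
    filter_upwards [isOpen_Ioo.mem_nhds hx] with z hz using PP_eq f hz
  refine ContinuousAt.congr ?_ this.symm
  refine continuous_sa.continuousAt.mul ?_
  refine continuousAt_of_dominated (bound := fun y => |f y|) ?_ ?_ hf.abs ?_
  · exact Eventually.of_forall fun z => (kkB.integrable z hf).aestronglyMeasurable
  · refine Eventually.of_forall fun z => Eventually.of_forall fun y => ?_
    rw [norm_mul]
    have := kkB.bdd z y
    exact mul_le_of_le_one_left (norm_nonneg _) this
  · filter_upwards [ae_nu] with y hy
    exact (kk_contAt hy hx).mul continuousAt_const

lemma TT_symm (f g : HH) : inner ℝ (TT f) g = inner ℝ f (TT g) := by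
  have e1 : inner ℝ (TT f) g = ∫ x, ∫ y, kk x y * f y * g x ∂nu ∂nu := by
    rw [inner_HH]
    apply integral_congr_ae
    filter_upwards [kkB.op_ae f] with x hx
    unfold TT
    rw [hx, integral_mul_const]
  have e2 : inner ℝ f (TT g) = ∫ y, ∫ x, kk x y * f y * g x ∂nu ∂nu := by
    rw [inner_HH]
    apply integral_congr_ae
    filter_upwards [kkB.op_ae g] with x hx
    unfold TT
    rw [hx, ← integral_const_mul]
    congr 1; ext y; rw [kk_symm]; ring
  rw [e1, e2]
  apply integral_integral_swap
  have h1 : Integrable (fun z : ℝ × ℝ => g z.1 * f z.2) (nu.prod nu) :=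
    (HH_integrable g).mul_prod (HH_integrable f)
  have h2 : Integrable (fun z : ℝ × ℝ => kk z.1 z.2 * (g z.1 * f z.2)) (nu.prod nu) := by
    refine h1.bdd_mul (c := 1) kkB.meas.aestronglyMeasurable ?_
    exact Eventually.of_forall fun z => kkB.bdd z.1 z.2
  refine h2.congr (Eventually.of_forall fun z => ?_)
  simp only [Function.uncurry]; ring

/-- multiplication operator -/
structure BV (v : ℝ → ℝ) (M : ℝ) : Prop where
  meas : Measurable v
  nonneg : ∀ x, 0 ≤ v x
  le : ∀ x, v x ≤ M

lemma BV.M_nonneg {v M} (hv : BV v M) : 0 ≤ M := (hv.nonneg 0).trans (hv.le 0)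
lemma BV.abs_le {v M} (hv : BV v M) (x : ℝ) : |v x| ≤ M := by
  rw [abs_of_nonneg (hv.nonneg x)]; exact hv.le x

lemma BV.memLp {v M} (hv : BV v M) (f : HH) : MemLp (fun x => v x * f x) 2 nu := by
  refine (Lp.memLp f).of_le_mul (c := M) (hv.meas.aestronglyMeasurable.mul (Lp.aestronglyMeasurable f)) ?_
  refine Eventually.of_forall fun x => ?_
  rw [norm_mul]; exact mul_le_mul_of_nonneg_right (hv.abs_le x) (norm_nonneg _)

def BV.op {v M} (hv : BV v M) : HH →L[ℝ] HH :=
  LinearMap.mkContinuous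
    { toFun := fun f => (hv.memLp f).toLp
      map_add' := fun f g => by
        ext1
        filter_upwards [MemLp.coeFn_toLp (hv.memLp (f+g)), MemLp.coeFn_toLp (hv.memLp f),
          MemLp.coeFn_toLp (hv.memLp g), Lp.coeFn_add ((hv.memLp f).toLp) ((hv.memLp g).toLp), Lp.coeFn_add f g]
          with x h1 h2 h3 h4 h5
        rw [h1, h4, Pi.add_apply, h2, h3, h5, Pi.add_apply, mul_add]
      map_smul' := fun c f => by
        ext1
        filter_upwards [MemLp.coeFn_toLp (hv.memLp (c • f)), MemLp.coeFn_toLp (hv.memLp f),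
          Lp.coeFn_smul c ((hv.memLp f).toLp), Lp.coeFn_smul c f] with x h1 h2 h4 h5
        simp only [RingHom.id_apply]
        rw [h1, h4, Pi.smul_apply, h2, h5, Pi.smul_apply, smul_eq_mul, smul_eq_mul]; ring } M
    (fun f => by
      simp only [LinearMap.coe_mk, AddHom.coe_mk]
      refine Lp.norm_le_mul_norm_of_ae_le_mul ?_
      filter_upwards [MemLp.coeFn_toLp (hv.memLp f)] with x hx
      rw [hx, norm_mul]; exact mul_le_mul_of_nonneg_right (hv.abs_le x) (norm_nonneg _))

lemma BV.op_ae {v M} (hv : BV v M) (f : HH) : hv.op f =ᵐ[nu] fun x => v x * f x :=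
  MemLp.coeFn_toLp (hv.memLp f)

lemma BV.op_symm {v M} (hv : BV v M) (f g : HH) : inner ℝ (hv.op f) g = inner ℝ f (hv.op g) := by
  rw [inner_HH, inner_HH]
  apply integral_congr_ae
  filter_upwards [hv.op_ae f, hv.op_ae g] with x h1 h2
  rw [h1, h2]; ring

lemma int_nu (f : ℝ → ℝ) : ∫ y, f y ∂nu = ∫ y in (0:ℝ)..1, f y := by
  rw [intervalIntegral.integral_of_le (by norm_num), integral_Ioc_eq_integral_Ioo]; rfl

def pc (g : ℝ → ℝ) (x : ℝ) : ℝ :=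
  x * (∫ y in (0:ℝ)..1, (1 - y) * g y) - x * (∫ y in (0:ℝ)..x, g y) + ∫ y in (0:ℝ)..x, y * g y

lemma pc_eq {g : ℝ → ℝ} (hg : Continuous g) {x : ℝ} (hx : x ∈ Icc (0:ℝ) 1) : Pot g x = pc g x := by
  unfold Pot pc
  rw [int_nu]
  have hi : ∀ a b : ℝ, IntervalIntegrable (fun y => GG x y * g y) volume a b := fun a b =>
    ((continuous_GG.comp (Continuous.prodMk continuous_const continuous_id)).mul hg).intervalIntegrable a b
  have hj : ∀ a b : ℝ, IntervalIntegrable (fun y => (1-y) * g y) volume a b := fun a b =>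
    ((continuous_const.sub continuous_id).mul hg).intervalIntegrable a b
  have hk : ∀ a b : ℝ, IntervalIntegrable (fun y => y * g y) volume a b := fun a b =>
    (continuous_id.mul hg).intervalIntegrable a b
  rw [← intervalIntegral.integral_add_adjacent_intervals (hi 0 x) (hi x 1),
    ← intervalIntegral.integral_add_adjacent_intervals (hj 0 x) (hj x 1)]
  have e1 : ∫ y in (0:ℝ)..x, GG x y * g y = (1-x) * ∫ y in (0:ℝ)..x, y * g y := by
    rw [← intervalIntegral.integral_const_mul]
    apply intervalIntegral.integral_congr
    intro y hy
    rw [uIcc_of_le hx.1] at hy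
    simp only [GG]
    rw [min_eq_right hy.2, max_eq_left hy.2]; ring
  have e2 : ∫ y in x..1, GG x y * g y = x * ∫ y in x..1, (1-y) * g y := by
    rw [← intervalIntegral.integral_const_mul]
    apply intervalIntegral.integral_congr
    intro y hy
    rw [uIcc_of_le hx.2] at hy
    simp only [GG]
    rw [min_eq_left hy.1, max_eq_right hy.1]; ring
  have e3 : ∫ y in (0:ℝ)..x, (1-y) * g y = (∫ y in (0:ℝ)..x, g y) - ∫ y in (0:ℝ)..x, y * g y := by
    rw [← intervalIntegral.integral_sub (hg.intervalIntegrable _ _) (hk _ _)]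
    congr 1; ext y; ring
  rw [e1, e2, e3]; ring

lemma pc_deriv {g : ℝ → ℝ} (hg : Continuous g) :
    deriv (pc g) = fun x => (∫ y in (0:ℝ)..1, (1 - y) * g y) - ∫ y in (0:ℝ)..x, g y := by
  ext x
  have h1 : HasDerivAt (fun x => ∫ y in (0:ℝ)..x, g y) (g x) x := hg.integral_hasStrictDerivAt 0 x |>.hasDerivAt
  have h2 : HasDerivAt (fun x => ∫ y in (0:ℝ)..x, y * g y) (x * g x) x :=
    (continuous_id.mul hg).integral_hasStrictDerivAt 0 x |>.hasDerivAt
  have h3 := (((hasDerivAt_id x).mul_const (∫ y in (0:ℝ)..1, (1 - y) * g y)).sub ((hasDerivAt_id x).mul h1)).add h2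
  have := h3.deriv
  unfold pc
  convert! this using 1
  simp; ring

lemma pc_deriv2 {g : ℝ → ℝ} (hg : Continuous g) : deriv (deriv (pc g)) = fun x => - g x := by
  rw [pc_deriv hg]
  ext x
  have h1 : HasDerivAt (fun x => ∫ y in (0:ℝ)..x, g y) (g x) x := hg.integral_hasStrictDerivAt 0 x |>.hasDerivAt
  simpa using (h1.const_sub (∫ y in (0:ℝ)..1, (1 - y) * g y)).deriv

lemma pc_diff {g : ℝ → ℝ} (hg : Continuous g) : Differentiable ℝ (pc g) := by
  intro x
  have h1 : HasDerivAt (fun x => ∫ y in (0:ℝ)..x, g y) (g x) x := hg.integral_hasStrictDerivAt 0 x |>.hasDerivAt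
  have h2 : HasDerivAt (fun x => ∫ y in (0:ℝ)..x, y * g y) (x * g x) x :=
    (continuous_id.mul hg).integral_hasStrictDerivAt 0 x |>.hasDerivAt
  exact ((((hasDerivAt_id x).mul_const (∫ y in (0:ℝ)..1, (1 - y) * g y)).sub ((hasDerivAt_id x).mul h1)).add h2).differentiableAt

lemma pc_diff2 {g : ℝ → ℝ} (hg : Continuous g) : Differentiable ℝ (deriv (pc g)) := by
  rw [pc_deriv hg]
  intro x
  have h1 : HasDerivAt (fun x => ∫ y in (0:ℝ)..x, g y) (g x) x := hg.integral_hasStrictDerivAt 0 x |>.hasDerivAt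
  exact (h1.const_sub (∫ y in (0:ℝ)..1, (1 - y) * g y)).differentiableAt

lemma contDiff_two {f : ℝ → ℝ} (h1 : Differentiable ℝ f) (h2 : Differentiable ℝ (deriv f))
    (h3 : Continuous (deriv (deriv f))) : ContDiff ℝ 2 f := by
  have : (2 : WithTop ℕ∞) = 1 + 1 := by norm_num
  rw [this, contDiff_succ_iff_deriv]
  refine ⟨h1, by simp, ?_⟩
  rw [contDiff_one_iff_deriv]
  exact ⟨h2, h3⟩

lemma of_contDiff_two {f : ℝ → ℝ} (h : ContDiff ℝ 2 f) :
    Differentiable ℝ f ∧ Differentiable ℝ (deriv f) ∧ Continuous (deriv (deriv f)) := by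
  have : (2 : WithTop ℕ∞) = 1 + 1 := by norm_num
  rw [this, contDiff_succ_iff_deriv] at h
  obtain ⟨h1, -, h2⟩ := h
  rw [contDiff_one_iff_deriv] at h2
  exact ⟨h1, h2⟩

lemma pc_contDiff {g : ℝ → ℝ} (hg : Continuous g) : ContDiff ℝ 2 (pc g) :=
  contDiff_two (pc_diff hg) (pc_diff2 hg) (by rw [pc_deriv2 hg]; exact hg.neg)

lemma pc_zero (g : ℝ → ℝ) : pc g 0 = 0 := by simp [pc]
lemma pc_one {g : ℝ → ℝ} (hg : Continuous g) : pc g 1 = 0 := by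
  have hk : IntervalIntegrable (fun y => y * g y) volume 0 1 :=
    (continuous_id.mul hg).intervalIntegrable 0 1
  have e3 : ∫ y in (0:ℝ)..1, (1-y) * g y = (∫ y in (0:ℝ)..1, g y) - ∫ y in (0:ℝ)..1, y * g y := by
    rw [← intervalIntegral.integral_sub (hg.intervalIntegrable _ _) hk]
    congr 1; ext y; ring
  unfold pc; rw [e3]; ring

lemma eq_Pot {f : ℝ → ℝ} (h : ContDiff ℝ 2 f) (h0 : f 0 = 0) (h1 : f 1 = 0) {x : ℝ}
    (hx : x ∈ Icc (0:ℝ) 1) : f x = Pot (fun y => - deriv (deriv f) y) x := by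
  obtain ⟨d1, d2, c⟩ := of_contDiff_two h
  obtain ⟨g, hgd⟩ : ∃ g : ℝ → ℝ, g = fun y => - deriv (deriv f) y := ⟨_, rfl⟩
  have hg : Continuous g := by rw [hgd]; exact c.neg
  rw [← hgd, pc_eq hg hx]
  have p2 := pc_deriv2 hg
  have dd : ∀ x, deriv (fun x => deriv f x - deriv (pc g) x) x = 0 := fun x => by
    rw [deriv_fun_sub (d2 x) (pc_diff2 hg x), p2, hgd]; simp
  have hc : ∀ x, deriv f x - deriv (pc g) x = deriv f 0 - deriv (pc g) 0 := fun x =>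
    is_const_of_deriv_eq_zero (d2.sub (pc_diff2 hg)) dd x 0
  obtain ⟨k, hkd⟩ : ∃ k, k = deriv f 0 - deriv (pc g) 0 := ⟨_, rfl⟩
  rw [← hkd] at hc
  have de : ∀ x, HasDerivAt (fun x => f x - pc g x - k * x) 0 x := fun x => by
    have := ((d1 x).hasDerivAt.sub (pc_diff hg x).hasDerivAt).sub ((hasDerivAt_id x).const_mul k)
    rw [hc x] at this
    convert! this using 1
    simp
  have he : ∀ x, f x - pc g x - k * x = 0 := fun x => by
    have := is_const_of_deriv_eq_zero (fun x => (de x).differentiableAt) (fun x => (de x).deriv) x 0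
    simpa [h0, pc_zero] using this
  have hk : k = 0 := by
    have := he 1
    rw [h1, pc_one hg] at this; linarith
  have := he x
  rw [hk] at this; linarith

end WFA
end

section
namespace WFA

lemma ae_of_null {m : Measure ℝ} (hs : m (Ioo (0:ℝ) 1)ᶜ = 0) : ∀ᵐ x ∂m, x ∈ Ioo (0:ℝ) 1 := by
  rw [ae_iff]; exact hs

lemma bint {m : Measure ℝ} [IsFiniteMeasure m] (hs : m (Ioo (0:ℝ) 1)ᶜ = 0) {f : ℝ → ℝ} (hf : Measurable f)
    {C : ℝ} (hb : ∀ x ∈ Ioo (0:ℝ) 1, |f x| ≤ C) : Integrable f m := by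
  refine Integrable.of_bound hf.aestronglyMeasurable C ?_
  filter_upwards [ae_of_null hs] with x hx using hb x hx

lemma bint_le {m : Measure ℝ} [IsFiniteMeasure m] (hs : m (Ioo (0:ℝ) 1)ᶜ = 0) {f : ℝ → ℝ}
    {C : ℝ} (hb : ∀ x ∈ Ioo (0:ℝ) 1, |f x| ≤ C) : |∫ x, f x ∂m| ≤ C * m.real univ := by
  have : ∀ᵐ x ∂m, ‖f x‖ ≤ C := by
    filter_upwards [ae_of_null hs] with x hx using hb x hx
  exact norm_integral_le_of_norm_le_const this

lemma int_congr_Ioo {m : Measure ℝ} (hs : m (Ioo (0:ℝ) 1)ᶜ = 0) {f g : ℝ → ℝ}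
    (h : ∀ x ∈ Ioo (0:ℝ) 1, f x = g x) : ∫ x, f x ∂m = ∫ x, g x ∂m := by
  apply integral_congr_ae
  filter_upwards [ae_of_null hs] with x hx using h x hx

lemma int_mono_Ioo {m : Measure ℝ} (hs : m (Ioo (0:ℝ) 1)ᶜ = 0) {f g : ℝ → ℝ}
    (hf : Integrable f m) (hg : Integrable g m)
    (h : ∀ x ∈ Ioo (0:ℝ) 1, f x ≤ g x) : ∫ x, f x ∂m ≤ ∫ x, g x ∂m := by
  apply integral_mono_ae hf hg
  filter_upwards [ae_of_null hs] with x hx using h x hx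

/-- weak measure-valued flow -/
structure WFlow (v : ℝ → ℝ) (D : ℝ) (μ : Measure ℝ) (p O : ℝ → Measure ℝ) : Prop where
  muf : IsFiniteMeasure μ
  mus : μ (Ioo (0:ℝ) 1)ᶜ = 0
  pf : ∀ t, IsFiniteMeasure (p t)
  ps : ∀ t, p t (Ioo (0:ℝ) 1)ᶜ = 0
  Of : ∀ t, IsFiniteMeasure (O t)
  Os : ∀ t, O t (Ioo (0:ℝ) 1)ᶜ = 0
  occ : ∀ f : ℝ → ℝ, Measurable f → (∃ C, ∀ x ∈ Ioo (0:ℝ) 1, |f x| ≤ C) → ∀ t, 0 ≤ t →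
    IntervalIntegrable (fun u => ∫ x, f x ∂(p u)) volume 0 t ∧
      ∫ u in (0:ℝ)..t, ∫ x, f x ∂(p u) = ∫ x, f x ∂(O t)
  eq : ∀ ψ : ℝ → ℝ, ContDiff ℝ 2 ψ → ψ 0 = 0 → ψ 1 = 0 → ∀ t, 0 ≤ t →
    ∫ x, ψ x ∂(p t) = ∫ x, ψ x ∂μ + D * ∫ x, (aa x * deriv (deriv ψ) x - v x * ψ x) ∂(O t)

lemma Pot_abs_le {g : ℝ → ℝ} (hg : Integrable g nu) {x : ℝ} (hx : x ∈ Ioo (0:ℝ) 1) :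
    |Pot g x| ≤ ∫ y, |g y| ∂nu := by
  suffices this : ∀ᵐ y ∂nu, ‖GG x y * g y‖ ≤ |g y| from norm_integral_le_of_norm_le hg.abs this
  filter_upwards [ae_nu] with y hy
  rw [norm_mul, Real.norm_eq_abs, Real.norm_eq_abs, abs_of_nonneg (GG_nonneg (Ioo_subset_Icc_self hx) (Ioo_subset_Icc_self hy))]
  exact mul_le_of_le_one_left (abs_nonneg _) (GG_le_one (Ioo_subset_Icc_self hx) (Ioo_subset_Icc_self hy))

lemma GG_bdd_ae {x : ℝ} (hx : x ∈ Ioo (0:ℝ) 1) : ∀ᵐ y ∂nu, ‖GG x y‖ ≤ 1 := by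
  filter_upwards [ae_nu] with y hy
  rw [Real.norm_eq_abs, abs_of_nonneg (GG_nonneg (Ioo_subset_Icc_self hx) (Ioo_subset_Icc_self hy))]
  exact GG_le_one (Ioo_subset_Icc_self hx) (Ioo_subset_Icc_self hy)

lemma GG_int {g : ℝ → ℝ} (hg : Integrable g nu) {x : ℝ} (hx : x ∈ Ioo (0:ℝ) 1) :
    Integrable (fun y => GG x y * g y) nu :=
  hg.bdd_mul (c := 1) ((continuous_GG.comp (Continuous.prodMk continuous_const continuous_id)).aestronglyMeasurable) (GG_bdd_ae hx)

lemma Pot_sub {g h : ℝ → ℝ} (hg : Integrable g nu) (hh : Integrable h nu) {x : ℝ} (hx : x ∈ Ioo (0:ℝ) 1) :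
    Pot g x - Pot h x = Pot (fun y => g y - h y) x := by
  unfold Pot
  rw [← integral_sub (GG_int hg hx) (GG_int hh hx)]
  congr 1; ext y; ring

variable {v : ℝ → ℝ} {D M : ℝ} {μ : Measure ℝ} {p O : ℝ → Measure ℝ}

lemma nu_null : nu (Ioo (0:ℝ) 1)ᶜ = 0 := by
  have := ae_nu; rwa [ae_iff] at this

lemma aa_abs {x : ℝ} (hx : x ∈ Ioo (0:ℝ) 1) : |aa x| ≤ 1 := by
  rw [abs_of_pos (aa_pos hx)]; exact aa_le_one x

lemma WFlow.ext_eq (hD : 0 < D) (hv : BV v M) (W : WFlow v D μ p O) {g : ℝ → ℝ} (hg : Measurable g) {C : ℝ}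
    (hb : ∀ x ∈ Ioo (0:ℝ) 1, |g x| ≤ C) {t : ℝ} (ht : 0 ≤ t) :
    ∫ x, Pot g x ∂(p t) = ∫ x, Pot g x ∂μ - D * ∫ x, (aa x * g x + v x * Pot g x) ∂(O t) := by
  have := W.muf; have := W.pf t; have := W.Of t
  have hgn : Integrable g nu := bint nu_null hg hb
  have hgO : Integrable g (O t) := bint (W.Os t) hg hb
  have hPm : Measurable (Pot g) := PP_meas hg
  have hPb : ∀ x ∈ Ioo (0:ℝ) 1, |Pot g x| ≤ ∫ y, |g y| ∂nu := fun x hx => Pot_abs_le hgn hx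
  have hM := hv.M_nonneg
  rw [← sub_eq_zero]
  set A := ∫ x, Pot g x ∂(p t) - (∫ x, Pot g x ∂μ - D * ∫ x, (aa x * g x + v x * Pot g x) ∂(O t)) with hA
  set K := (p t).real univ + μ.real univ + D * (1 + M * (O t).real univ) with hK
  have hK0 : 0 ≤ K := by positivity
  suffices h : ∀ ε > 0, |A| ≤ ε * K by
    by_contra hne
    have hpos : 0 < |A| := abs_pos.2 hne
    have h2 := h (|A| / (2 * (K+1))) (by positivity)
    rw [div_mul_eq_mul_div, le_div_iff₀ (by positivity)] at h2
    nlinarith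
  intro ε hε
  have hgm : Integrable g (nu + O t) := hgn.add_measure hgO
  obtain ⟨q, hq1, hq2⟩ := hgm.exists_boundedContinuous_integral_sub_le hε
  have qc : Continuous q := q.continuous
  have qn : Integrable q nu := by simpa using q.integrable nu
  have qO : Integrable q (O t) := by simpa using q.integrable (O t)
  have i1 : Integrable (fun x => ‖g x - q x‖) nu := (hgn.sub qn).norm
  have i2 : Integrable (fun x => ‖g x - q x‖) (O t) := (hgO.sub qO).norm
  rw [integral_add_measure i1 i2] at hq1
  have n1 : 0 ≤ ∫ x, ‖g x - q x‖ ∂nu := integral_nonneg fun x => norm_nonneg _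
  have n2 : 0 ≤ ∫ x, ‖g x - q x‖ ∂(O t) := integral_nonneg fun x => norm_nonneg _
  have hd : ∀ x ∈ Ioo (0:ℝ) 1, |Pot g x - Pot q x| ≤ ε := fun x hx => by
    rw [Pot_sub hgn qn hx]
    refine (Pot_abs_le (hgn.sub qn) hx).trans ?_
    simp only [Real.norm_eq_abs] at hq1 n2 n1
    simp only [Pi.sub_apply]
    linarith
  have hQm : Measurable (Pot q) := PP_meas qc.measurable
  have hQb : ∀ x ∈ Ioo (0:ℝ) 1, |Pot q x| ≤ ∫ y, |q y| ∂nu := fun x hx => Pot_abs_le qn hx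
  have e := W.eq (pc q) (pc_contDiff qc) (pc_zero q) (pc_one qc) t ht
  have e0 : ∀ {m : Measure ℝ} (hs : m (Ioo (0:ℝ) 1)ᶜ = 0), ∫ x, pc q x ∂m = ∫ x, Pot q x ∂m := fun hs =>
    int_congr_Ioo hs fun x hx => (pc_eq qc (Ioo_subset_Icc_self hx)).symm
  rw [e0 (W.ps t), e0 W.mus, int_congr_Ioo (W.Os t) (g := fun x => -(aa x * q x + v x * Pot q x))
    (fun x hx => by rw [pc_deriv2 qc, pc_eq qc (Ioo_subset_Icc_self hx)]; ring), integral_neg] at e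
  have a1 : |∫ x, Pot g x ∂(p t) - ∫ x, Pot q x ∂(p t)| ≤ ε * (p t).real univ := by
    rw [← integral_sub (bint (W.ps t) hPm hPb) (bint (W.ps t) hQm hQb)]
    exact bint_le (W.ps t) hd
  have a2 : |∫ x, Pot g x ∂μ - ∫ x, Pot q x ∂μ| ≤ ε * μ.real univ := by
    rw [← integral_sub (bint W.mus hPm hPb) (bint W.mus hQm hQb)]
    exact bint_le W.mus hd
  have vPb : ∀ {f : ℝ → ℝ} {C : ℝ}, Measurable f → (∀ x ∈ Ioo (0:ℝ) 1, |f x| ≤ C) → Integrable (fun x => v x * f x) (O t) :=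
    fun hf hb => (bint (W.Os t) hf hb).bdd_mul (c := M) hv.meas.aestronglyMeasurable (Eventually.of_forall fun x => hv.abs_le x)
  have aab : ∀ {f : ℝ → ℝ}, Integrable f (O t) → Integrable (fun x => aa x * f x) (O t) :=
    fun hf => hf.bdd_mul (c := 1) measurable_aa.aestronglyMeasurable (by
      filter_upwards [ae_of_null (W.Os t)] with x hx using aa_abs hx)
  have a3 : |∫ x, (aa x * g x + v x * Pot g x) ∂(O t) - ∫ x, (aa x * q x + v x * Pot q x) ∂(O t)| ≤ ε * (1 + M * (O t).real univ) := by
    rw [integral_add (aab hgO) (vPb hPm hPb), integral_add (aab qO) (vPb hQm hQb)]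
    have b1 : |∫ x, aa x * g x ∂(O t) - ∫ x, aa x * q x ∂(O t)| ≤ ε := by
      rw [← integral_sub (aab hgO) (aab qO)]
      suffices hh : ∀ᵐ x ∂(O t), ‖aa x * g x - aa x * q x‖ ≤ ‖g x - q x‖ from
        (norm_integral_le_of_norm_le i2 hh).trans (by linarith)
      filter_upwards [ae_of_null (W.Os t)] with x hx
      rw [← mul_sub, norm_mul]
      exact mul_le_of_le_one_left (norm_nonneg _) (aa_abs hx)
    have b2 : |∫ x, v x * Pot g x ∂(O t) - ∫ x, v x * Pot q x ∂(O t)| ≤ (M * ε) * (O t).real univ := by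
      rw [← integral_sub (vPb hPm hPb) (vPb hQm hQb)]
      refine bint_le (W.Os t) fun x hx => ?_
      rw [← mul_sub, abs_mul]
      exact mul_le_mul (hv.abs_le x) (hd x hx) (abs_nonneg _) hM
    rw [abs_le] at b1 b2 ⊢
    constructor <;> nlinarith [b1.1, b1.2, b2.1, b2.2]
  rw [abs_le] at a1 a2 a3 ⊢
  constructor <;> simp only [hA, hK] <;> nlinarith [a1.1, a1.2, a2.1, a2.2, mul_le_mul_of_nonneg_left a3.1 hD.le, mul_le_mul_of_nonneg_left a3.2 hD.le]

/-- `F` solves `-aa F'' + v F = e` with zero boundary values -/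
structure Sol (v F e : ℝ → ℝ) : Prop where
  Fm : Measurable F
  em : Measurable e
  eb : ∃ C, ∀ x ∈ Ioo (0:ℝ) 1, |e x| ≤ C * aa x
  Fb : ∃ C, ∀ x ∈ Ioo (0:ℝ) 1, |F x| ≤ C * aa x
  ex : ∃ g : ℝ → ℝ, Measurable g ∧ (∃ C, ∀ x ∈ Ioo (0:ℝ) 1, |g x| ≤ C) ∧ (∀ x ∈ Ioo (0:ℝ) 1, F x = Pot g x) ∧
    ∀ x ∈ Ioo (0:ℝ) 1, aa x * g x + v x * F x = e x

lemma bdd_of_aa {f : ℝ → ℝ} (h : ∃ C, ∀ x ∈ Ioo (0:ℝ) 1, |f x| ≤ C * aa x) : ∃ C, ∀ x ∈ Ioo (0:ℝ) 1, |f x| ≤ C := by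
  obtain ⟨C, hC⟩ := h
  refine ⟨|C|, fun x hx => (hC x hx).trans ?_⟩
  have := aa_pos hx; have := aa_le_one x
  nlinarith [le_abs_self C, abs_nonneg C]

lemma WFlow.sol (hD : 0 < D) (hv : BV v M) (W : WFlow v D μ p O) {F e : ℝ → ℝ} (h : Sol v F e) {t : ℝ} (ht : 0 ≤ t) :
    ∫ x, F x ∂(p t) = ∫ x, F x ∂μ - D * ∫ u in (0:ℝ)..t, ∫ x, e x ∂(p u) := by
  obtain ⟨g, hg, ⟨C, hC⟩, hF, he⟩ := h.ex
  have := W.ext_eq hD hv hg hC ht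
  rw [(W.occ e h.em (bdd_of_aa h.eb) t ht).2, int_congr_Ioo (W.ps t) hF, int_congr_Ioo W.mus hF, this,
    int_congr_Ioo (W.Os t) fun x hx => show e x = aa x * g x + v x * Pot g x by rw [← he x hx, hF x hx]]

end WFA
end

section
namespace WFA
variable {v : ℝ → ℝ} {D M : ℝ} {μ : Measure ℝ} {p O : ℝ → Measure ℝ}

lemma Pot_le_aa {g : ℝ → ℝ} {C : ℝ} (hb : ∀ x ∈ Ioo (0:ℝ) 1, |g x| ≤ C) {x : ℝ} (hx : x ∈ Ioo (0:ℝ) 1) :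
    |Pot g x| ≤ C * aa x := by
  have : ∀ᵐ y ∂nu, ‖GG x y * g y‖ ≤ C * aa x := by
    filter_upwards [ae_nu] with y hy
    rw [norm_mul, Real.norm_eq_abs, Real.norm_eq_abs, abs_of_nonneg (GG_nonneg (Ioo_subset_Icc_self hx) (Ioo_subset_Icc_self hy)), mul_comm C]
    exact mul_le_mul (GG_le_aa (Ioo_subset_Icc_self hx) (Ioo_subset_Icc_self hy)) (hb y hy) (abs_nonneg _) (aa_pos hx).le
  unfold Pot; simpa using norm_integral_le_of_norm_le_const this

lemma Sol.mk2 (hv : BV v M) {F e g : ℝ → ℝ} (hF : Measurable F) (he : Measurable e) (hg : Measurable g) {C : ℝ}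
    (hb : ∀ x ∈ Ioo (0:ℝ) 1, |g x| ≤ C) (h1 : ∀ x ∈ Ioo (0:ℝ) 1, F x = Pot g x)
    (h2 : ∀ x ∈ Ioo (0:ℝ) 1, aa x * g x + v x * F x = e x) : Sol v F e where
  Fm := hF
  em := he
  Fb := ⟨C, fun x hx => by rw [h1 x hx]; exact Pot_le_aa hb hx⟩
  eb := ⟨C + M * C, fun x hx => by
    rw [← h2 x hx, h1 x hx]
    have a1 := aa_pos hx
    have b1 : |aa x * g x| ≤ C * aa x := by
      rw [abs_mul, abs_of_pos a1, mul_comm]; exact mul_le_mul_of_nonneg_right (hb x hx) a1.le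
    have b2 : |v x * Pot g x| ≤ M * (C * aa x) := by
      rw [abs_mul]; exact mul_le_mul (hv.abs_le x) (Pot_le_aa hb hx) (abs_nonneg _) hv.M_nonneg
    calc _ ≤ |aa x * g x| + |v x * Pot g x| := abs_add_le _ _
      _ ≤ _ := by linarith⟩
  ex := ⟨g, hg, ⟨C, hb⟩, h1, h2⟩

lemma Sol.of_C2 (hv : BV v M) {q : ℝ → ℝ} (hq : ContDiff ℝ 2 q) (h0 : q 0 = 0) (h1 : q 1 = 0) :
    Sol v q (fun x => - (aa x * deriv (deriv q) x) + v x * q x) := by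
  obtain ⟨-, -, c⟩ := of_contDiff_two hq
  obtain ⟨C, hC⟩ := (isCompact_Icc (a := (0:ℝ)) (b := 1)).exists_bound_of_continuousOn c.neg.continuousOn
  refine Sol.mk2 hv hq.continuous.measurable ?_ c.neg.measurable (C := C) (fun x hx => hC x (Ioo_subset_Icc_self hx))
    (fun x hx => eq_Pot hq h0 h1 (Ioo_subset_Icc_self hx)) (fun x hx => by simp)
  exact (measurable_aa.mul c.measurable).neg.add (hv.meas.mul hq.continuous.measurable)

lemma Sol.lin (hv : BV v M) {F e F' e' : ℝ → ℝ} (h : Sol v F e) (h' : Sol v F' e') (k k' : ℝ) :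
    Sol v (fun x => k * F x - k' * F' x) (fun x => k * e x - k' * e' x) := by
  obtain ⟨g, hg, ⟨C, hC⟩, hF, he⟩ := h.ex
  obtain ⟨g', hg', ⟨C', hC'⟩, hF', he'⟩ := h'.ex
  refine Sol.mk2 hv (g := fun x => k * g x - k' * g' x) (C := |k| * C + |k'| * C') ?_ ?_ ?_ ?_ ?_ ?_
  · exact (h.Fm.const_mul k).sub (h'.Fm.const_mul k')
  · exact (h.em.const_mul k).sub (h'.em.const_mul k')
  · exact (hg.const_mul k).sub (hg'.const_mul k')
  · intro x hx
    refine (abs_sub _ _).trans ?_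
    rw [abs_mul, abs_mul]
    exact add_le_add (mul_le_mul_of_nonneg_left (hC x hx) (abs_nonneg _)) (mul_le_mul_of_nonneg_left (hC' x hx) (abs_nonneg _))
  · intro x hx
    rw [hF x hx, hF' x hx, ← Pot_sub ((bint nu_null hg hC).const_mul k) ((bint nu_null hg' hC').const_mul k') hx]
    unfold Pot
    rw [← integral_const_mul, ← integral_const_mul]
    congr 1 <;> (congr 1; ext y; ring)
  · intro x hx
    rw [← he x hx, ← he' x hx]; ring

lemma deriv2_aa : deriv (deriv aa) = fun _ => (-2:ℝ) := by
  have h1 : deriv aa = fun x => 1 - 2 * x := by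
    ext x
    have := ((hasDerivAt_id x).mul ((hasDerivAt_id x).const_sub 1)).deriv
    unfold aa
    convert! this using 1
    simp; ring
  rw [h1]; ext x
  simp

lemma aa_C2 : ContDiff ℝ 2 aa := by unfold aa; fun_prop

lemma Sol.sol_aa (hv : BV v M) : Sol v aa (fun x => (2 + v x) * aa x) := by
  have := Sol.of_C2 hv aa_C2 (by simp [aa]) (by simp [aa])
  rw [deriv2_aa] at this
  convert this using 2; ring

lemma Sol.eint {F e : ℝ → ℝ} (h : Sol v F e) (W : WFlow v D μ p O) (t : ℝ) : Integrable e (p t) := by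
  have := W.pf t
  obtain ⟨C, hC⟩ := bdd_of_aa h.eb
  exact bint (W.ps t) h.em hC

lemma Sol.Fint {F e : ℝ → ℝ} (h : Sol v F e) (W : WFlow v D μ p O) (t : ℝ) : Integrable F (p t) := by
  have := W.pf t
  obtain ⟨C, hC⟩ := bdd_of_aa h.Fb
  exact bint (W.ps t) h.Fm hC

lemma aa_bd : ∃ C, ∀ x ∈ Ioo (0:ℝ) 1, |aa x| ≤ C := ⟨1, fun _ hx => aa_abs hx⟩

lemma WFlow.decay (hD : 0 < D) (hv : BV v M) (W : WFlow v D μ p O) {t : ℝ} (ht : 0 < t) :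
    ∫ x, aa x ∂(p t) ≤ (∫ x, aa x ∂μ) / (2 * D * t) := by
  have S := Sol.sol_aa hv
  set E : ℝ → ℝ := fun u => ∫ x, (2 + v x) * aa x ∂(p u) with hE
  set y : ℝ → ℝ := fun u => ∫ x, aa x ∂(p u) with hy
  have hEi := fun t ht => (W.occ _ S.em (bdd_of_aa S.eb) t ht).1
  have hyi := fun t ht => (W.occ _ measurable_aa aa_bd t ht).1
  have hy0 : ∀ u, 0 ≤ y u := fun u => integral_nonneg_of_ae (by
    filter_upwards [ae_of_null (W.ps u)] with x hx using (aa_pos hx).le)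
  have hEy : ∀ u, 2 * y u ≤ E u := fun u => by
    simp only [hy, hE]
    rw [← integral_const_mul]
    exact int_mono_Ioo (W.ps u) ((S.Fint W u).const_mul 2) (S.eint W u) fun x hx => by
      have := aa_pos hx; have := hv.nonneg x; nlinarith
  have e := fun t ht => W.sol hD hv S (t := t) ht
  have mono : ∀ u ∈ Icc 0 t, y t ≤ y u := fun u hu => by
    have e1 := e u hu.1; have e2 := e t ht.le
    have : (0:ℝ) ≤ ∫ w in u..t, E w := intervalIntegral.integral_nonneg hu.2 fun w _ => by
      linarith [hEy w, hy0 w]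
    have hs : (∫ w in (0:ℝ)..u, E w) + ∫ w in u..t, E w = ∫ w in (0:ℝ)..t, E w :=
      intervalIntegral.integral_add_adjacent_intervals (hEi u hu.1) ((hEi u hu.1).symm.trans (hEi t ht.le))
    simp only [hy]
    rw [e1, e2]; change _ - D * (∫ w in (0:ℝ)..t, E w) ≤ _ - D * ∫ w in (0:ℝ)..u, E w
    nlinarith
  have h1 : t * y t ≤ ∫ u in (0:ℝ)..t, y u := by
    have := intervalIntegral.integral_mono_on ht.le intervalIntegrable_const (hyi t ht.le) mono
    simpa using this
  have h2 : 2 * ∫ u in (0:ℝ)..t, y u ≤ ∫ u in (0:ℝ)..t, E u := by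
    rw [← intervalIntegral.integral_const_mul]
    exact intervalIntegral.integral_mono_on ht.le ((hyi t ht.le).const_mul 2) (hEi t ht.le) fun u _ => hEy u
  have h3 : y t = ∫ x, aa x ∂μ - D * ∫ u in (0:ℝ)..t, E u := e t ht.le
  change y t ≤ _
  rw [le_div_iff₀ (by positivity)]
  have := hy0 t
  nlinarith

lemma WFlow.decay_tendsto (hD : 0 < D) (hv : BV v M) (W : WFlow v D μ p O) {F : ℝ → ℝ}
    (hF : ∃ C, ∀ x ∈ Ioo (0:ℝ) 1, |F x| ≤ C * aa x) :
    Tendsto (fun t => ∫ x, F x ∂(p t)) atTop (𝓝 0) := by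
  obtain ⟨C, hC⟩ := hF
  have hC0 : 0 ≤ C := by
    have h2 := aa_pos (x := 1/2) (by norm_num)
    have := (abs_nonneg _).trans (hC (1/2) (by norm_num))
    exact nonneg_of_mul_nonneg_left this h2
  refine squeeze_zero_norm' (a := fun t => C * ((∫ x, aa x ∂μ) / (2 * D * t))) ?_ ?_
  · filter_upwards [eventually_gt_atTop 0] with t ht
    have := W.pf t
    have h1 : ∀ᵐ x ∂(p t), ‖F x‖ ≤ C * aa x := by
      filter_upwards [ae_of_null (W.ps t)] with x hx using hC x hx
    refine (norm_integral_le_of_norm_le (((Sol.sol_aa hv).Fint W t).const_mul C) h1).trans ?_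
    rw [integral_const_mul]
    exact mul_le_mul_of_nonneg_left (W.decay hD hv ht) hC0
  · have : Tendsto (fun t : ℝ => 2 * D * t) atTop atTop := tendsto_id.const_mul_atTop (by positivity)
    simpa using (this.const_div_atTop (∫ x, aa x ∂μ)).const_mul C

lemma int_ode {y : ℝ → ℝ} {c k : ℝ} (hi : ∀ t, 0 ≤ t → IntervalIntegrable y volume 0 t)
    (h : ∀ t, 0 ≤ t → y t = c - k * ∫ u in (0:ℝ)..t, y u) : ∀ t, 0 ≤ t → y t = Real.exp (-(k * t)) * c := by
  have hc : ∀ T, 0 ≤ T → ContinuousOn y (Icc 0 T) := fun T hT => by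
    have h1 : ContinuousOn (fun t => c - k * ∫ u in (0:ℝ)..t, y u) (Icc 0 T) := by
      refine continuousOn_const.sub (continuousOn_const.mul ?_)
      have := intervalIntegral.continuousOn_primitive_interval (a := 0) (b := T) (μ := volume) (f := y)
        (by rw [uIcc_of_le hT]; exact (intervalIntegrable_iff_integrableOn_Icc_of_le hT).1 (hi T hT))
      rwa [uIcc_of_le hT] at this
    exact h1.congr fun t ht => h t ht.1
  intro t ht
  set z : ℝ → ℝ := fun u => y (max u 0) with hz
  have zc : Continuous z := by
    refine continuous_iff_continuousAt.2 fun u => ?_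
    have hT : 0 ≤ |u| + 1 := by positivity
    have h1 : ContinuousOn z (Iic (|u|+1)) := by
      refine (hc _ hT).comp (continuous_id.max continuous_const).continuousOn fun w hw => ⟨le_max_right _ _, max_le hw hT⟩
    exact h1.continuousAt (Iic_mem_nhds (by linarith [le_abs_self u]))
  have hzi : ∀ t, 0 ≤ t → ∫ u in (0:ℝ)..t, z u = ∫ u in (0:ℝ)..t, y u := fun t ht => by
    apply intervalIntegral.integral_congr
    intro u hu
    rw [uIcc_of_le ht] at hu
    simp [hz, max_eq_left hu.1]
  have hd : ∀ t, HasDerivAt (fun t => Real.exp (k*t) * (c - k * ∫ u in (0:ℝ)..t, z u))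
      (Real.exp (k*t) * k * (c - k * ∫ u in (0:ℝ)..t, z u) + Real.exp (k*t) * (- (k * z t))) t := fun t => by
    have h1 : HasDerivAt (fun t => ∫ u in (0:ℝ)..t, z u) (z t) t := (zc.integral_hasStrictDerivAt 0 t).hasDerivAt
    have h2 : HasDerivAt (fun t => Real.exp (k*t)) (Real.exp (k*t) * k) t := by
      simpa using ((hasDerivAt_id t).const_mul k).exp
    exact h2.mul ((h1.const_mul k).const_sub c)
  have hconst := constant_of_has_deriv_right_zero (a := 0) (b := t) (fun u _ => (hd u).continuousAt.continuousWithinAt)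
    (fun u hu => by
      have := (hd u).hasDerivWithinAt (s := Ici u)
      rw [hzi u hu.1, ← h u hu.1] at this
      simp only [hz, max_eq_left hu.1] at this
      convert this using 1; ring) t ⟨ht, le_rfl⟩
  simp only [hzi t ht, ← h t ht] at hconst
  simp at hconst
  rw [Real.exp_neg, ← hconst, inv_mul_cancel_left₀ (Real.exp_ne_zero _)]

lemma WFlow.eig (hD : 0 < D) (hv : BV v M) (W : WFlow v D μ p O) {F : ℝ → ℝ} {l : ℝ}
    (h : Sol v F (fun x => l * F x)) {t : ℝ} (ht : 0 ≤ t) :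
    ∫ x, F x ∂(p t) = Real.exp (-(D * l * t)) * ∫ x, F x ∂μ := by
  refine int_ode (y := fun t => ∫ x, F x ∂(p t)) (fun t ht => (W.occ _ h.Fm (bdd_of_aa h.Fb) t ht).1) (fun t ht => ?_) t ht
  rw [W.sol hD hv h ht]
  simp only [integral_const_mul, intervalIntegral.integral_const_mul]
  ring

def FlowEx (v : ℝ → ℝ) (D : ℝ) : Prop := ∀ x ∈ Ioo (0:ℝ) 1, ∃ p O, WFlow v D (Measure.dirac x) p O

lemma Sol.nonneg (hD : 0 < D) (hv : BV v M) (hE : FlowEx v D) {F e : ℝ → ℝ} (h : Sol v F e)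
    (he : ∀ x ∈ Ioo (0:ℝ) 1, 0 ≤ e x) : ∀ x ∈ Ioo (0:ℝ) 1, 0 ≤ F x := by
  intro x hx
  obtain ⟨p, O, W⟩ := hE x hx
  refine le_of_tendsto (W.decay_tendsto hD hv h.Fb) ?_
  filter_upwards [eventually_ge_atTop 0] with t ht
  rw [W.sol hD hv h ht, integral_dirac]
  have : (0:ℝ) ≤ ∫ u in (0:ℝ)..t, ∫ x, e x ∂(p u) := intervalIntegral.integral_nonneg ht fun w _ =>
    integral_nonneg_of_ae (by filter_upwards [ae_of_null (W.ps w)] with x hx using he x hx)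
  nlinarith

lemma Sol.eig_pos (hD : 0 < D) (hv : BV v M) (hE : FlowEx v D) {F : ℝ → ℝ} {l : ℝ} (h : Sol v F (fun x => l * F x))
    {x : ℝ} (hx : x ∈ Ioo (0:ℝ) 1) (hF : F x ≠ 0) : 0 < l := by
  obtain ⟨p, O, W⟩ := hE x hx
  by_contra hl
  push Not at hl
  have h1 := (W.decay_tendsto hD hv h.Fb).abs
  rw [abs_zero] at h1
  have : |F x| ≤ 0 := ge_of_tendsto h1 (by
    filter_upwards [eventually_ge_atTop 0] with t ht
    rw [W.eig hD hv h ht, integral_dirac, abs_mul, abs_of_pos (Real.exp_pos _)]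
    refine le_mul_of_one_le_left (abs_nonneg _) (Real.one_le_exp ?_)
    have : D * l * t = l * (D * t) := by ring
    rw [this]
    have : 0 ≤ D * t := by positivity
    nlinarith)
  exact hF (abs_nonpos_iff.1 this)

end WFA
end

section
namespace WFA
variable {v : ℝ → ℝ} {D M : ℝ} {μ : Measure ℝ} {p O : ℝ → Measure ℝ}

lemma HH_meas (f : HH) : Measurable f := (Lp.stronglyMeasurable f).measurable

lemma PP_le1 {f : ℝ → ℝ} (hf : Integrable f nu) {x : ℝ} (hx : x ∈ Ioo (0:ℝ) 1) :
    |PP f x| ≤ sa x * ∫ y, |f y| ∂nu := by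
  rw [PP_eq _ hx, abs_mul, abs_of_pos (sa_pos hx)]
  refine mul_le_mul_of_nonneg_left ?_ (sa_nonneg x)
  have h1 : ∀ᵐ y ∂nu, ‖kk x y * f y‖ ≤ |f y| := Eventually.of_forall fun y => by
    rw [norm_mul]
    exact mul_le_of_le_one_left (norm_nonneg _) (kkB.bdd x y)
  exact norm_integral_le_of_norm_le hf.abs h1

lemma PP_measurable {f : ℝ → ℝ} (hf : Measurable f) : Measurable (PP f) := PP_meas (hf.div measurable_sa)

lemma div_sa_le {F : ℝ → ℝ} {C : ℝ} {x : ℝ} (hx : x ∈ Ioo (0:ℝ) 1) (h : |F x| ≤ C * aa x) : |F x / sa x| ≤ C * sa x := by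
  have := sa_pos hx
  rw [abs_div, abs_of_pos this, div_le_iff₀ this, mul_assoc, sa_sq hx]; exact h

lemma sol_of (hv : BV v M) {f : ℝ → ℝ} (hf : Measurable f) {C : ℝ} (hfb : ∀ x ∈ Ioo (0:ℝ) 1, |f x| ≤ C * sa x)
    (u : HH) (hu : u =ᵐ[nu] fun x => PP (fun y => f y - v y * u y) x / sa x) :
    Sol v (PP (fun y => f y - v y * u y)) (fun x => sa x * f x) := by
  set h : ℝ → ℝ := fun y => f y - v y * u y with hh
  have hm : Measurable h := hf.sub (hv.meas.mul (HH_meas u))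
  have hfb' : ∀ x ∈ Ioo (0:ℝ) 1, |f x| ≤ |C| := fun x hx => (hfb x hx).trans (by
    nlinarith [sa_pos hx, sa_le_one x, le_abs_self C, abs_nonneg C])
  have hvu : Integrable (fun y => v y * u y) nu := (HH_integrable u).bdd_mul (c := M) hv.meas.aestronglyMeasurable
    (Eventually.of_forall fun x => hv.abs_le x)
  have hi : Integrable h nu := (bint nu_null hf hfb').sub hvu
  have hub : ∀ᵐ y ∂nu, |u y| ≤ ∫ y, |h y| ∂nu := by
    filter_upwards [hu, ae_nu] with x h1 hx
    rw [h1, abs_div, abs_of_pos (sa_pos hx), div_le_iff₀ (sa_pos hx), mul_comm]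
    exact PP_le1 hi hx
  have hhb : ∀ᵐ y ∂nu, |h y| ≤ |C| + M * ∫ y, |h y| ∂nu := by
    filter_upwards [hub, ae_nu] with y h1 hy
    refine (abs_sub _ _).trans (add_le_add (hfb' y hy) ?_)
    rw [abs_mul]; exact mul_le_mul (hv.abs_le y) h1 (abs_nonneg _) hv.M_nonneg
  have hFb := fun x hx => PP_le_of_bdd hhb (x := x) hx
  set C2 := (|C| + M * ∫ y, |h y| ∂nu) * c1
  refine Sol.mk2 hv (g := fun x => (sa x * f x - v x * PP h x) / aa x) (C := C + M * C2) (PP_measurable hm)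
    (measurable_sa.mul hf) ?_ ?_ ?_ ?_
  · exact ((measurable_sa.mul hf).sub (hv.meas.mul (PP_measurable hm))).div measurable_aa
  · intro x hx
    have a1 := aa_pos hx
    rw [abs_div, abs_of_pos a1, div_le_iff₀ a1]
    refine (abs_sub _ _).trans ?_
    rw [abs_mul, abs_mul, abs_of_pos (sa_pos hx), add_mul]
    refine add_le_add ?_ ?_
    · rw [← sa_sq hx, ← mul_assoc, mul_comm]; exact mul_le_mul_of_nonneg_right (hfb x hx) (sa_nonneg x)
    · rw [mul_assoc]; exact mul_le_mul (hv.abs_le x) (hFb x hx) (abs_nonneg _) hv.M_nonneg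
  · intro x hx
    unfold PP Pot
    apply integral_congr_ae
    filter_upwards [hu, ae_nu] with y h1 hy
    have h2 : PP h y = u y * sa y := by rw [h1]; field_simp [(sa_pos hy).ne']
    change GG x y * (h y / sa y) = GG x y * ((sa y * f y - v y * PP h y) / aa y)
    rw [h2, ← sa_sq hy, hh]
    have := (sa_pos hy).ne'
    field_simp
  · intro x hx
    have := (aa_pos hx).ne'
    field_simp; ring

lemma TT_sub_ae (hv : BV v M) (f u : HH) : (f - hv.op u : HH) =ᵐ[nu] fun y => f y - v y * u y := by
  filter_upwards [Lp.coeFn_sub f (hv.op u), hv.op_ae u] with y h1 h2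
  rw [h1, Pi.sub_apply, h2]

lemma rep_ae (hv : BV v M) {f u : HH} (hu : u = TT (f - hv.op u)) :
    u =ᵐ[nu] fun x => PP (fun y => f y - v y * u y) x / sa x := by
  have h := TT_ae (f - hv.op u)
  rw [← hu] at h
  filter_upwards [h] with x hx
  rw [hx, PP_congr (TT_sub_ae hv f u)]

/-- pointwise representative of an eigenvector, multiplied by `sa` -/
lemma eig_sol (hv : BV v M) {l : ℝ} {u : HH} (hu : u = TT (l • u - hv.op u)) :
    ∃ F : ℝ → ℝ, Sol v F (fun x => l * F x) ∧ (∀ x ∈ Ioo (0:ℝ) 1, F x = PP (l • u - hv.op u : HH) x) ∧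
      u =ᵐ[nu] fun x => F x / sa x := by
  have h := TT_ae (l • u - hv.op u)
  rw [← hu] at h
  set w : HH := l • u - hv.op u with hw
  have hwa : w =ᵐ[nu] fun y => (l - v y) * u y := by
    filter_upwards [TT_sub_ae hv (l • u) u, Lp.coeFn_smul l u] with y h1 h2
    rw [h1, h2, Pi.smul_apply, smul_eq_mul]; ring
  have hub : ∀ᵐ y ∂nu, |u y| ≤ ‖w‖ := by
    filter_upwards [h, ae_nu] with x h1 hx
    rw [h1, abs_div, abs_of_pos (sa_pos hx), div_le_iff₀ (sa_pos hx), mul_comm]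
    exact PP_le w hx
  have hwb : ∀ᵐ y ∂nu, |w y| ≤ (|l| + M) * ‖w‖ := by
    filter_upwards [hub, hwa] with y h1 h2
    rw [h2, abs_mul]
    refine mul_le_mul ((abs_sub _ _).trans (add_le_add le_rfl (hv.abs_le y))) h1 (abs_nonneg _) ?_
    have := hv.M_nonneg; positivity
  have hFb := fun x hx => PP_le_of_bdd hwb (x := x) hx
  set C2 := (|l| + M) * ‖w‖ * c1
  have hFm : Measurable (PP w) := PP_measurable (HH_meas w)
  have key : PP (fun y => l * (PP w y / sa y) - v y * u y) = PP w := by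
    ext x
    apply PP_congr
    filter_upwards [hwa, h] with y h1 h2
    rw [h1, ← h2]; ring
  refine ⟨PP w, ?_, fun _ _ => rfl, h⟩
  have S := sol_of hv (f := fun y => l * (PP w y / sa y)) ((hFm.div measurable_sa).const_mul l) (C := |l| * C2)
    (fun x hx => by
      rw [abs_mul, mul_assoc]
      exact mul_le_mul_of_nonneg_left (div_sa_le hx (hFb x hx)) (abs_nonneg _)) u (by rw [key]; exact h)
  rw [key] at S
  obtain ⟨g, hg, ⟨C, hC⟩, hF, he⟩ := S.ex
  refine Sol.mk2 hv hFm (hFm.const_mul l) hg hC hF fun x hx => ?_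
  rw [he x hx]
  have := (sa_pos hx).ne'
  field_simp

lemma Sol.zero_of (hD : 0 < D) (hv : BV v M) (hE : FlowEx v D) {F : ℝ → ℝ} (h : Sol v F (fun x => 0 * F x)) :
    ∀ x ∈ Ioo (0:ℝ) 1, F x = 0 := by
  intro x hx
  by_contra hne
  exact lt_irrefl _ (h.eig_pos hD hv hE hx hne)

lemma exists_K (hD : 0 < D) (hv : BV v M) (hE : FlowEx v D) :
    ∃ K : HH →L[ℝ] HH, IsCompactOperator K ∧ (∀ f g : HH, inner ℝ (K f) g = inner ℝ f (K g)) ∧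
      ∀ f u : HH, K f = u ↔ u = TT (f - hv.op u) := by
  set T : HH →L[ℝ] HH := TT ∘L hv.op with hT
  have hTc : IsCompactOperator T := TT_compact.comp_clm hv.op
  have hne : ¬ Module.End.HasEigenvalue (T : Module.End ℝ HH) (-1) := by
    intro h
    obtain ⟨u, hu⟩ := h.exists_hasEigenvector
    have h1 : TT (hv.op u) = - u := by
      have := hu.apply_eq_smul
      simpa [hT] using this
    have h2 : u = TT ((0:ℝ) • u - hv.op u) := by
      rw [zero_smul, zero_sub, map_neg, h1, neg_neg]
    obtain ⟨F, hF, -, hua⟩ := eig_sol hv h2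
    have hz := hF.zero_of hD hv hE
    apply hu.2
    refine Lp.ext ?_
    filter_upwards [hua, ae_nu, Lp.coeFn_zero ℝ 2 nu] with x h1 hx h3
    rw [h1, hz x hx, zero_div, h3]; rfl
  have hr := (hTc.hasEigenvalue_or_mem_resolventSet (μ := (-1:ℝ)) (by norm_num)).resolve_left hne
  rw [spectrum.mem_resolventSet_iff] at hr
  have hr' : IsUnit (1 + T) := by
    have := hr.neg
    rwa [show -(algebraMap ℝ (HH →L[ℝ] HH) (-1) - T) = 1 + T by rw [map_neg, map_one]; abel] at this
  obtain ⟨A, hA⟩ := hr'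
  set B : HH →L[ℝ] HH := ((A⁻¹ : (HH →L[ℝ] HH)ˣ) : HH →L[ℝ] HH) with hB
  have hAB : ∀ f, B (f + T f) = f := fun f => by
    have : (B * (A : HH →L[ℝ] HH)) f = f := by rw [hB, Units.inv_mul]; rfl
    rw [hA] at this; simpa using this
  have hBA : ∀ f, B f + T (B f) = f := fun f => by
    have : ((A : HH →L[ℝ] HH) * B) f = f := by rw [hB, Units.mul_inv]; rfl
    rw [hA] at this; simpa using this
  have hiff : ∀ f u : HH, (B ∘L TT) f = u ↔ u = TT (f - hv.op u) := fun f u => by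
    have e : TT (hv.op u) = T u := rfl
    rw [map_sub, e, ContinuousLinearMap.comp_apply]
    constructor
    · rintro rfl
      exact eq_sub_of_add_eq (hBA _)
    · intro h
      rw [← hAB u]; congr 1; rw [← sub_eq_iff_eq_add]; exact h.symm
  refine ⟨B ∘L TT, TT_compact.clm_comp B, fun f g => ?_, hiff⟩
  have h1 := (hiff f _).1 rfl
  have h2 := (hiff g _).1 rfl
  set u := (B ∘L TT) f
  set w := (B ∘L TT) g
  have e1 : inner ℝ u (g - hv.op w) = inner ℝ (f - hv.op u) w := by
    conv_lhs => rw [h1, TT_symm, ← h2]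
  rw [inner_sub_right, inner_sub_left, hv.op_symm] at e1
  linarith

end WFA
end

section
namespace WFA
variable {v : ℝ → ℝ} {D M : ℝ} {μ : Measure ℝ} {p O : ℝ → Measure ℝ}

def qb (β c x : ℝ) : ℝ := aa x * Real.exp (-β * (x - c) ^ 2)

lemma qb_deriv2 (β c : ℝ) : deriv (deriv (qb β c)) = fun x => Real.exp (-β * (x - c) ^ 2) *
    (-2 - 4 * β * ((1 - 2 * x) * (x - c)) - 2 * β * aa x + 4 * β ^ 2 * aa x * (x - c) ^ 2) := by
  have hE : ∀ x, HasDerivAt (fun x => Real.exp (-β * (x - c) ^ 2)) (Real.exp (-β * (x - c) ^ 2) * (-2 * β * (x - c))) x := fun x => by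
    have := (((((hasDerivAt_id x).sub_const c).pow 2).const_mul (-β)).exp)
    convert! this using 1
    simp; ring
  have hA : ∀ x, HasDerivAt aa (1 - 2 * x) x := fun x => by
    have := ((hasDerivAt_id x).mul ((hasDerivAt_id x).const_sub 1))
    convert! this using 1
    simp; ring
  have h1 : deriv (qb β c) = fun x => (1 - 2 * x) * Real.exp (-β * (x - c) ^ 2) + aa x * (Real.exp (-β * (x - c) ^ 2) * (-2 * β * (x - c))) := by
    ext x
    exact ((hA x).mul (hE x)).deriv
  rw [h1]; ext x
  have l1 : HasDerivAt (fun x : ℝ => 1 - 2 * x) (-2) x := by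
    simpa using (((hasDerivAt_id x).const_mul 2).const_sub (1:ℝ))
  have l2 : HasDerivAt (fun x : ℝ => -2 * β * (x - c)) (-2 * β) x := by
    simpa using (((hasDerivAt_id x).sub_const c).const_mul (-2 * β))
  have := ((l1.mul (hE x)).add ((hA x).mul ((hE x).mul l2))).deriv
  refine Eq.trans this ?_
  simp only [Pi.mul_apply]
  ring

lemma qb_C2 (β c : ℝ) : ContDiff ℝ 2 (qb β c) := by unfold qb aa; fun_prop

lemma barrier {c ρ N : ℝ} (hc : c ∈ Ioo (0:ℝ) 1) (hρ : 0 < ρ) (hN : 0 ≤ N) : ∃ β, 1 ≤ β ∧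
    ∀ x ∈ Ioo (0:ℝ) 1, ρ ≤ |x - c| → N + 4 * β * ((1 - 2 * x) * (x - c)) + 2 * β * aa x - 4 * β ^ 2 * aa x * (x - c) ^ 2 ≤ 0 := by
  obtain ⟨hc0, hc1⟩ := hc
  set m := min c (1 - c) with hm
  have hm0 : 0 < m := lt_min hc0 (by linarith)
  have hmc : m ≤ c := min_le_left _ _
  have hmc' : m ≤ 1 - c := min_le_right _ _
  have hm1 : m ≤ 1/2 := by linarith
  set β := 1 + N / m + (N + 6) / (m / 2 * ρ ^ 2) with hβ
  have t1 : 0 ≤ N / m := by positivity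
  have t2 : 0 ≤ (N + 6) / (m / 2 * ρ ^ 2) := by positivity
  have hb1 : 1 ≤ β := by linarith
  have hbN : N ≤ β * m := by
    have : N / m ≤ β := by linarith
    rwa [div_le_iff₀ hm0] at this
  have hbR : N + 6 ≤ β * (m / 2 * ρ ^ 2) := by
    have : (N + 6) / (m / 2 * ρ ^ 2) ≤ β := by linarith
    rwa [div_le_iff₀ (by positivity)] at this
  refine ⟨β, hb1, fun x hx hxc => ?_⟩
  have hb0 : 0 < β := by linarith
  have ha := aa_pos hx
  have bd : ∀ {a' : ℝ}, (1 - 2 * x) * (x - c) ≤ - (m / 2) → aa x ≤ m / 2 → 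
      N + 4 * β * ((1 - 2 * x) * (x - c)) + 2 * β * aa x - 4 * β ^ 2 * aa x * (x - c) ^ 2 ≤ 0 := by
    intro _ h1 h2
    have e1 := mul_le_mul_of_nonneg_left h1 hb0.le
    have e2 := mul_le_mul_of_nonneg_left h2 hb0.le
    have : 0 ≤ 4 * β ^ 2 * aa x * (x - c) ^ 2 := by positivity
    nlinarith
  by_cases hl : x < m / 4
  · refine bd (a' := 0) ?_ ?_
    · nlinarith [hx.1]
    · unfold aa; nlinarith [hx.1, hx.2]
  by_cases hr : 1 - m / 4 < x
  · refine bd (a' := 0) ?_ ?_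
    · nlinarith [hx.2]
    · unfold aa; nlinarith [hx.1, hx.2]
  push Not at hl hr
  have ha0 : m / 8 ≤ aa x := by unfold aa; nlinarith [mul_nonneg (sub_nonneg.2 hl) (sub_nonneg.2 hr)]
  have hsq : ρ ^ 2 ≤ (x - c) ^ 2 := by rw [← sq_abs (x - c)]; exact pow_le_pow_left₀ hρ.le hxc 2
  have h3 : m / 8 * ρ ^ 2 ≤ aa x * (x - c) ^ 2 := mul_le_mul ha0 hsq (by positivity) ha.le
  have h4 : (1 - 2 * x) * (x - c) ≤ 1 := by nlinarith [hx.1, hx.2]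
  have h5 := aa_le_one x
  have h6 : N + 6 ≤ β * (4 * (aa x * (x - c) ^ 2)) := hbR.trans (mul_le_mul_of_nonneg_left (by linarith) hb0.le)
  have h7 : β * (N + 6) ≤ β * (β * (4 * (aa x * (x - c) ^ 2))) := mul_le_mul_of_nonneg_left h6 hb0.le
  have e1 := mul_le_mul_of_nonneg_left h4 hb0.le
  have e2 := mul_le_mul_of_nonneg_left h5 hb0.le
  nlinarith

lemma Sol.hopf (hD : 0 < D) (hv : BV v M) (hE : FlowEx v D) {F e : ℝ → ℝ} (h : Sol v F e)
    (he : ∀ x ∈ Ioo (0:ℝ) 1, 0 ≤ e x) {c : ℝ} (hc : c ∈ Ioo (0:ℝ) 1) (hec : 0 < e c) (hcont : ContinuousAt e c) :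
    ∃ k, 0 < k ∧ ∀ x ∈ Ioo (0:ℝ) 1, k * aa x ≤ F x := by
  have hM := hv.M_nonneg
  set δ := e c / 2 with hδ
  have hδ0 : 0 < δ := by positivity
  obtain ⟨ρ, hρ, hJ⟩ := Metric.eventually_nhds_iff.1 (hcont.eventually (lt_mem_nhds (show δ < e c by linarith)))
  obtain ⟨β, hβ1, hβ⟩ := barrier hc hρ (show 0 ≤ 2 + M by linarith)
  set N := 2 + M with hN
  set Cq := N + 6 * β with hCq
  have hCq0 : 0 < Cq := by linarith
  have S := Sol.of_C2 hv (qb_C2 β c) (by simp [qb, aa]) (by simp [qb, aa])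
  rw [qb_deriv2] at S
  have S2 := Sol.lin hv h S (Cq / δ) 1
  have pos := S2.nonneg hD hv hE (fun x hx => by
    have ha := aa_pos hx
    have ha1 := aa_le_one x
    have hex := Real.exp_pos (-β * (x - c) ^ 2)
    have hex1 : Real.exp (-β * (x - c) ^ 2) ≤ 1 := Real.exp_le_one_iff.2 (by nlinarith [sq_nonneg (x - c)])
    have hvx := hv.le x
    set B := N + 4 * β * ((1 - 2 * x) * (x - c)) + 2 * β * aa x - 4 * β ^ 2 * aa x * (x - c) ^ 2 with hB
    have key : -(aa x * (Real.exp (-β * (x - c) ^ 2) * (-2 - 4 * β * ((1 - 2 * x) * (x - c)) - 2 * β * aa x + 4 * β ^ 2 * aa x * (x - c) ^ 2))) + v x * qb β c x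
        ≤ aa x * Real.exp (-β * (x - c) ^ 2) * B := by
      have : 0 ≤ aa x * Real.exp (-β * (x - c) ^ 2) * (M - v x) := by
        have : 0 ≤ M - v x := by linarith
        positivity
      unfold qb
      rw [hB, hN]
      nlinarith
    rw [one_mul, sub_nonneg]
    refine key.trans ?_
    have hae : 0 < aa x * Real.exp (-β * (x - c) ^ 2) := by positivity
    by_cases hxc : ρ ≤ |x - c|
    · have := hβ x hx hxc
      have h1 : 0 ≤ Cq / δ * e x := mul_nonneg (by positivity) (he x hx)
      nlinarith
    · push Not at hxc
      have h1 : δ < e x := hJ (by rwa [Real.dist_eq])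
      have h2 : Cq ≤ Cq / δ * e x := by
        rw [div_mul_eq_mul_div, le_div_iff₀ hδ0]; nlinarith
      refine le_trans ?_ h2
      have hB2 : B ≤ Cq := by
        have h4 : (1 - 2 * x) * (x - c) ≤ 1 := by nlinarith [hx.1, hx.2, hc.1, hc.2]
        have e1 := mul_le_mul_of_nonneg_left h4 (show 0 ≤ β by linarith)
        have e2 := mul_le_mul_of_nonneg_left ha1 (show 0 ≤ β by linarith)
        have : 0 ≤ 4 * β ^ 2 * aa x * (x - c) ^ 2 := by positivity
        rw [hB, hCq]; nlinarith
      have h5 : aa x * Real.exp (-β * (x - c) ^ 2) ≤ 1 := mul_le_one₀ ha1 hex.le hex1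
      nlinarith)
  refine ⟨δ / Cq * Real.exp (-β), by positivity, fun x hx => ?_⟩
  have h1 := pos x hx
  simp only [one_mul, sub_nonneg, qb] at h1
  have h2 : Real.exp (-β) ≤ Real.exp (-β * (x - c) ^ 2) := Real.exp_le_exp.2 (by
    have : (x - c) ^ 2 ≤ 1 := by nlinarith [hx.1, hx.2, hc.1, hc.2]
    nlinarith)
  have ha := aa_pos hx
  rw [div_mul_eq_mul_div, le_div_iff₀ hδ0] at h1
  rw [div_mul_eq_mul_div, div_mul_eq_mul_div, div_le_iff₀ hCq0]
  have := mul_le_mul_of_nonneg_left h2 (mul_nonneg ha.le hδ0.le)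
  nlinarith

end WFA
end

section
namespace WFA
variable {v : ℝ → ℝ} {D M : ℝ} {μ : Measure ℝ} {p O : ℝ → Measure ℝ}

structure KOp (v : ℝ → ℝ) (M D : ℝ) (K : HH →L[ℝ] HH) : Prop where
  hD : 0 < D
  hv : BV v M
  hE : FlowEx v D
  comp : IsCompactOperator K
  symm : ∀ f g : HH, inner ℝ (K f) g = inner ℝ f (K g)
  iff : ∀ f u : HH, K f = u ↔ u = TT (f - hv.op u)

variable {K : HH →L[ℝ] HH}

/-- the source `f - v K f` -/
def KOp.src (hK : KOp v M D K) : HH →L[ℝ] HH := 1 - hK.hv.op ∘L K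

lemma KOp.src_apply (hK : KOp v M D K) (f : HH) : hK.src f = f - hK.hv.op (K f) := rfl

def KOp.KF (hK : KOp v M D K) (f : HH) (x : ℝ) : ℝ := PP (hK.src f) x

lemma KOp.eq (hK : KOp v M D K) (f : HH) : K f = TT (hK.src f) := (hK.iff f _).1 rfl

lemma KOp.ae (hK : KOp v M D K) (f : HH) : K f =ᵐ[nu] fun x => hK.KF f x / sa x := by
  rw [hK.eq f]; exact TT_ae _

lemma KOp.KF_meas (hK : KOp v M D K) (f : HH) : Measurable (hK.KF f) := PP_measurable (HH_meas _)

lemma KOp.KF_contAt (hK : KOp v M D K) (f : HH) {x : ℝ} (hx : x ∈ Ioo (0:ℝ) 1) : ContinuousAt (hK.KF f) x :=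
  PP_contAt (HH_integrable _) hx

lemma KOp.KF_inner (hK : KOp v M D K) (f : HH) {x : ℝ} (hx : x ∈ Ioo (0:ℝ) 1) :
    hK.KF f x = sa x * inner ℝ ((kkB.memLp_sec x).toLp) (hK.src f) := PP_inner _ hx

lemma KOp.KF_le (hK : KOp v M D K) (f : HH) {x : ℝ} (hx : x ∈ Ioo (0:ℝ) 1) :
    |hK.KF f x| ≤ ‖hK.src‖ * ‖f‖ * sa x := by
  have := PP_le (hK.src f) hx
  refine this.trans ?_
  rw [mul_comm]
  exact mul_le_mul_of_nonneg_right (hK.src.le_opNorm f) (sa_nonneg x)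

lemma KOp.K_bdd (hK : KOp v M D K) (f : HH) : ∀ᵐ x ∂nu, |K f x| ≤ ‖hK.src‖ * ‖f‖ := by
  filter_upwards [hK.ae f, ae_nu] with x h1 hx
  rw [h1, abs_div, abs_of_pos (sa_pos hx), div_le_iff₀ (sa_pos hx)]
  exact hK.KF_le f hx

def KOp.B2 (hK : KOp v M D K) : ℝ := (‖hK.src‖ + M * (‖hK.src‖ * ‖K‖)) * c1

lemma KOp.B2_nonneg (hK : KOp v M D K) : 0 ≤ hK.B2 := by
  have := hK.hv.M_nonneg; have := c1_nonneg; unfold KOp.B2; positivity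

lemma KOp.KF2_le (hK : KOp v M D K) (f : HH) {x : ℝ} (hx : x ∈ Ioo (0:ℝ) 1) :
    |hK.KF (K f) x| ≤ hK.B2 * ‖f‖ * aa x := by
  have hM := hK.hv.M_nonneg
  have h : ∀ᵐ y ∂nu, |hK.src (K f) y| ≤ (‖hK.src‖ + M * (‖hK.src‖ * ‖K‖)) * ‖f‖ := by
    filter_upwards [TT_sub_ae hK.hv (K f) (K (K f)), hK.K_bdd f, hK.K_bdd (K f)] with y h1 h2 h3
    rw [hK.src_apply, h1]
    refine (abs_sub _ _).trans ?_
    rw [abs_mul, add_mul]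
    refine add_le_add h2 ?_
    rw [mul_assoc]
    refine mul_le_mul (hK.hv.abs_le y) (h3.trans ?_) (abs_nonneg _) hM
    rw [mul_assoc]
    exact mul_le_mul_of_nonneg_left (K.le_opNorm f) (norm_nonneg _)
  refine (PP_le_of_bdd h hx).trans (le_of_eq ?_)
  unfold KOp.B2; ring

lemma KOp.K2_le (hK : KOp v M D K) (f : HH) : ∀ᵐ x ∂nu, |K (K f) x| ≤ hK.B2 * ‖f‖ * sa x := by
  filter_upwards [hK.ae (K f), ae_nu] with x h1 hx
  rw [h1]
  exact div_sa_le hx (hK.KF2_le f hx)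

/-- functional given by a finite measure -/
def KOp.fn (hK : KOp v M D K) (m : Measure ℝ) (f : HH) : ℝ := ∫ x, hK.KF f x ∂m

lemma KOp.KF_int (hK : KOp v M D K) {m : Measure ℝ} [IsFiniteMeasure m] (hs : m (Ioo (0:ℝ) 1)ᶜ = 0) (f : HH) :
    Integrable (hK.KF f) m := by
  refine bint hs (hK.KF_meas f) (C := ‖hK.src‖ * ‖f‖) fun x hx => (hK.KF_le f hx).trans ?_
  have := sa_le_one x
  exact mul_le_of_le_one_right (by positivity) this

lemma KOp.KF_add (hK : KOp v M D K) (f g : HH) {x : ℝ} (hx : x ∈ Ioo (0:ℝ) 1) :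
    hK.KF (f + g) x = hK.KF f x + hK.KF g x := by
  rw [hK.KF_inner _ hx, hK.KF_inner _ hx, hK.KF_inner _ hx, map_add, inner_add_right, mul_add]

lemma KOp.KF_smul (hK : KOp v M D K) (c : ℝ) (f : HH) {x : ℝ} (hx : x ∈ Ioo (0:ℝ) 1) :
    hK.KF (c • f) x = c * hK.KF f x := by
  rw [hK.KF_inner _ hx, hK.KF_inner _ hx, map_smul, inner_smul_right]; ring

/-- `f ↦ ∫ sa K f dm` -/
def KOp.J (hK : KOp v M D K) (m : Measure ℝ) [IsFiniteMeasure m] (hs : m (Ioo (0:ℝ) 1)ᶜ = 0) : HH →L[ℝ] ℝ :=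
  LinearMap.mkContinuous
    { toFun := fun f => ∫ x, hK.KF f x ∂m
      map_add' := fun f g => by
        rw [← integral_add (hK.KF_int hs f) (hK.KF_int hs g)]
        exact int_congr_Ioo hs fun x hx => hK.KF_add f g hx
      map_smul' := fun c f => by
        simp only [RingHom.id_apply, smul_eq_mul]
        rw [← integral_const_mul]
        exact int_congr_Ioo hs fun x hx => hK.KF_smul c f hx } (‖hK.src‖ * m.real univ)
    (fun f => by
      simp only [LinearMap.coe_mk, AddHom.coe_mk]
      refine (bint_le (C := ‖hK.src‖ * ‖f‖) hs fun x hx => (hK.KF_le f hx).trans ?_).trans (le_of_eq (by ring))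
      exact mul_le_of_le_one_right (by positivity) (sa_le_one x))

lemma KOp.J_apply (hK : KOp v M D K) (m : Measure ℝ) [IsFiniteMeasure m] (hs : m (Ioo (0:ℝ) 1)ᶜ = 0) (f : HH) :
    hK.J m hs f = ∫ x, hK.KF f x ∂m := rfl

/-- the functional `f ↦ ∫ sa K² f dm`, controlled by `m(aa)` -/
lemma KOp.exists_riesz (hK : KOp v M D K) (m : Measure ℝ) [IsFiniteMeasure m] (hs : m (Ioo (0:ℝ) 1)ᶜ = 0) :
    ∃ w : HH, ‖w‖ ≤ hK.B2 * ∫ x, aa x ∂m ∧ ∀ f : HH, inner ℝ w f = ∫ x, hK.KF (K f) x ∂m := by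
  set L : HH →L[ℝ] ℝ := hK.J m hs ∘L K with hL
  refine ⟨(InnerProductSpace.toDual ℝ HH).symm L, ?_, fun f => ?_⟩
  · rw [LinearIsometryEquiv.norm_map]
    have hB := hK.B2_nonneg
    have h0 : 0 ≤ ∫ x, aa x ∂m := integral_nonneg_of_ae (by
      filter_upwards [ae_of_null hs] with x hx using (aa_pos hx).le)
    refine L.opNorm_le_bound (by positivity) fun f => ?_
    have h1 : ∀ᵐ x ∂m, ‖hK.KF (K f) x‖ ≤ hK.B2 * ‖f‖ * aa x := by
      filter_upwards [ae_of_null hs] with x hx using hK.KF2_le f hx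
    have h2 := norm_integral_le_of_norm_le ((bint hs measurable_aa (C := 1) fun x hx => aa_abs hx).const_mul _) h1
    rw [integral_const_mul] at h2
    calc ‖L f‖ = ‖∫ x, hK.KF (K f) x ∂m‖ := rfl
      _ ≤ _ := h2
      _ = _ := by ring
  · rw [InnerProductSpace.toDual_symm_apply]; rfl

lemma bdd_memLp {f : ℝ → ℝ} (hf : Measurable f) {C : ℝ} (hb : ∀ x ∈ Ioo (0:ℝ) 1, |f x| ≤ C) : MemLp f 2 nu :=
  MemLp.of_bound hf.aestronglyMeasurable C (by filter_upwards [ae_nu] with x hx using hb x hx)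

/-- every `Sol` is in the range of `K` -/
lemma KOp.of_sol (hK : KOp v M D K) {F e : ℝ → ℝ} (S : Sol v F e) :
    ∃ f : HH, f =ᵐ[nu] (fun x => e x / sa x) ∧ (∀ x ∈ Ioo (0:ℝ) 1, hK.KF f x = F x) ∧ K f =ᵐ[nu] fun x => F x / sa x := by
  obtain ⟨Ce, hCe⟩ := S.eb
  obtain ⟨CF, hCF⟩ := S.Fb
  have bd : ∀ {C : ℝ} {F : ℝ → ℝ} (h : ∀ x ∈ Ioo (0:ℝ) 1, |F x| ≤ C * aa x), ∀ x ∈ Ioo (0:ℝ) 1, |F x / sa x| ≤ |C| := by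
    intro C F h x hx
    refine (div_sa_le hx (h x hx)).trans ?_
    nlinarith [sa_pos hx, sa_le_one x, le_abs_self C, abs_nonneg C]
  have me := bdd_memLp (S.em.div measurable_sa) (bd hCe)
  have mF := bdd_memLp (S.Fm.div measurable_sa) (bd hCF)
  obtain ⟨g, hg, ⟨C, hC⟩, hF, he⟩ := S.ex
  have af := me.coeFn_toLp
  have au := mF.coeFn_toLp
  set f : HH := me.toLp with hf
  set u : HH := mF.toLp with hu
  have hsrc : ∀ x, PP (f - hK.hv.op u : HH) x = Pot g x := fun x => by
    unfold PP Pot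
    apply integral_congr_ae
    filter_upwards [TT_sub_ae hK.hv f u, af, au, ae_nu] with y h1 h2 h3 hy
    rw [h1, h2, h3, Pi.div_apply, Pi.div_apply, ← he y hy, ← sa_sq hy]
    have := (sa_pos hy).ne'
    field_simp; ring
  have hKu : K f = u := by
    rw [hK.iff]
    refine Lp.ext ?_
    filter_upwards [TT_ae (f - hK.hv.op u), au, ae_nu] with x h1 h2 hx
    rw [h1, h2, Pi.div_apply, hsrc, hF x hx]
  refine ⟨f, af, fun x hx => ?_, by rw [hKu]; exact au⟩
  unfold KOp.KF
  rw [hK.src_apply, hKu, hsrc, hF x hx]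

/-- eigenvectors -/
lemma KOp.eig (hK : KOp v M D K) {k : ℝ} (hk : k ≠ 0) {u : HH} (hu : K u = k • u) :
    Sol v (fun x => k⁻¹ * hK.KF u x) (fun x => k⁻¹ * (k⁻¹ * hK.KF u x)) ∧ u =ᵐ[nu] fun x => (k⁻¹ * hK.KF u x) / sa x := by
  have h1 : u = TT (k⁻¹ • u - hK.hv.op u) := by
    have := (hK.iff u (k • u)).1 hu
    have h2 : k⁻¹ • (k • u) = k⁻¹ • TT (u - hK.hv.op (k • u)) := by rw [← this]
    rw [smul_smul, inv_mul_cancel₀ hk, one_smul, ← map_smul, smul_sub, ← map_smul, smul_smul, inv_mul_cancel₀ hk, one_smul] at h2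
    exact h2
  have hs : hK.src u = k • (k⁻¹ • u - hK.hv.op u) := by
    rw [hK.src_apply, hu, map_smul, smul_sub, smul_smul, mul_inv_cancel₀ hk, one_smul]
  obtain ⟨F, hF, hFP, hua⟩ := eig_sol hK.hv h1
  have e : ∀ x ∈ Ioo (0:ℝ) 1, k⁻¹ * hK.KF u x = F x := fun x hx => by
    rw [hFP x hx, hK.KF_inner u hx, hs, PP_inner _ hx, inner_smul_right]
    field_simp
  obtain ⟨g, hg, ⟨C, hC⟩, hF1, he⟩ := hF.ex
  constructor
  · refine Sol.mk2 hK.hv ((hK.KF_meas u).const_mul _) (((hK.KF_meas u).const_mul _).const_mul _) hg hC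
      (fun x hx => by rw [e x hx, hF1 x hx]) (fun x hx => by rw [e x hx, he x hx])
  · filter_upwards [hua, ae_nu] with x h1 hx
    rw [h1, e x hx]

lemma ne_zero_of_ae {u : HH} {F : ℝ → ℝ} (h : u =ᵐ[nu] fun x => F x / sa x) (hu : u ≠ 0) :
    ∃ x ∈ Ioo (0:ℝ) 1, F x ≠ 0 := by
  by_contra hc
  push Not at hc
  apply hu
  refine Lp.ext ?_
  filter_upwards [h, ae_nu, Lp.coeFn_zero ℝ 2 nu] with x h1 hx h3
  rw [h1, hc x hx, zero_div, h3]; rfl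

lemma KOp.eig_pos (hK : KOp v M D K) {k : ℝ} {u : HH} (hu0 : u ≠ 0) (hu : K u = k • u) : 0 ≤ k := by
  by_cases hk : k = 0
  · rw [hk]
  obtain ⟨S, ha⟩ := hK.eig hk hu
  obtain ⟨x, hx, hne⟩ := ne_zero_of_ae ha hu0
  exact (inv_pos.1 (S.eig_pos hK.hD hK.hv hK.hE hx hne)).le

end WFA
end

section
namespace WFA
section Basis
variable {E : Type} [NormedAddCommGroup E] [InnerProductSpace ℝ E] [CompleteSpace E] {ι : Type}

lemma clm_eq {G : Type} [NormedAddCommGroup G] [InnerProductSpace ℝ G] (b : HilbertBasis ι ℝ G) {L L' : G →L[ℝ] ℝ} (h : ∀ i, L (b i) = L' (b i)) : L = L' := by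
  ext f
  have h1 := (b.hasSum_repr f).mapL L
  have h2 := (b.hasSum_repr f).mapL L'
  refine h1.unique ?_
  convert h2 using 2 with i
  rw [map_smul, map_smul, h i]

lemma exists_basis {T : E →L[ℝ] E} (hc : IsCompactOperator T) (hs : ∀ f g : E, inner ℝ (T f) g = inner ℝ f (T g)) :
    ∃ (ι : Type) (b : HilbertBasis ι ℝ E) (k : ι → ℝ), ∀ i, T (b i) = k i • b i := by
  have hsym : T.IsSymmetric := fun f g => hs f g
  have hcl : ∀ a : ℝ, IsClosed (Module.End.eigenspace (T : E →ₗ[ℝ] E) a : Set E) := fun a => by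
    have : (Module.End.eigenspace (T : E →ₗ[ℝ] E) a : Set E) = {x | T x = a • x} := by
      ext x; simp
    rw [this]
    exact isClosed_eq T.continuous (continuous_const_smul a)
  have hcs : ∀ a : ℝ, CompleteSpace (Module.End.eigenspace (T : E →ₗ[ℝ] E) a) := fun a =>
    (hcl a).completeSpace_coe
  choose w b hb using fun a : ℝ => exists_hilbertBasis ℝ (Module.End.eigenspace (T : E →ₗ[ℝ] E) a)
  have ho := hsym.orthogonalFamily_eigenspaces.orthonormal_sigma_orthonormal (fun a => (b a).orthonormal)
  refine ⟨_, HilbertBasis.mkOfOrthogonalEqBot ho ?_, fun i => i.1, fun i => ?_⟩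
  · rw [eq_bot_iff, ← ContinuousLinearMap.orthogonalComplement_iSup_eigenspaces_eq_bot hc hsym]
    intro x hx
    rw [Submodule.mem_orthogonal] at hx
    have key : ∀ a : ℝ, ∀ y : Module.End.eigenspace (T : E →ₗ[ℝ] E) a, inner ℝ x (y : E) = 0 := by
      intro a y
      have := clm_eq (b a) (L := (innerSL ℝ x) ∘L (Module.End.eigenspace (T : E →ₗ[ℝ] E) a).subtypeL) (L' := 0)
        (fun i => by
          have := hx _ (Submodule.subset_span ⟨⟨a, i⟩, rfl⟩)
          rw [real_inner_comm] at this
          simpa using this)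
      simpa using congrArg (fun L => L y) this
    rw [Submodule.mem_orthogonal]
    intro y hy
    induction hy using Submodule.iSup_induction' with
    | mem a y hy => rw [real_inner_comm]; exact key a ⟨y, hy⟩
    | zero => simp
    | add y z _ _ h1 h2 => rw [inner_add_left, h1, h2, add_zero]
  · simp only [HilbertBasis.coe_mkOfOrthogonalEqBot]
    exact Module.End.mem_eigenspace_iff.1 (b i.1 i.2).2

lemma finite_ge {T : E →L[ℝ] E} (hc : IsCompactOperator T) (b : HilbertBasis ι ℝ E) (k : ι → ℝ)
    (hb : ∀ i, T (b i) = k i • b i) {ε : ℝ} (hε : 0 < ε) : {i | ε ≤ k i}.Finite := by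
  by_contra hinf
  have hinf : {i | ε ≤ k i}.Infinite := hinf
  set f := hinf.natEmbedding
  have hK : IsCompact (closure (T '' Metric.closedBall 0 1)) := hc.isCompact_closure_image_closedBall 1
  obtain ⟨a, -, φ, hφ, hlim⟩ := hK.tendsto_subseq (x := fun n => T (b (f n).1)) (fun n =>
    subset_closure ⟨_, by simp [b.orthonormal.1 (f n).1], rfl⟩)
  have hC := hlim.cauchySeq
  rw [Metric.cauchySeq_iff'] at hC
  obtain ⟨N, hN⟩ := hC ε hε
  have h1 := hN (N+1) (by lia)
  set i := (f (φ N)).1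
  set j := (f (φ (N+1))).1
  have hij : j ≠ i := fun h => by
    have h2 := f.injective (Subtype.ext h)
    have := hφ.injective h2
    lia
  have hi : ε ≤ k i := (f (φ N)).2
  have hj : ε ≤ k j := (f (φ (N+1))).2
  simp only [Function.comp] at h1
  rw [dist_eq_norm] at h1
  change ‖T (b j) - T (b i)‖ < ε at h1
  rw [hb, hb] at h1
  have h2 : ‖k j • b j - k i • b i‖ ^ 2 = k j ^ 2 + k i ^ 2 := by
    rw [← real_inner_self_eq_norm_sq, inner_sub_left, inner_sub_right, inner_sub_right]
    simp only [real_inner_smul_left, real_inner_smul_right, real_inner_self_eq_norm_sq,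
      b.orthonormal.2 hij, b.orthonormal.2 hij.symm, norm_smul, b.orthonormal.1, Real.norm_eq_abs, mul_one, sq_abs]
    ring
  have : ‖k j • b j - k i • b i‖ ^ 2 < ε ^ 2 := by
    exact pow_lt_pow_left₀ h1 (norm_nonneg _) (by norm_num)
  nlinarith [sq_nonneg (k i), mul_self_le_mul_self hε.le hj]

lemma exists_top {T : E →L[ℝ] E} (hc : IsCompactOperator T) (b : HilbertBasis ι ℝ E) (k : ι → ℝ)
    (hb : ∀ i, T (b i) = k i • b i) (hk : ∀ i, 0 ≤ k i) (hT : T ≠ 0) : ∃ i₀, 0 < k i₀ ∧ ∀ i, k i ≤ k i₀ := by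
  obtain ⟨j, hj⟩ : ∃ j, 0 < k j := by
    by_contra hcon
    push Not at hcon
    apply hT
    ext f
    have h1 := (b.hasSum_repr f).mapL T
    have h2 : (fun i => T (b.repr f i • b i)) = fun _ => 0 := by
      ext i; rw [map_smul, hb, le_antisymm (hcon i) (hk i)]; simp
    rw [h2] at h1
    simpa using h1.unique hasSum_zero
  obtain ⟨i₀, h1, h2⟩ := (finite_ge hc b k hb hj).exists_maximalFor k _ ⟨j, le_refl (k j)⟩
  refine ⟨i₀, lt_of_lt_of_le hj h1, fun i => ?_⟩
  by_contra h
  push Not at h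
  exact absurd (h2 (show k j ≤ k i from h1.trans h.le) h.le) (not_le.2 h)

lemma top_le {T : E →L[ℝ] E} (b : HilbertBasis ι ℝ E) (k : ι → ℝ) (hs : ∀ f g : E, inner ℝ (T f) g = inner ℝ f (T g))
    (hb : ∀ i, T (b i) = k i • b i) {m : ℝ} (hm : ∀ i, k i ≤ m) (g : E) : inner ℝ (T g) g ≤ m * ‖g‖ ^ 2 := by
  have h1 := b.hasSum_inner_mul_inner (T g) g
  have h2 := (b.hasSum_inner_mul_inner g g).mul_left m
  rw [real_inner_self_eq_norm_sq] at h2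
  refine hasSum_le (fun i => ?_) h1 h2
  rw [hs, hb, inner_smul_right, real_inner_comm (b i) g]
  have := hm i
  nlinarith [mul_self_nonneg (inner ℝ (b i) g), mul_le_mul_of_nonneg_right this (mul_self_nonneg (inner ℝ (b i) g))]

lemma exists_gap {T : E →L[ℝ] E} (hc : IsCompactOperator T) (b : HilbertBasis ι ℝ E) (k : ι → ℝ)
    (hb : ∀ i, T (b i) = k i • b i) {i₀ : ι} (h0 : 0 < k i₀) (h : ∀ i, i ≠ i₀ → k i < k i₀) :
    ∃ k₁, 0 < k₁ ∧ k₁ < k i₀ ∧ ∀ i, i ≠ i₀ → k i ≤ k₁ := by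
  have hf := finite_ge hc b k hb (half_pos h0)
  by_cases hne : ({i | k i₀ / 2 ≤ k i} \ {i₀}).Nonempty
  · obtain ⟨i, h1, h2⟩ := (hf.subset sdiff_subset).exists_maximalFor k _ hne
    have hi := h1.1
    simp only [mem_ofPred_eq] at hi
    refine ⟨k i, by linarith, h i h1.2, fun j hj => ?_⟩
    by_contra hc
    push Not at hc
    exact absurd (h2 (show j ∈ _ from ⟨by simp only [mem_ofPred_eq]; linarith, hj⟩) hc.le) (not_le.2 hc)
  · refine ⟨k i₀ / 2, by linarith, by linarith, fun j hj => ?_⟩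
    by_contra hc
    push Not at hc
    exact hne ⟨j, hc.le, hj⟩
end Basis
end WFA
end

section
namespace WFA
variable {v : ℝ → ℝ} {D M : ℝ} {K : HH →L[ℝ] HH}

lemma KOp.sol_src (hK : KOp v M D K) {q : ℝ → ℝ} (hq : Measurable q) {C : ℝ} (hb : ∀ x ∈ Ioo (0:ℝ) 1, |q x| ≤ C * aa x) :
    ∃ (f : HH) (G : ℝ → ℝ), f =ᵐ[nu] (fun x => q x / sa x) ∧ Sol v G q ∧ K f =ᵐ[nu] fun x => G x / sa x := by
  have hb' : ∀ x ∈ Ioo (0:ℝ) 1, |q x / sa x| ≤ C * sa x := fun x hx => div_sa_le hx (hb x hx)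
  have hm : Measurable fun x => q x / sa x := hq.div measurable_sa
  have mf := bdd_memLp hm (C := |C|) (fun x hx => (hb' x hx).trans (by
    nlinarith [sa_pos hx, sa_le_one x, le_abs_self C, abs_nonneg C]))
  have af := mf.coeFn_toLp
  set f : HH := mf.toLp
  have e : ∀ x, hK.KF f x = PP (fun y => q y / sa y - v y * K f y) x := fun x => by
    unfold KOp.KF PP Pot
    apply integral_congr_ae
    rw [hK.src_apply]
    filter_upwards [TT_sub_ae hK.hv f (K f), af] with y h1 h2
    rw [h1, h2]
  have S := sol_of hK.hv hm hb' (K f) (by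
    filter_upwards [hK.ae f] with x hx
    rw [hx, e])
  obtain ⟨g, hg, ⟨C', hC⟩, hF, he⟩ := S.ex
  refine ⟨f, _, af, Sol.mk2 hK.hv S.Fm hq hg hC hF (fun x hx => ?_), by
    filter_upwards [hK.ae f] with x hx
    rw [hx, e]⟩
  rw [he x hx]
  have := (sa_pos hx).ne'
  field_simp

lemma KOp.top_sign (hK : KOp v M D K) {k : ℝ} (hk : 0 < k) {u : HH} (hu0 : u ≠ 0) (hu : K u = k • u)
    (htop : ∀ g : HH, inner ℝ (K g) g ≤ k * ‖g‖ ^ 2) :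
    ∃ c ε : ℝ, 0 < c ∧ ε * ε = 1 ∧ ∀ x ∈ Ioo (0:ℝ) 1, c * aa x ≤ ε * (k⁻¹ * hK.KF u x) := by
  obtain ⟨S, ha⟩ := hK.eig hk.ne' hu
  set F : ℝ → ℝ := fun x => k⁻¹ * hK.KF u x with hF
  have hFc : ∀ {x}, x ∈ Ioo (0:ℝ) 1 → ContinuousAt F x := fun hx => continuousAt_const.mul (hK.KF_contAt u hx)
  obtain ⟨x0, hx0, hne⟩ := ne_zero_of_ae ha hu0
  have hk' := inv_pos.2 hk
  by_cases h1 : ∀ x ∈ Ioo (0:ℝ) 1, 0 ≤ F x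
  · obtain ⟨c, hc, h⟩ := S.hopf hK.hD hK.hv hK.hE (fun x hx => mul_nonneg hk'.le (h1 x hx)) hx0
      (mul_pos hk' (lt_of_le_of_ne (h1 x0 hx0) hne.symm)) (continuousAt_const.mul (hFc hx0))
    exact ⟨c, 1, hc, by ring, fun x hx => by rw [one_mul]; exact h x hx⟩
  by_cases h2 : ∀ x ∈ Ioo (0:ℝ) 1, F x ≤ 0
  · have S' := Sol.lin hK.hv S S 0 1
    obtain ⟨c, hc, h⟩ := S'.hopf hK.hD hK.hv hK.hE (fun x hx => by nlinarith [mul_nonneg hk'.le (neg_nonneg.2 (h2 x hx))]) hx0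
      (by nlinarith [mul_pos hk' (neg_pos.2 (lt_of_le_of_ne (h2 x0 hx0) hne))])
      ((continuousAt_const.mul (continuousAt_const.mul (hFc hx0))).sub (continuousAt_const.mul (continuousAt_const.mul (hFc hx0))))
    exact ⟨c, -1, hc, by ring, fun x hx => (h x hx).trans (le_of_eq (by simp only [hF]; ring))⟩
  exfalso
  push Not at h1 h2
  obtain ⟨x1, hx1, h1⟩ := h1
  obtain ⟨x2, hx2, h2⟩ := h2
  obtain ⟨C, hC⟩ := S.Fb
  obtain ⟨f, G, hf, SG, hKf⟩ := hK.sol_src (q := fun x => |F x|) S.Fm.abs (C := C) (fun x hx => by rw [abs_abs]; exact hC x hx)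
  have hA : ∀ {x}, x ∈ Ioo (0:ℝ) 1 → ContinuousAt (fun x => |F x|) x := fun hx => (hFc hx).abs
  obtain ⟨c, hc, hc'⟩ := (Sol.lin hK.hv SG S 1 k).hopf hK.hD hK.hv hK.hE
    (fun x hx => by rw [mul_inv_cancel_left₀ hk.ne']; nlinarith [le_abs_self (F x)]) hx1
    (by rw [mul_inv_cancel_left₀ hk.ne']; nlinarith [abs_nonneg (F x1)])
    ((continuousAt_const.mul (hA hx1)).sub (continuousAt_const.mul (continuousAt_const.mul (hFc hx1))))
  obtain ⟨d, hd, hd'⟩ := (Sol.lin hK.hv SG S 1 (-k)).hopf hK.hD hK.hv hK.hE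
    (fun x hx => by rw [neg_mul, mul_inv_cancel_left₀ hk.ne']; nlinarith [neg_abs_le (F x)]) hx2
    (by rw [neg_mul, mul_inv_cancel_left₀ hk.ne']; nlinarith [abs_nonneg (F x2)])
    ((continuousAt_const.mul (hA hx2)).sub (continuousAt_const.mul (continuousAt_const.mul (hFc hx2))))
  set m := min c d
  have hm : 0 < m := lt_min hc hd
  have low : ∀ x ∈ Ioo (0:ℝ) 1, k * |F x| + m * aa x ≤ G x := fun x hx => by
    have a1 := hc' x hx
    have a2 := hd' x hx
    have a3 : m * aa x ≤ c * aa x := mul_le_mul_of_nonneg_right (min_le_left _ _) (aa_pos hx).le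
    have a4 : m * aa x ≤ d * aa x := mul_le_mul_of_nonneg_right (min_le_right _ _) (aa_pos hx).le
    rcases abs_cases (F x) with ⟨h, _⟩ | ⟨h, _⟩ <;> rw [h] <;> linarith
  have i1 : Integrable (fun x => K f x * f x) nu := L2.integrable_inner (𝕜 := ℝ) f (K f) |>.congr (by
    filter_upwards with x; simp)
  have i2 : Integrable (fun x => f x ^ 2) nu := (Lp.memLp f).integrable_sq
  have key := htop f
  rw [inner_HH, norm_sq_HH, ← integral_const_mul] at key
  have hFi : Integrable (fun x => |F x|) nu := bint nu_null S.Fm.abs (C := |C|) (fun x hx => by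
    rw [abs_abs]; exact (hC x hx).trans (by nlinarith [aa_pos hx, aa_le_one x, le_abs_self C, abs_nonneg C]))
  have : ∫ x, (k * f x ^ 2 + m * |F x|) ∂nu ≤ ∫ x, K f x * f x ∂nu := by
    refine integral_mono_ae ((i2.const_mul k).add (hFi.const_mul m)) i1 ?_
    filter_upwards [hf, hKf, ae_nu] with x e1 e2 hx
    rw [e1, e2]
    have hs := sa_pos hx
    have : k * (|F x| / sa x) ^ 2 + m * |F x| = (k * |F x| + m * aa x) / sa x * (|F x| / sa x) := by
      rw [← sa_sq hx]; field_simp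
    rw [this]
    exact mul_le_mul_of_nonneg_right (div_le_div_of_nonneg_right (low x hx) hs.le) (by positivity)
  rw [integral_add (i2.const_mul k) (hFi.const_mul m), integral_const_mul m] at this
  have h0 : ∫ x, |F x| ∂nu ≤ 0 := by nlinarith
  have h0' := le_antisymm h0 (integral_nonneg fun x => abs_nonneg _)
  rw [integral_eq_zero_iff_of_nonneg (fun x => abs_nonneg _) hFi] at h0'
  apply hu0
  refine Lp.ext ?_
  filter_upwards [ha, h0', Lp.coeFn_zero ℝ 2 nu] with x e1 e2 e3
  rw [e1, e3]
  simp only [Pi.zero_apply, abs_eq_zero] at e2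
  change F x / sa x = _
  rw [e2, zero_div]; rfl

structure Spec (hK : KOp v M D K) {ι : Type} (b : HilbertBasis ι ℝ HH) (k : ι → ℝ) (i₀ : ι) (k₁ c ε : ℝ) : Prop where
  eig : ∀ i, K (b i) = k i • b i
  nn : ∀ i, 0 ≤ k i
  k1pos : 0 < k₁
  k1lt : k₁ < k i₀
  gap : ∀ i, i ≠ i₀ → k i ≤ k₁
  cpos : 0 < c
  eps : ε * ε = 1
  low : ∀ x ∈ Ioo (0:ℝ) 1, c * aa x ≤ ε * ((k i₀)⁻¹ * hK.KF (b i₀) x)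

lemma KOp.ne_zero (hK : KOp v M D K) : K ≠ 0 := by
  rintro rfl
  obtain ⟨f, -, h, -⟩ := hK.of_sol (Sol.sol_aa hK.hv)
  obtain ⟨-, h2⟩ : True ∧ (0:HH →L[ℝ] HH) f =ᵐ[nu] fun x => aa x / sa x := by
    obtain ⟨g, _, h3, h4⟩ := hK.of_sol (Sol.sol_aa hK.hv)
    refine ⟨trivial, ?_⟩
    simpa using h4
  have : ∀ᵐ x ∂nu, False := by
    filter_upwards [h2, ae_nu, Lp.coeFn_zero ℝ 2 nu] with x h1 hx h3
    have : (0:HH) x = aa x / sa x := h1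
    rw [h3] at this
    have := div_pos (aa_pos hx) (sa_pos hx)
    simp_all
  rw [eventually_false_iff_eq_bot, ae_eq_bot] at this
  exact IsProbabilityMeasure.ne_zero nu this

lemma KOp.spec (hK : KOp v M D K) : ∃ (ι : Type) (b : HilbertBasis ι ℝ HH) (k : ι → ℝ) (i₀ : ι) (k₁ c ε : ℝ),
    Spec hK b k i₀ k₁ c ε := by
  obtain ⟨ι, b, k, hb⟩ := exists_basis hK.comp hK.symm
  have hne : ∀ i, b i ≠ 0 := fun i h => by
    have := b.orthonormal.1 i
    rw [h] at this; simp at this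
  have hnn : ∀ i, 0 ≤ k i := fun i => hK.eig_pos (hne i) (hb i)
  obtain ⟨i₀, h0, hmax⟩ := exists_top hK.comp b k hb hnn hK.ne_zero
  have sgn : ∀ i, k i = k i₀ → ∃ c ε : ℝ, 0 < c ∧ ε * ε = 1 ∧ ∀ x ∈ Ioo (0:ℝ) 1, c * aa x ≤ ε * ((k i)⁻¹ * hK.KF (b i) x) :=
    fun i hi => hK.top_sign (by rw [hi]; exact h0) (hne i) (hb i) (by rw [hi]; exact top_le b k hK.symm hb hmax)
  obtain ⟨c, ε, hc, he, hlow⟩ := sgn i₀ rfl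
  have hsimple : ∀ i, i ≠ i₀ → k i < k i₀ := by
    intro i hi
    refine lt_of_le_of_ne (hmax i) fun heq => ?_
    obtain ⟨d, ε', hd, he', hlow'⟩ := sgn i heq
    have ho : inner ℝ (b i₀) (b i) = 0 := b.orthonormal.2 hi.symm
    rw [inner_HH] at ho
    have a0 := (hK.eig h0.ne' (hb i₀)).2
    have a1 := (hK.eig (by rw [heq]; exact h0.ne') (hb i)).2
    have i1 : Integrable (fun x => b i₀ x * b i x) nu := L2.integrable_inner (𝕜 := ℝ) (b i) (b i₀) |>.congr (by
      filter_upwards with x; simp)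
    have h3 : ∫ x, c * d * aa x ∂nu ≤ ∫ x, (ε * ε') * (b i₀ x * b i x) ∂nu := by
      refine integral_mono_ae ((bint nu_null measurable_aa (C := 1) fun x hx => aa_abs hx).const_mul _) (i1.const_mul _) ?_
      filter_upwards [a0, a1, ae_nu] with x e0 e1 hx
      rw [e0, e1]
      have hs := sa_pos hx
      have := mul_le_mul (hlow x hx) (hlow' x hx) (by have := aa_pos hx; positivity) (le_trans (by have := aa_pos hx; positivity) (hlow x hx))
      rw [show ε * ε' * (((k i₀)⁻¹ * hK.KF (b i₀) x) / sa x * (((k i)⁻¹ * hK.KF (b i) x) / sa x)) =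
        (ε * ((k i₀)⁻¹ * hK.KF (b i₀) x)) * (ε' * ((k i)⁻¹ * hK.KF (b i) x)) / aa x by rw [← sa_sq hx]; field_simp]
      rw [le_div_iff₀ (aa_pos hx)]
      refine le_trans (le_of_eq (by ring)) this
    rw [integral_const_mul, integral_const_mul, ho, mul_zero] at h3
    have h4 : 0 < ∫ x, aa x ∂nu := by
      rw [integral_pos_iff_support_of_nonneg_ae (by filter_upwards [ae_nu] with x hx using (aa_pos hx).le)
        (bint nu_null measurable_aa (C := 1) fun x hx => aa_abs hx)]
      have : nu (Ioo 0 1) ≤ nu (Function.support aa) := measure_mono fun x hx => (aa_pos hx).ne'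
      refine lt_of_lt_of_le ?_ this
      simp [nu]
    have : 0 < c * d * ∫ x, aa x ∂nu := by positivity
    linarith
  obtain ⟨k₁, h1, h2, h3⟩ := exists_gap hK.comp b k hb h0 hsimple
  exact ⟨ι, b, k, i₀, k₁, c, ε, hb, hnn, h1, h2, h3, hc, he, hlow⟩
end WFA
end

section
namespace WFA
variable {v : ℝ → ℝ} {D M : ℝ} {K : HH →L[ℝ] HH}

lemma KOp.KF_zero (hK : KOp v M D K) {f : HH} (h : K f = 0) {x : ℝ} (hx : x ∈ Ioo (0:ℝ) 1) : hK.KF f x = 0 := by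
  have h1 : hK.KF f =ᵐ[volume.restrict (Ioo (0:ℝ) 1)] fun _ => 0 := by
    filter_upwards [show ∀ᵐ y ∂nu, K f y = hK.KF f y / sa y from hK.ae f, show ∀ᵐ y ∂nu, y ∈ Ioo (0:ℝ) 1 from ae_nu,
      show ∀ᵐ y ∂nu, (0:HH) y = (0 : ℝ → ℝ) y from Lp.coeFn_zero ℝ 2 nu] with y h1 hy h3
    rw [h, h3, Pi.zero_apply, eq_comm, div_eq_zero_iff] at h1
    exact h1.resolve_right (sa_pos hy).ne'
  exact Measure.eqOn_open_of_ae_eq h1 isOpen_Ioo (fun y hy => (hK.KF_contAt f hy).continuousWithinAt) continuousOn_const hx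

lemma ext_C2 {m₁ m₂ : Measure ℝ} [IsFiniteMeasure m₁] [IsFiniteMeasure m₂] (h₁ : m₁ (Ioo (0:ℝ) 1)ᶜ = 0)
    (h₂ : m₂ (Ioo (0:ℝ) 1)ᶜ = 0)
    (h : ∀ ψ : ℝ → ℝ, ContDiff ℝ 2 ψ → ψ 0 = 0 → ψ 1 = 0 → ∫ x, ψ x ∂m₁ = ∫ x, ψ x ∂m₂) : m₁ = m₂ := by
  have hop : ∀ U : Set ℝ, IsOpen U → m₁ U = m₂ U := by
    intro U hU
    obtain ⟨f, hf, hfc, hfr⟩ := (hU.inter isOpen_Ioo : IsOpen (U ∩ Ioo (0:ℝ) 1)).exists_contDiff_support_eq (n := 2)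
    have hf0 : ∀ x, x ∉ U ∩ Ioo (0:ℝ) 1 → f x = 0 := fun x hx => by
      rw [← hf] at hx; exact Function.notMem_support.1 hx
    have hfp : ∀ x, x ∈ U ∩ Ioo (0:ℝ) 1 → 0 < f x := fun x hx => by
      rw [← hf] at hx
      exact lt_of_le_of_ne (hfr ⟨x, rfl⟩).1 (Function.mem_support.1 hx).symm
    set φ : ℕ → ℝ → ℝ := fun n x => Real.smoothTransition (n * f x) with hφ
    have hφc : ∀ n, ContDiff ℝ 2 (φ n) := fun n => Real.smoothTransition.contDiff.comp (contDiff_const.mul hfc)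
    have hlim : ∀ (m : Measure ℝ) [IsFiniteMeasure m], m (Ioo (0:ℝ) 1)ᶜ = 0 →
        Tendsto (fun n => ∫ x, φ n x ∂m) atTop (𝓝 (m.real U)) := by
      intro m _ hm
      have e : m.real U = ∫ x, (U ∩ Ioo (0:ℝ) 1).indicator (fun _ => (1:ℝ)) x ∂m := by
        rw [integral_indicator (hU.inter isOpen_Ioo).measurableSet]
        simp only [integral_const, smul_eq_mul, mul_one, measureReal_def, Measure.restrict_apply MeasurableSet.univ, univ_inter]
        congr 1
        rw [measure_inter_conull hm]
      rw [e]
      refine tendsto_integral_of_dominated_convergence (fun _ => 1) (fun n => (hφc n).continuous.aestronglyMeasurable)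
        (integrable_const _) (fun n => Eventually.of_forall fun x => ?_) (Eventually.of_forall fun x => ?_)
      · rw [Real.norm_eq_abs, abs_of_nonneg (Real.smoothTransition.nonneg _)]
        exact Real.smoothTransition.le_one _
      · by_cases hx : x ∈ U ∩ Ioo (0:ℝ) 1
        · rw [indicator_of_mem hx]
          obtain ⟨N, hN⟩ := exists_nat_gt (1 / f x)
          refine tendsto_const_nhds.congr' ?_
          filter_upwards [eventually_ge_atTop N] with n hn
          have hp := hfp x hx
          refine (Real.smoothTransition.one_of_one_le ?_).symm
          rw [div_lt_iff₀ hp] at hN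
          have : (N:ℝ) ≤ n := by exact_mod_cast hn
          nlinarith
        · rw [indicator_of_notMem hx]
          refine tendsto_const_nhds.congr fun n => ?_
          simp only [hφ, hf0 x hx, mul_zero]
          exact (Real.smoothTransition.zero_of_nonpos le_rfl).symm
    have := tendsto_nhds_unique (hlim m₁ h₁) ((hlim m₂ h₂).congr fun n => (h (φ n) (hφc n) (by
      simp only [hφ]; rw [hf0 0 (by simp)]; simp) (by simp only [hφ]; rw [hf0 1 (by simp)]; simp)).symm)
    rwa [measureReal_def, measureReal_def, ENNReal.toReal_eq_toReal_iff' (measure_ne_top _ _) (measure_ne_top _ _)] at this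
  exact ext_of_generate_finite {U : Set ℝ | IsOpen U} BorelSpace.measurable_eq isPiSystem_isOpen
    (fun U hU => hop U hU) (hop univ isOpen_univ)

lemma KOp.U (hK : KOp v M D K) {ι : Type} (b : HilbertBasis ι ℝ HH) (k : ι → ℝ) (hb : ∀ i, K (b i) = k i • b i)
    {m₁ m₂ : Measure ℝ} [IsFiniteMeasure m₁] [IsFiniteMeasure m₂] (h₁ : m₁ (Ioo (0:ℝ) 1)ᶜ = 0)
    (h₂ : m₂ (Ioo (0:ℝ) 1)ᶜ = 0) (h : ∀ i, k i ≠ 0 → ∫ x, hK.KF (b i) x ∂m₁ = ∫ x, hK.KF (b i) x ∂m₂) : m₁ = m₂ := by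
  have hJ : hK.J m₁ h₁ = hK.J m₂ h₂ := clm_eq b fun i => by
    rw [hK.J_apply, hK.J_apply]
    by_cases hi : k i = 0
    · have : K (b i) = 0 := by rw [hb, hi, zero_smul]
      rw [int_congr_Ioo h₁ fun x hx => hK.KF_zero this hx, int_congr_Ioo h₂ fun x hx => hK.KF_zero this hx]
      simp
    · exact h i hi
  refine ext_C2 h₁ h₂ fun ψ hψ h0 h1 => ?_
  obtain ⟨f, -, hf, -⟩ := hK.of_sol (Sol.of_C2 hK.hv hψ h0 h1)
  rw [← int_congr_Ioo h₁ hf, ← int_congr_Ioo h₂ hf, ← hK.J_apply m₁ h₁, ← hK.J_apply m₂ h₂, hJ]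
end WFA
end

section
namespace WFA
variable {v : ℝ → ℝ} {D M : ℝ} {K : HH →L[ℝ] HH}

lemma exists_diag {ι : Type} (b : HilbertBasis ι ℝ HH) (g : ι → ℝ) {C : ℝ} (hC : 0 ≤ C) (hg : ∀ i, |g i| ≤ C) (w : HH) :
    ∃ h : HH, (∀ i, inner ℝ (b i) h = g i * inner ℝ (b i) w) ∧ ‖h‖ ≤ C * ‖w‖ := by
  have h2 : (0:ℝ) < (2:ℝ≥0∞).toReal := by norm_num
  have bd : ∀ s : Finset ι, ∑ i ∈ s, ‖g i * b.repr w i‖ ^ (2:ℝ≥0∞).toReal ≤ (C * ‖w‖) ^ (2:ℝ≥0∞).toReal := by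
    intro s
    have h1 := lp.sum_rpow_le_norm_rpow h2 (b.repr w) s
    rw [LinearIsometryEquiv.norm_map] at h1
    rw [Real.mul_rpow hC (norm_nonneg _)]
    refine le_trans ?_ (mul_le_mul_of_nonneg_left h1 (by positivity))
    rw [Finset.mul_sum]
    refine Finset.sum_le_sum fun i _ => ?_
    rw [norm_mul, Real.mul_rpow (norm_nonneg _) (norm_nonneg _)]
    exact mul_le_mul_of_nonneg_right (Real.rpow_le_rpow (norm_nonneg _) (hg i) h2.le) (by positivity)
  have hm : Memℓp (fun i => g i * b.repr w i) 2 := memℓp_gen' bd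
  refine ⟨b.repr.symm ⟨_, hm⟩, fun i => ?_, ?_⟩
  · rw [← b.repr_apply_apply, LinearIsometryEquiv.apply_symm_apply, ← b.repr_apply_apply]
  · rw [LinearIsometryEquiv.norm_map]
    exact lp.norm_le_of_forall_sum_le h2 (by positivity) bd

lemma withDens_null (d : ℝ → ℝ≥0∞) : (nu.withDensity d) (Ioo (0:ℝ) 1)ᶜ = 0 :=
  withDensity_absolutelyContinuous _ _ nu_null

lemma withDens_fin {d : ℝ → ℝ} {C : ℝ} (hb : ∀ x ∈ Ioo (0:ℝ) 1, |d x| ≤ C) :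
    IsFiniteMeasure (nu.withDensity fun x => ENNReal.ofReal (d x)) := by
  refine isFiniteMeasure_withDensity ?_
  refine ((lintegral_mono_ae (g := fun _ => ENNReal.ofReal C) ?_).trans_lt ?_).ne
  · filter_upwards [ae_nu] with x hx using ENNReal.ofReal_le_ofReal ((le_abs_self _).trans (hb x hx))
  · simp

lemma withDens_int {d : ℝ → ℝ} (hd : Measurable d) (f : ℝ → ℝ) :
    ∫ x, f x ∂(nu.withDensity fun x => ENNReal.ofReal (d x)) = ∫ x, max (d x) 0 * f x ∂nu := by
  have := integral_withDensity_eq_integral_smul (μ := nu) (f := fun x => (d x).toNNReal) hd.real_toNNReal f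
  simpa [ENNReal.ofReal, NNReal.smul_def, Real.coe_toNNReal'] using this

/-- comparison of a measure with a signed density -/
lemma KOp.dens (hK : KOp v M D K) {ι : Type} (b : HilbertBasis ι ℝ HH) (k : ι → ℝ) (hb : ∀ i, K (b i) = k i • b i)
    {m : Measure ℝ} [IsFiniteMeasure m] (hm : m (Ioo (0:ℝ) 1)ᶜ = 0) {d : ℝ → ℝ} (hd : Measurable d) {C : ℝ}
    (hdb : ∀ x ∈ Ioo (0:ℝ) 1, |d x| ≤ C)
    (h : ∀ i, k i ≠ 0 → ∫ x, hK.KF (b i) x ∂m = ∫ x, d x * hK.KF (b i) x ∂nu)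
    {f : ℝ → ℝ} (hf : Measurable f) {C' : ℝ} (hfb : ∀ x ∈ Ioo (0:ℝ) 1, |f x| ≤ C') :
    ∫ x, f x ∂m = ∫ x, d x * f x ∂nu := by
  have f1 := withDens_fin hdb
  have f2 := withDens_fin (d := fun x => - d x) (C := C) (fun x hx => by rw [abs_neg]; exact hdb x hx)
  have key : ∀ {f : ℝ → ℝ} (_ : Measurable f) {C' : ℝ} (_ : ∀ x ∈ Ioo (0:ℝ) 1, |f x| ≤ C'),
      ∫ x, f x ∂(nu.withDensity fun x => ENNReal.ofReal (d x)) -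
        ∫ x, f x ∂(nu.withDensity fun x => ENNReal.ofReal (- d x)) = ∫ x, d x * f x ∂nu := by
    intro f hf C' hfb
    have bb : ∀ x ∈ Ioo (0:ℝ) 1, |max (d x) 0 * f x| ≤ C * C' ∧ |max (-d x) 0 * f x| ≤ C * C' := fun x hx => by
      have h1 := hdb x hx
      have h2 := hfb x hx
      have h3 := abs_nonneg (d x)
      rw [abs_mul, abs_mul]
      constructor <;> refine mul_le_mul (le_trans ?_ h1) h2 (abs_nonneg _) (h3.trans h1) <;>
        rw [abs_of_nonneg (le_max_right _ _)] <;> exact max_le (by first | exact le_abs_self _ | exact neg_le_abs _) h3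
    rw [withDens_int hd, withDens_int (d := fun x => - d x) hd.neg, ← integral_sub]
    · congr 1; ext x
      rcases le_total (d x) 0 with hx | hx
      · simp [hx]
      · simp [hx]
    · exact bint nu_null ((hd.max measurable_const).mul hf) (fun x hx => (bb x hx).1)
    · exact bint nu_null ((hd.neg.max measurable_const).mul hf) (fun x hx => (bb x hx).2)
  have kb : ∀ i, ∀ x ∈ Ioo (0:ℝ) 1, |hK.KF (b i) x| ≤ ‖hK.src‖ * ‖b i‖ := fun i x hx => (hK.KF_le (b i) hx).trans
    (mul_le_of_le_one_right (by positivity) (sa_le_one x))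
  have hU : m + (nu.withDensity fun x => ENNReal.ofReal (- d x)) = nu.withDensity fun x => ENNReal.ofReal (d x) := by
    refine hK.U b k hb (by rw [Measure.add_apply, hm, withDens_null, add_zero]) (withDens_null _) fun i hi => ?_
    rw [integral_add_measure (hK.KF_int hm _) (hK.KF_int (withDens_null _) _), h i hi, ← key (hK.KF_meas (b i)) (kb i)]
    ring
  have := key hf hfb
  rw [← hU, integral_add_measure (bint hm hf hfb) (bint (withDens_null _) hf hfb)] at this
  linarith

lemma KOp.int_KF (hK : KOp v M D K) {k : ℝ} {u : HH} (hu : K u = k • u) (g : HH) {d : ℝ → ℝ}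
    (hd : g =ᵐ[nu] fun x => d x * sa x) : ∫ x, d x * hK.KF u x ∂nu = k * inner ℝ u g := by
  rw [← real_inner_smul_left, inner_HH]
  apply integral_congr_ae
  filter_upwards [hK.ae u, ae_nu, hd] with x h1 hx h2
  rw [← hu, h1, h2]
  have := (sa_pos hx).ne'
  field_simp

lemma WFlow.coef (hK : KOp v M D K) {μ : Measure ℝ} {p O : ℝ → Measure ℝ} (W : WFlow v D μ p O) {k : ℝ} (hk : k ≠ 0) {u : HH}
    (hu : K u = k • u) {t : ℝ} (ht : 0 ≤ t) :
    ∫ x, hK.KF u x ∂(p t) = Real.exp (-(D * k⁻¹ * t)) * ∫ x, hK.KF u x ∂μ := by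
  have := W.eig hK.hD hK.hv (hK.eig hk hu).1 ht
  rw [integral_const_mul, integral_const_mul] at this
  have h2 := congrArg (fun z => k * z) this
  rw [mul_inv_cancel_left₀ hk] at h2
  rw [h2]; field_simp

lemma exp4 (hD : 0 < D) {l l₁ t : ℝ} (h1 : 0 < l₁) (h : l₁ ≤ l) (ht : 1 ≤ t) :
    l ^ 4 * Real.exp (-(D * l * t)) ≤ (24 / D ^ 4 * Real.exp (D * l₁)) * Real.exp (-(D * l₁ * t)) := by
  have hl : 0 < l := h1.trans_le h
  have e1 := Real.pow_div_factorial_le_exp (D * l) (by positivity) 4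
  have e2 : l ^ 4 ≤ 24 / D ^ 4 * Real.exp (D * l) := by
    rw [div_le_iff₀ (by positivity)] at e1
    rw [div_mul_eq_mul_div, le_div_iff₀ (by positivity)]
    simp [Nat.factorial] at e1
    nlinarith [e1]
  calc _ ≤ (24 / D ^ 4 * Real.exp (D * l)) * Real.exp (-(D * l * t)) := mul_le_mul_of_nonneg_right e2 (Real.exp_pos _).le
    _ = 24 / D ^ 4 * Real.exp (-(D * l * (t - 1))) := by rw [mul_assoc, ← Real.exp_add]; ring_nf
    _ ≤ 24 / D ^ 4 * Real.exp (-(D * l₁ * (t - 1))) := by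
      have := mul_le_mul_of_nonneg_right (mul_le_mul_of_nonneg_left h hD.le) (sub_nonneg.2 ht)
      gcongr
    _ = _ := by rw [mul_assoc (24 / D ^ 4), ← Real.exp_add]; ring_nf

structure Ana (v : ℝ → ℝ) (D l₀ l₁ c C : ℝ) (F : ℝ → ℝ) : Prop where
  l0pos : 0 < l₀
  l01 : l₀ < l₁
  cpos : 0 < c
  Cpos : 0 < C
  Fm : Measurable F
  low : ∀ x ∈ Ioo (0:ℝ) 1, c * aa x ≤ F x
  up : ∀ x ∈ Ioo (0:ℝ) 1, F x ≤ C * aa x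
  sol : Sol v F (fun x => l₀ * F x)
  conv : ∀ μ p O, WFlow v D μ p O → ∀ t : ℝ, 1 ≤ t → ∀ f : ℝ → ℝ, Measurable f → (∀ x ∈ Ioo (0:ℝ) 1, |f x| ≤ 1) →
    |∫ x, f x ∂(p t) - Real.exp (-(D * l₀ * t)) * (∫ x, F x ∂μ) * ∫ x, F x / aa x * f x ∂nu| ≤
      C * Real.exp (-(D * l₁ * t)) * ∫ x, aa x ∂μ
  stat : ∀ μ p O (a : ℝ), WFlow v D μ p O →
    (∀ f : ℝ → ℝ, Measurable f → (∃ C, ∀ x ∈ Ioo (0:ℝ) 1, |f x| ≤ C) → ∫ x, f x ∂μ = a * ∫ x, F x / aa x * f x ∂nu) →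
    ∀ t : ℝ, 0 ≤ t → ∀ f : ℝ → ℝ, Measurable f → (∃ C, ∀ x ∈ Ioo (0:ℝ) 1, |f x| ≤ C) →
      ∫ x, f x ∂(p t) = Real.exp (-(D * l₀ * t)) * ∫ x, f x ∂μ

lemma KOp.ana (hK : KOp v M D K) : ∃ l₀ l₁ c C F, Ana v D l₀ l₁ c C F := by
  obtain ⟨ι, b, k, i₀, k₁, c, ε, sp⟩ := hK.spec
  classical
  have hD := hK.hD
  have hk0 : 0 < k i₀ := sp.k1pos.trans sp.k1lt
  obtain ⟨S, ha⟩ := hK.eig hk0.ne' (sp.eig i₀)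
  set F : ℝ → ℝ := fun x => ε * ((k i₀)⁻¹ * hK.KF (b i₀) x) with hF
  have SF : Sol v F (fun x => (k i₀)⁻¹ * F x) := by
    convert Sol.lin hK.hv S S ε 0 using 2 <;> simp [hF]; ring
  obtain ⟨C, hC⟩ := SF.Fb
  set C₂ := hK.B2 * (24 / D ^ 4 * Real.exp (D * k₁⁻¹)) * hK.B2 with hC2
  have hB := hK.B2_nonneg
  have hC20 : 0 ≤ C₂ := by positivity
  have hq : ∀ x ∈ Ioo (0:ℝ) 1, |F x / aa x| ≤ C := fun x hx => by
    rw [abs_div, abs_of_pos (aa_pos hx), div_le_iff₀ (aa_pos hx)]; exact hC x hx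
  have hqm : Measurable fun x => F x / aa x := SF.Fm.div measurable_aa
  have hbF : ((ε • b i₀ : HH)) =ᵐ[nu] fun x => F x / aa x * sa x := by
    filter_upwards [Lp.coeFn_smul ε (b i₀), ha, ae_nu] with x h1 h2 hx
    rw [h1, Pi.smul_apply, h2, ← sa_sq hx, smul_eq_mul]
    have := (sa_pos hx).ne'
    simp only [hF]; field_simp
  refine ⟨(k i₀)⁻¹, k₁⁻¹, c, max C (C₂ + 1), F, inv_pos.2 hk0, (inv_lt_inv₀ hk0 sp.k1pos).2 sp.k1lt, sp.cpos,
    lt_max_of_lt_right (by linarith), SF.Fm, sp.low,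
    fun x hx => (le_abs_self _).trans ((hC x hx).trans (mul_le_mul_of_nonneg_right (le_max_left _ _) (aa_pos hx).le)), SF, ?_, ?_⟩
  · intro μ p O W t ht f hf hfb
    have t0 : 0 ≤ t := by linarith
    have := W.muf; have := W.pf t
    obtain ⟨w, hw, hwi⟩ := hK.exists_riesz μ W.mus
    have hwb : ∀ i, inner ℝ (b i) w = k i * ∫ x, hK.KF (b i) x ∂μ := fun i => by
      rw [real_inner_comm, hwi, ← integral_const_mul]
      exact int_congr_Ioo W.mus fun x hx => by rw [sp.eig, hK.KF_smul _ _ hx]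
    set g : ι → ℝ := fun i => if i = i₀ then 0 else if k i = 0 then 0 else (k i)⁻¹ ^ 4 * Real.exp (-(D * (k i)⁻¹ * t)) with hg
    set C₁ := (24 / D ^ 4 * Real.exp (D * k₁⁻¹)) * Real.exp (-(D * k₁⁻¹ * t)) with hC1
    have hC1p : 0 ≤ C₁ := by positivity
    have hgb : ∀ i, |g i| ≤ C₁ := fun i => by
      simp only [hg]
      split_ifs with h1 h2
      · simpa using hC1p
      · simpa using hC1p
      · have hp : 0 < k i := lt_of_le_of_ne (sp.nn i) (Ne.symm h2)
        rw [abs_of_nonneg (by positivity)]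
        exact exp4 hD (inv_pos.2 sp.k1pos) (inv_anti₀ hp (sp.gap i h1)) ht
    obtain ⟨h, hh, hhn⟩ := exists_diag b g hC1p hgb w
    have hd1 : ∀ x ∈ Ioo (0:ℝ) 1, |hK.KF (K h) x / aa x| ≤ hK.B2 * ‖h‖ := fun x hx => by
      rw [abs_div, abs_of_pos (aa_pos hx), div_le_iff₀ (aa_pos hx)]; exact hK.KF2_le h hx
    have hd1m : Measurable fun x => hK.KF (K h) x / aa x := (hK.KF_meas _).div measurable_aa
    set A := Real.exp (-(D * (k i₀)⁻¹ * t)) * ∫ x, F x ∂μ with hA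
    have hrep := hK.dens b k sp.eig (W.ps t) (d := fun x => hK.KF (K h) x / aa x + A * (F x / aa x))
      (hd1m.add (hqm.const_mul _)) (C := hK.B2 * ‖h‖ + |A| * C)
      (fun x hx => (abs_add_le _ _).trans (add_le_add (hd1 x hx) (by rw [abs_mul]; exact mul_le_mul_of_nonneg_left (hq x hx) (abs_nonneg _))))
      (fun i hi => by
        rw [W.coef hK hi (sp.eig i) t0, hK.int_KF (sp.eig i) (K (K h) + A • ε • b i₀)]
        · rw [inner_add_right, ← hK.symm, sp.eig, inner_smul_left, ← hK.symm, sp.eig, inner_smul_left, hh, hwb, inner_smul_right,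
            inner_smul_right]
          by_cases hi0 : i = i₀
          · subst hi0
            rw [real_inner_self_eq_norm_sq, b.orthonormal.1]
            have e := sp.eps
            have hAe : A = Real.exp (-(D * (k i)⁻¹ * t)) * (ε * ((k i)⁻¹ * ∫ x, hK.KF (b i) x ∂μ)) := by
              rw [hA, hF, integral_const_mul, integral_const_mul]
            simp only [hg, if_true, hAe]
            simp
            field_simp
            rw [sq, e, mul_one]
          · rw [b.orthonormal.2 hi0]
            simp only [hg, if_neg hi0, if_neg hi]
            simp
            field_simp
        · filter_upwards [Lp.coeFn_add (K (K h)) (A • ε • b i₀), Lp.coeFn_smul A (ε • b i₀), hbF, hK.ae (K h), ae_nu] with x h1 h2 h3 h4 hx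
          rw [h1, Pi.add_apply, h2, Pi.smul_apply, h3, h4, smul_eq_mul, ← sa_sq hx]
          have := (sa_pos hx).ne'
          field_simp) hf hfb
    have i1 : Integrable (fun x => hK.KF (K h) x / aa x * f x) nu := bint nu_null (hd1m.mul hf) (C := hK.B2 * ‖h‖)
      (fun x hx => by
        rw [abs_mul]; exact (mul_le_of_le_one_right (abs_nonneg _) (hfb x hx)).trans (hd1 x hx))
    have i2 : Integrable (fun x => F x / aa x * f x) nu := bint nu_null (hqm.mul hf) (C := C)
      (fun x hx => by
        rw [abs_mul]; exact (mul_le_of_le_one_right (abs_nonneg _) (hfb x hx)).trans (hq x hx))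
    have e1 : ∫ x, f x ∂(p t) = ∫ x, hK.KF (K h) x / aa x * f x ∂nu + A * ∫ x, F x / aa x * f x ∂nu := by
      rw [hrep, ← integral_const_mul, ← integral_add i1 (i2.const_mul _)]
      congr 1; ext x; ring
    rw [e1, add_sub_cancel_right]
    refine (bint_le (C := hK.B2 * ‖h‖) nu_null (fun x hx => by
        rw [abs_mul]; exact (mul_le_of_le_one_right (abs_nonneg _) (hfb x hx)).trans (hd1 x hx))).trans ?_
    have hpos : 0 ≤ ∫ x, aa x ∂μ := integral_nonneg_of_ae (by
      filter_upwards [ae_of_null W.mus] with x hx using (aa_pos hx).le)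
    have e2 : hK.B2 * ‖h‖ ≤ C₂ * Real.exp (-(D * k₁⁻¹ * t)) * ∫ x, aa x ∂μ := by
      calc hK.B2 * ‖h‖ ≤ hK.B2 * (C₁ * (hK.B2 * ∫ x, aa x ∂μ)) :=
            mul_le_mul_of_nonneg_left (hhn.trans (mul_le_mul_of_nonneg_left hw hC1p)) hB
        _ = _ := by rw [hC1, hC2]; ring
    simp only [measureReal_def, measure_univ, ENNReal.toReal_one, mul_one]
    refine e2.trans ?_
    have : C₂ ≤ max C (C₂ + 1) := le_trans (by linarith) (le_max_right _ _)
    gcongr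
  · intro μ p O a W hμ t ht f hf ⟨C', hfb⟩
    have := W.muf; have := W.pf t
    set A := Real.exp (-(D * (k i₀)⁻¹ * t)) with hA
    have kb : ∀ i, ∃ C, ∀ x ∈ Ioo (0:ℝ) 1, |hK.KF (b i) x| ≤ C := fun i => ⟨_, fun x hx => (hK.KF_le (b i) hx).trans
      (mul_le_of_le_one_right (by positivity) (sa_le_one x))⟩
    have hrep := hK.dens b k sp.eig (W.ps t) (d := fun x => A * a * (F x / aa x)) (hqm.const_mul _) (C := |A * a| * C)
      (fun x hx => by rw [abs_mul]; exact mul_le_mul_of_nonneg_left (hq x hx) (abs_nonneg _))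
      (fun i hi => by
        rw [W.coef hK hi (sp.eig i) ht, hμ _ (hK.KF_meas _) (kb i)]
        simp only [mul_assoc (A * a)]
        rw [integral_const_mul, hK.int_KF (sp.eig i) _ hbF]
        by_cases hi0 : i = i₀
        · subst hi0; rw [hA]; ring
        · rw [inner_smul_right, b.orthonormal.2 hi0]; ring) hf hfb
    rw [hrep, hμ f hf ⟨C', hfb⟩]
    simp only [mul_assoc (A * a)]
    rw [integral_const_mul]; ring
end WFA
end

section
namespace WFA

lemma exp_ac {h : ℝ → ℝ} (hm : Measurable h) {M : ℝ} (h0 : ∀ u, 0 ≤ h u) (hM : ∀ u, h u ≤ M) {t : ℝ} (ht : 0 ≤ t) :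
    AbsolutelyContinuousOnInterval (fun t => Real.exp (-∫ u in (0:ℝ)..t, h u)) 0 t ∧
      ∀ᵐ t : ℝ, HasDerivAt (fun t => Real.exp (-∫ u in (0:ℝ)..t, h u)) (-(h t * Real.exp (-∫ u in (0:ℝ)..t, h u))) t := by
  have hM0 : 0 ≤ M := (h0 0).trans (hM 0)
  have hb : ∀ u, ‖h u‖ ≤ M := fun u => by rw [Real.norm_eq_abs, abs_of_nonneg (h0 u)]; exact hM u
  have hi : ∀ a b : ℝ, IntervalIntegrable h volume a b := fun a b =>
    (intervalIntegrable_const (c := M)).mono_fun hm.aestronglyMeasurable (Eventually.of_forall fun u => by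
      rw [Real.norm_of_nonneg hM0]; exact hb u)
  set A : ℝ → ℝ := fun t => ∫ u in (0:ℝ)..t, h u with hA
  have hdiff : ∀ {u w : ℝ}, u ≤ w → A w - A u ≤ M * (w - u) ∧ 0 ≤ A w - A u := by
    intro u w huw
    have : A w - A u = ∫ x in u..w, h x := intervalIntegral.integral_interval_sub_left (hi _ _) (hi _ _)
    rw [this]
    refine ⟨?_, intervalIntegral.integral_nonneg_of_forall huw h0⟩
    calc _ ≤ ∫ x in u..w, M := intervalIntegral.integral_mono huw (hi _ _) intervalIntegrable_const hM
      _ = _ := by simp [mul_comm]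
  have hA0 : ∀ u, 0 ≤ u → 0 ≤ A u := fun u hu => intervalIntegral.integral_nonneg_of_forall hu h0
  have hlip : LipschitzOnWith M.toNNReal (fun t => Real.exp (-A t)) (uIcc 0 t) := by
    refine LipschitzOnWith.of_le_add_mul _ fun u hu w hw => ?_
    rw [uIcc_of_le ht] at hu hw
    rw [Real.coe_toNNReal _ hM0, Real.dist_eq]
    rcases le_total u w with h1 | h1
    · obtain ⟨a1, a2⟩ := hdiff h1
      have e1 : Real.exp (-A w) = Real.exp (-A u) * Real.exp (-(A w - A u)) := by rw [← Real.exp_add]; ring_nf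
      have e2 : Real.exp (-A u) ≤ 1 := Real.exp_le_one_iff.2 (neg_nonpos.2 (hA0 u hu.1))
      have e3 := Real.add_one_le_exp (-(A w - A u))
      rw [abs_of_nonpos (by linarith), e1]
      nlinarith [Real.exp_pos (-A u)]
    · have a2 := (hdiff h1).2
      have : Real.exp (-A u) ≤ Real.exp (-A w) := Real.exp_le_exp.2 (by linarith)
      have := mul_nonneg hM0 (abs_nonneg (u - w))
      linarith
  have hloc : LocallyIntegrable h volume := by
    rw [locallyIntegrable_iff]
    intro k hk
    exact Measure.integrableOn_of_bounded hk.measure_lt_top.ne hm.aestronglyMeasurable (Eventually.of_forall hb)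
  refine ⟨hlip.absolutelyContinuousOnInterval, ?_⟩
  filter_upwards [_root_.LocallyIntegrable.ae_hasDerivAt_integral hloc] with u hu
  refine (hu 0).fun_neg.exp.congr_deriv ?_
  ring

lemma exp_ode {h : ℝ → ℝ} (hm : Measurable h) {M : ℝ} (h0 : ∀ u, 0 ≤ h u) (hM : ∀ u, h u ≤ M) {t : ℝ} (ht : 0 ≤ t) :
    Real.exp (-∫ u in (0:ℝ)..t, h u) = 1 - ∫ u in (0:ℝ)..t, h u * Real.exp (-∫ w in (0:ℝ)..u, h w) := by
  obtain ⟨h1, h2⟩ := exp_ac hm h0 hM ht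
  have h3 := h1.integral_deriv_eq_sub
  rw [intervalIntegral.integral_congr_ae (g := fun u => -(h u * Real.exp (-∫ w in (0:ℝ)..u, h w)))
    (by filter_upwards [h2] with u hu _ using hu.deriv), intervalIntegral.integral_neg] at h3
  simp only [intervalIntegral.integral_same, neg_zero, Real.exp_zero] at h3
  linarith

lemma exp_prod {h : ℝ → ℝ} (hm : Measurable h) {M : ℝ} (h0 : ∀ u, 0 ≤ h u) (hM : ∀ u, h u ≤ M) {q : ℝ → ℝ} (hq : Continuous q)
    {t : ℝ} (ht : 0 ≤ t) :
    Real.exp (-∫ u in (0:ℝ)..t, h u) * ∫ u in (0:ℝ)..t, q u =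
      ∫ u in (0:ℝ)..t, (Real.exp (-∫ w in (0:ℝ)..u, h w) * q u
        - h u * Real.exp (-∫ w in (0:ℝ)..u, h w) * ∫ w in (0:ℝ)..u, q w) := by
  obtain ⟨h1, h2⟩ := exp_ac hm h0 hM ht
  have hQ := (hq.intervalIntegrable (μ := volume) 0 t).absolutelyContinuousOnInterval_intervalIntegral (c := 0) (by simp)
  have h3 := h1.integral_deriv_mul_eq_sub hQ
  simp only [intervalIntegral.integral_same, mul_zero, sub_zero] at h3
  rw [← h3]
  apply intervalIntegral.integral_congr_ae
  filter_upwards [h2] with u hu _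
  rw [hu.deriv, (intervalIntegral.integral_hasDerivAt_right (hq.intervalIntegrable _ _)
    (hq.stronglyMeasurableAtFilter _ _) hq.continuousAt).deriv]
  ring

section
variable {Ω : Type}

lemma joint_meas {m : MeasurableSpace Ω} {Y : ℝ → Ω → ℝ} (hY : ∀ u, Measurable (Y u)) (hc : ∀ ω, Continuous fun u => Y u ω) :
    Measurable (Function.uncurry fun (u : ℝ) ω => Y u ω) :=
  measurable_uncurry_of_continuous_of_measurable hc hY

lemma int_meas {m : MeasurableSpace Ω} {Y : ℝ → Ω → ℝ} (hY : ∀ u, Measurable (Y u)) (hc : ∀ ω, Continuous fun u => Y u ω)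
    {h : ℝ → ℝ} (hh : Measurable h) (t : ℝ) : Measurable fun ω => ∫ u in (0:ℝ)..t, h (Y u ω) := by
  have : StronglyMeasurable (Function.uncurry fun ω (u:ℝ) => h (Y u ω)) :=
    ((hh.comp (joint_meas hY hc)).comp measurable_swap).stronglyMeasurable
  exact (this.integral_prod_right (ν := volume.restrict (Ioc 0 t))).measurable.sub
    (this.integral_prod_right (ν := volume.restrict (Ioc t 0))).measurable

lemma fub {m : MeasurableSpace Ω} {P : Measure Ω} [IsProbabilityMeasure P] {H : ℝ → Ω → ℝ}
    (hH : Measurable (Function.uncurry H)) {C t : ℝ} (ht : 0 ≤ t) (hC : ∀ u ∈ Ioc 0 t, ∀ ω, |H u ω| ≤ C) :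
    Integrable (Function.uncurry H) ((volume.restrict (Ioc 0 t)).prod P) ∧
    IntervalIntegrable (fun u => ∫ ω, H u ω ∂P) volume 0 t ∧
    Integrable (fun ω => ∫ u in (0:ℝ)..t, H u ω) P ∧
    ∫ ω, (∫ u in (0:ℝ)..t, H u ω) ∂P = ∫ u in (0:ℝ)..t, ∫ ω, H u ω ∂P := by
  have hi : Integrable (Function.uncurry H) ((volume.restrict (Ioc 0 t)).prod P) := by
    refine Integrable.of_bound hH.aestronglyMeasurable C ?_
    have : ∀ᵐ z ∂((volume.restrict (Ioc 0 t)).prod P), z.1 ∈ Ioc 0 t :=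
      Measure.quasiMeasurePreserving_fst.ae (ae_restrict_mem measurableSet_Ioc)
    filter_upwards [this] with z hz using hC _ hz _
  refine ⟨hi, ?_, ?_, ?_⟩
  · rw [intervalIntegrable_iff_integrableOn_Ioc_of_le ht]
    exact hi.integral_prod_left
  · simp only [intervalIntegral.integral_of_le ht]
    exact hi.integral_prod_right
  · simp only [intervalIntegral.integral_of_le ht]
    exact (integral_integral_swap hi).symm
end
end WFA
end

section
namespace WFA
variable {s σ : ℝ} {r : ℝ → ℝ} {μ₀ : Measure ℝ}

def hh (r : ℝ → ℝ) : ℝ → ℝ := indicator (Icc 0 1) (fun x => -r x)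

structure RH (r : ℝ → ℝ) (M : ℝ) : Prop where
  m : Measurable r
  b : ∀ x ∈ Icc (0:ℝ) 1, 0 ≤ -r x ∧ -r x ≤ M

lemma RH.hm {M : ℝ} (H : RH r M) : Measurable (hh r) := H.m.neg.indicator measurableSet_Icc
lemma RH.M0 {M : ℝ} (H : RH r M) : 0 ≤ M := (H.b 0 (by simp)).1.trans (H.b 0 (by simp)).2
lemma RH.h0 {M : ℝ} (H : RH r M) (x : ℝ) : 0 ≤ hh r x := indicator_nonneg (fun x hx => (H.b x hx).1) x
lemma RH.hM {M : ℝ} (H : RH r M) (x : ℝ) : hh r x ≤ M := by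
  unfold hh; rw [indicator_apply]; split_ifs with hx
  · exact (H.b x hx).2
  · exact H.M0

def ZZ (W : WFKilled s σ r μ₀) (t : ℝ) (ω : W.Ω) : ℝ := Real.exp (-∫ u in (0:ℝ)..t, hh r (W.X u ω))

variable {M : ℝ} (W : WFKilled s σ r μ₀)

lemma int_meas_F {q : ℝ → ℝ} (hq : Measurable q) {t : ℝ} (ht : 0 ≤ t) (m : MeasurableSpace W.Ω)
    (hX : ∀ u ≤ t, Measurable[m] (W.X u)) :
    Measurable[m] fun ω => ∫ u in (0:ℝ)..t, q (W.X u ω) := by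
  have := @int_meas _ m (fun u ω => W.X (min u t) ω) (fun u => hX _ (min_le_right _ _))
    (fun ω => (W.contX ω).comp (continuous_id.min continuous_const)) q hq t
  convert this using 2 with ω
  refine intervalIntegral.integral_congr fun u hu => ?_
  rw [uIcc_of_le ht] at hu
  simp [min_eq_left hu.2]

lemma XF {u t : ℝ} (hut : u ≤ t) : Measurable[W.ℱ t] (W.X u) := (W.adaptedX u).mono (W.ℱ.mono hut) le_rfl

lemma ZZ_measF (H : RH r M) {t : ℝ} (ht : 0 ≤ t) : Measurable[W.ℱ t] (ZZ W t) :=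
  Real.measurable_exp.comp (int_meas_F W H.hm ht _ fun _ hu => XF W hu).neg

lemma RH.ii (H : RH r M) (ω : W.Ω) (a b : ℝ) : IntervalIntegrable (fun u => hh r (W.X u ω)) volume a b :=
  (intervalIntegrable_const (c := M)).mono_fun (H.hm.comp (W.contX ω).measurable).aestronglyMeasurable
    (Eventually.of_forall fun u => by
      show ‖hh r (W.X u ω)‖ ≤ ‖M‖
      rw [Real.norm_of_nonneg H.M0, Real.norm_of_nonneg (H.h0 _)]; exact H.hM _)

lemma ZZ_cont (H : RH r M) (ω : W.Ω) : Continuous fun t => ZZ W t ω :=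
  Real.continuous_exp.comp (intervalIntegral.continuous_primitive (H.ii W ω) 0).neg

lemma ZZ_meas (H : RH r M) (t : ℝ) : Measurable (ZZ W t) :=
  Real.measurable_exp.comp (int_meas W.measX W.contX H.hm t).neg

lemma ZZ_joint (H : RH r M) : Measurable (Function.uncurry (ZZ W)) := joint_meas (ZZ_meas W H) (ZZ_cont W H)
lemma X_joint : Measurable (Function.uncurry W.X) := joint_meas W.measX W.contX

lemma ZZ_pos (t : ℝ) (ω : W.Ω) : 0 < ZZ W t ω := Real.exp_pos _
lemma ZZ_le (H : RH r M) {t : ℝ} (ht : 0 ≤ t) (ω : W.Ω) : ZZ W t ω ≤ 1 :=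
  Real.exp_le_one_iff.2 (neg_nonpos.2 (intervalIntegral.integral_nonneg_of_forall ht fun _ => H.h0 _))

lemma LWF_cont (s σ : ℝ) {f : ℝ → ℝ} (hf : ContDiff ℝ 2 f) : Continuous (LWF s σ f) := by
  have h1 : Continuous (deriv f) := hf.continuous_deriv (by norm_num)
  have h2 : Continuous (deriv (deriv f)) := by
    have : ContDiff ℝ 1 (deriv f) := by
      have : ContDiff ℝ (1+1) f := by simpa [one_add_one_eq_two] using hf
      exact (contDiff_succ_iff_deriv.1 this).2.2
    exact this.continuous_deriv le_rfl
  unfold LWF; fun_prop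

lemma bdd_Icc {q : ℝ → ℝ} (hq : Continuous q) : ∃ C, 0 ≤ C ∧ ∀ x ∈ Icc (0:ℝ) 1, |q x| ≤ C := by
  obtain ⟨C, hC⟩ := isCompact_Icc.exists_bound_of_continuousOn (hq.continuousOn (s := Icc (0:ℝ) 1))
  exact ⟨C, (abs_nonneg _).trans (hC 0 (by simp)), hC⟩

lemma mart_mul {f : ℝ → ℝ} (hf : ContDiff ℝ 2 f) {u t : ℝ} (hut : u ≤ t) {G : W.Ω → ℝ} (hG : Measurable[W.ℱ u] G)
    {C : ℝ} (hC : ∀ ω, |G ω| ≤ C) :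
    ∫ ω, G ω * (f (W.X t ω) - ∫ u in Ioc (0:ℝ) t, LWF s σ f (W.X u ω)) ∂W.P =
    ∫ ω, G ω * (f (W.X u ω) - ∫ u in Ioc (0:ℝ) u, LWF s σ f (W.X u ω)) ∂W.P := by
  have hm := W.martProblem f hf
  have h1 := condExp_stronglyMeasurable_mul_of_bound (W.ℱ.le u) hG.stronglyMeasurable (hm.integrable t) C
    (Eventually.of_forall hC)
  have h2 := integral_congr_ae (h1.trans (EventuallyEq.rfl.mul (hm.2 u t hut)))
  rw [integral_condExp (W.ℱ.le u)] at h2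
  exact h2

lemma fwd (H : RH r M) {f : ℝ → ℝ} (hf : ContDiff ℝ 2 f) {t : ℝ} (ht : 0 ≤ t) :
    ∫ ω, ZZ W t ω * f (W.X t ω) ∂W.P = ∫ ω, f (W.X 0 ω) ∂W.P +
      ∫ u in (0:ℝ)..t, ∫ ω, ZZ W u ω * (LWF s σ f (W.X u ω) - hh r (W.X u ω) * f (W.X u ω)) ∂W.P := by
  set q := LWF s σ f with hq
  have hqc : Continuous q := LWF_cont s σ hf
  obtain ⟨Cf, hCf0, hCf⟩ := bdd_Icc hf.continuous
  obtain ⟨Cq, hCq0, hCq⟩ := bdd_Icc hqc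
  set Φ : ℝ → W.Ω → ℝ := fun t ω => ∫ u in (0:ℝ)..t, q (W.X u ω) with hΦ
  set G : ℝ → W.Ω → ℝ := fun u ω => hh r (W.X u ω) * ZZ W u ω with hGd
  have hqX : ∀ ω, Continuous fun u => q (W.X u ω) := fun ω => hqc.comp (W.contX ω)
  have jΦ : Measurable (Function.uncurry Φ) := joint_meas (fun t => int_meas W.measX W.contX hqc.measurable t)
    (fun ω => intervalIntegral.continuous_primitive (fun a b => (hqX ω).intervalIntegrable a b) 0)
  have jX := X_joint W
  have jZ := ZZ_joint W H
  have jh : Measurable (Function.uncurry fun u ω => hh r (W.X u ω)) := H.hm.comp jX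
  have jf : Measurable (Function.uncurry fun u ω => f (W.X u ω)) := hf.continuous.measurable.comp jX
  have jq : Measurable (Function.uncurry fun u ω => q (W.X u ω)) := hqc.measurable.comp jX
  have jG : Measurable (Function.uncurry G) := jh.mul jZ
  have bf : ∀ u ω, |f (W.X u ω)| ≤ Cf := fun u ω => hCf _ (W.range01 u ω)
  have bq : ∀ u ω, |q (W.X u ω)| ≤ Cq := fun u ω => hCq _ (W.range01 u ω)
  have bG : ∀ u, 0 ≤ u → ∀ ω, |G u ω| ≤ M := fun u hu ω => by
    rw [hGd, abs_of_nonneg (mul_nonneg (H.h0 _) (ZZ_pos W _ _).le)]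
    exact (mul_le_of_le_one_right (H.h0 _) (ZZ_le W H hu ω)).trans (H.hM _)
  have bZ : ∀ u, 0 ≤ u → ∀ ω, |ZZ W u ω| ≤ 1 := fun u hu ω => by
    rw [abs_of_pos (ZZ_pos W _ _)]; exact ZZ_le W H hu ω
  have bΦ : ∀ u ∈ Icc 0 t, ∀ ω, |Φ u ω| ≤ Cq * t := fun u hu ω => by
    have := intervalIntegral.norm_integral_le_of_norm_le_const (a := 0) (b := u) (f := fun u => q (W.X u ω)) (C := Cq)
      (fun x _ => bq x ω)
    rw [sub_zero, abs_of_nonneg hu.1] at this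
    exact this.trans (mul_le_mul_of_nonneg_left hu.2 hCq0)
  have bI : ∀ {q : W.Ω → ℝ} (C : ℝ), Measurable q → (∀ ω, |q ω| ≤ C) → Integrable q W.P :=
    fun C hq hC => Integrable.of_bound hq.aestronglyMeasurable C (Eventually.of_forall hC)
  set N : ℝ → W.Ω → ℝ := fun t ω => f (W.X t ω) - Φ t ω with hN
  have jN : Measurable (Function.uncurry N) := jf.sub jΦ
  have bN : ∀ u ∈ Icc 0 t, ∀ ω, |N u ω| ≤ Cf + Cq * t := fun u hu ω =>
    (abs_sub _ _).trans (add_le_add (bf _ _) (bΦ u hu ω))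
  have hMM : ∀ u, 0 ≤ u → ∀ G : W.Ω → ℝ, ∀ ω, G ω * (f (W.X u ω) - ∫ u in Ioc (0:ℝ) u, LWF s σ f (W.X u ω)) = G ω * N u ω := by
    intro u hu G ω; simp only [hN, hΦ, intervalIntegral.integral_of_le hu, hq]
  have htt : t ∈ Icc 0 t := ⟨ht, le_rfl⟩
  have hC0 : 0 ≤ Cf + Cq * t := by positivity
  have sec : ∀ {K : ℝ → W.Ω → ℝ}, Measurable (Function.uncurry K) → ∀ u, Measurable (K u) :=
    fun hK u => hK.comp (measurable_const.prodMk measurable_id)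
  -- step 1
  have s1 : ∀ u ∈ Icc 0 t, ∫ ω, G u ω * N t ω ∂W.P = ∫ ω, G u ω * N u ω ∂W.P := by
    intro u hu
    have := mart_mul W hf hu.2 (G := G u) ((H.hm.comp (XF W le_rfl)).mul (ZZ_measF W H hu.1)) (bG u hu.1)
    simpa only [hMM _ ht, hMM _ hu.1] using this
  have s0 : ∫ ω, N t ω ∂W.P = ∫ ω, f (W.X 0 ω) ∂W.P := by
    have := mart_mul W hf ht (G := fun _ => 1) measurable_const (C := 1) (by simp)
    rw [integral_congr_ae (Eventually.of_forall (hMM _ ht fun _ => 1)), integral_congr_ae (Eventually.of_forall (hMM 0 le_rfl fun _ => 1))] at this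
    simpa [hN, hΦ] using this
  have j1 : Measurable (Function.uncurry fun u ω => G u ω * N t ω) := jG.mul ((sec jN t).comp measurable_snd)
  have b1 : ∀ u ∈ Ioc 0 t, ∀ ω, |G u ω * N t ω| ≤ M * (Cf + Cq * t) := fun u hu ω => by
    rw [abs_mul]; exact mul_le_mul (bG u hu.1.le ω) (bN t htt ω) (abs_nonneg _) H.M0
  have j2 : Measurable (Function.uncurry fun u ω => G u ω * N u ω) := jG.mul jN
  have b2 : ∀ u ∈ Ioc 0 t, ∀ ω, |G u ω * N u ω| ≤ M * (Cf + Cq * t) := fun u hu ω => by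
    rw [abs_mul]; exact mul_le_mul (bG u hu.1.le ω) (bN u ⟨hu.1.le, hu.2⟩ ω) (abs_nonneg _) H.M0
  have j3 : Measurable (Function.uncurry fun u ω => ZZ W u ω * q (W.X u ω) - G u ω * Φ u ω) := (jZ.mul jq).sub (jG.mul jΦ)
  have b3 : ∀ u ∈ Ioc 0 t, ∀ ω, |ZZ W u ω * q (W.X u ω) - G u ω * Φ u ω| ≤ 1 * Cq + M * (Cq * t) := fun u hu ω => by
    refine (abs_sub _ _).trans ?_
    rw [abs_mul, abs_mul]
    exact add_le_add (mul_le_mul (bZ u hu.1.le ω) (bq u ω) (abs_nonneg _) zero_le_one)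
      (mul_le_mul (bG u hu.1.le ω) (bΦ u ⟨hu.1.le, hu.2⟩ ω) (abs_nonneg _) H.M0)
  have F1 := fub (P := W.P) j1 ht b1
  have F2 := fub (P := W.P) j2 ht b2
  have F3 := fub (P := W.P) j3 ht b3
  have iN : Integrable (N t) W.P := bI _ (sec jN t) (bN t htt)
  have e1 : ∀ ω, ZZ W t ω * f (W.X t ω) = N t ω - (∫ u in (0:ℝ)..t, G u ω * N t ω) +
      ∫ u in (0:ℝ)..t, (ZZ W u ω * q (W.X u ω) - G u ω * Φ u ω) := by
    intro ω
    have a1 := exp_ode (H.hm.comp (W.contX ω).measurable) (fun u => H.h0 _) (fun u => H.hM _) ht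
    have a2 := exp_prod (H.hm.comp (W.contX ω).measurable) (fun u => H.h0 _) (fun u => H.hM _) (hqX ω) ht
    have a3 : ZZ W t ω = 1 - ∫ u in (0:ℝ)..t, G u ω := a1
    have a4 : ZZ W t ω * Φ t ω = ∫ u in (0:ℝ)..t, (ZZ W u ω * q (W.X u ω) - G u ω * Φ u ω) := a2
    rw [← a4, intervalIntegral.integral_mul_const]
    have : f (W.X t ω) = N t ω + Φ t ω := by simp [hN]
    rw [this, a3]; ring
  simp_rw [e1]
  have iNF : Integrable (fun ω => N t ω - ∫ u in (0:ℝ)..t, G u ω * N t ω) W.P := iN.sub F1.2.2.1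
  rw [integral_add iNF F3.2.2.1, integral_sub iN F1.2.2.1, F1.2.2.2, F3.2.2.2, s0,
    intervalIntegral.integral_congr (g := fun u => ∫ ω, G u ω * N u ω ∂W.P) (fun u hu => s1 u (by rwa [uIcc_of_le ht] at hu)),
    sub_add, sub_eq_add_neg, ← intervalIntegral.integral_sub F2.2.1 F3.2.1, ← intervalIntegral.integral_neg]
  congr 1
  refine intervalIntegral.integral_congr_ae (Eventually.of_forall fun u hu => ?_)
  rw [uIoc_of_le ht] at hu
  rw [← integral_sub (bI _ (sec j2 u) (b2 u hu)) (bI _ (sec j3 u) (b3 u hu)), ← integral_neg]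
  refine integral_congr_ae (Eventually.of_forall fun ω => ?_)
  simp only [hN, hGd]; ring
end WFA
end

section
namespace WFA
variable {s σ : ℝ} {r : ℝ → ℝ} {μ₀ : Measure ℝ} {M : ℝ} (W : WFKilled s σ r μ₀)

lemma fX_int {q : ℝ → ℝ} (hq : Continuous q) (t : ℝ) : Integrable (fun ω => q (W.X t ω)) W.P := by
  obtain ⟨C, -, hC⟩ := bdd_Icc hq
  exact Integrable.of_bound (hq.measurable.comp (W.measX t)).aestronglyMeasurable C
    (Eventually.of_forall fun ω => hC _ (W.range01 t ω))

lemma sup_ineq {f : ℝ → ℝ} (hf : ContDiff ℝ 2 f) (hL : ∀ x ∈ Icc (0:ℝ) 1, LWF s σ f x ≤ 0) {u t : ℝ} (hu : 0 ≤ u) (hut : u ≤ t)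
    {B : Set W.Ω} (hB : MeasurableSet[W.ℱ u] B) : ∫ ω in B, f (W.X t ω) ∂W.P ≤ ∫ ω in B, f (W.X u ω) ∂W.P := by
  have hB' : MeasurableSet B := W.ℱ.le u _ hB
  have h1 := mart_mul W hf hut (G := B.indicator fun _ => 1) (measurable_const.indicator hB) (C := 1)
    (fun ω => by by_cases h : ω ∈ B <;> simp [h])
  have e : ∀ g : W.Ω → ℝ, ∫ ω, B.indicator (fun _ => (1:ℝ)) ω * g ω ∂W.P = ∫ ω in B, g ω ∂W.P := fun g => by
    rw [← integral_indicator hB']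
    exact integral_congr_ae (Eventually.of_forall fun ω => by by_cases h : ω ∈ B <;> simp [h])
  rw [e, e] at h1
  have hc : ∀ ω, Continuous fun u => LWF s σ f (W.X u ω) := fun ω => (LWF_cont s σ hf).comp (W.contX ω)
  have i1 : ∀ t, Integrable (fun ω => f (W.X t ω) - ∫ u in Ioc (0:ℝ) t, LWF s σ f (W.X u ω)) (W.P.restrict B) :=
    fun t => ((W.martProblem f hf).integrable t).restrict
  have i2 : ∀ t, Integrable (fun ω => f (W.X t ω)) (W.P.restrict B) := fun t => (fX_int W hf.continuous t).restrict
  have h2 : ∫ ω in B, ((f (W.X t ω) - ∫ u in Ioc (0:ℝ) t, LWF s σ f (W.X u ω)) - f (W.X t ω)) ∂W.P ≥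
      ∫ ω in B, ((f (W.X u ω) - ∫ u in Ioc (0:ℝ) u, LWF s σ f (W.X u ω)) - f (W.X u ω)) ∂W.P := by
    refine integral_mono ((i1 u).sub (i2 u)) ((i1 t).sub (i2 t)) fun ω => ?_
    have h3 : ∫ w in Ioc (0:ℝ) t, LWF s σ f (W.X w ω) ≤ ∫ w in Ioc (0:ℝ) u, LWF s σ f (W.X w ω) := by
      rw [← intervalIntegral.integral_of_le hu, ← intervalIntegral.integral_of_le (hu.trans hut),
        ← intervalIntegral.integral_add_adjacent_intervals ((hc ω).intervalIntegrable 0 u) ((hc ω).intervalIntegrable u t)]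
      have : 0 ≤ ∫ w in u..t, -LWF s σ f (W.X w ω) :=
        intervalIntegral.integral_nonneg_of_forall hut fun w => neg_nonneg.2 (hL _ (W.range01 w ω))
      rw [intervalIntegral.integral_neg] at this
      linarith
    simp only
    linarith
  rw [integral_sub (i1 u) (i2 u), integral_sub (i1 t) (i2 t)] at h2
  linarith

lemma grid_ineq {f : ℝ → ℝ} (hf : ContDiff ℝ 2 f) (hL : ∀ x ∈ Icc (0:ℝ) 1, LWF s σ f x ≤ 0) {t : ℝ}
    {u : ℕ → ℝ} (hu0 : ∀ i, 0 ≤ u i) (hum : Monotone u) {e : ℝ} (n : ℕ) (hut : ∀ i < n, u i ≤ t) :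
    ∫ ω in {ω | ∃ i < n, f (W.X (u i) ω) < e}, f (W.X t ω) ∂W.P ≤ e * W.P.real {ω | ∃ i < n, f (W.X (u i) ω) < e} := by
  induction n with
  | zero => simp
  | succ n ih =>
    have hmF : ∀ k, k ≤ n → MeasurableSet[W.ℱ (u n)] {ω | f (W.X (u k) ω) < e} := fun k hk =>
      (hf.continuous.measurable.comp (XF W (hum hk))) measurableSet_Iio
    set A := {ω | ∃ i < n, f (W.X (u i) ω) < e} with hA
    have hAF : MeasurableSet[W.ℱ (u n)] A := by
      have : A = ⋃ i ∈ Finset.range n, {ω | f (W.X (u i) ω) < e} := by ext; simp [hA]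
      rw [this]
      exact Finset.measurableSet_biUnion _ fun i hi => hmF i (Finset.mem_range.1 hi).le
    set B := {ω | f (W.X (u n) ω) < e} \ A with hB
    have hBF : MeasurableSet[W.ℱ (u n)] B := (hmF n le_rfl).diff hAF
    have hBm : MeasurableSet B := W.ℱ.le _ _ hBF
    have hU : {ω | ∃ i < n + 1, f (W.X (u i) ω) < e} = A ∪ B := by
      ext ω
      simp only [hA, hB, mem_setOf_eq, mem_union, mem_diff, Nat.lt_succ_iff_lt_or_eq]
      constructor
      · rintro ⟨i, hi | rfl, h⟩
        · exact Or.inl ⟨i, hi, h⟩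
        · by_cases h' : ∃ i_1 < i, f (W.X (u i_1) ω) < e
          · exact Or.inl h'
          · exact Or.inr ⟨h, h'⟩
      · rintro (⟨i, hi, h⟩ | ⟨h, -⟩)
        · exact ⟨i, Or.inl hi, h⟩
        · exact ⟨n, Or.inr rfl, h⟩
    have hd : Disjoint A B := disjoint_sdiff_right
    have hi := fun t => fX_int W hf.continuous t
    rw [hU, setIntegral_union hd hBm (hi t).integrableOn (hi t).integrableOn, measureReal_union hd hBm, mul_add]
    refine add_le_add (ih fun i hi => hut i (hi.trans (Nat.lt_succ_self n))) ?_
    refine (sup_ineq W hf hL (hu0 n) (hut n (Nat.lt_succ_self n)) hBF).trans ?_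
    calc _ ≤ ∫ ω in B, e ∂W.P := setIntegral_mono_on (hi _).integrableOn (integrable_const _) hBm fun ω hω => hω.1.le
      _ = _ := by simp [mul_comm]

lemma absorb {f : ℝ → ℝ} (hf : ContDiff ℝ 2 f) (hf0 : ∀ x ∈ Icc (0:ℝ) 1, 0 ≤ f x)
    (hL : ∀ x ∈ Icc (0:ℝ) 1, LWF s σ f x ≤ 0) {t : ℝ} (ht : 0 ≤ t) :
    ∀ᵐ ω ∂W.P, (∃ u ∈ Icc 0 t, f (W.X u ω) = 0) → f (W.X t ω) = 0 := by
  have hi := fX_int W hf.continuous t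
  have h0 : ∀ ω, 0 ≤ f (W.X t ω) := fun ω => hf0 _ (W.range01 t ω)
  set A : ℝ → ℕ → Set W.Ω := fun e N => {ω | ∃ i < N + 1, f (W.X (t * (i / N : ℝ)) ω) < e} with hA
  have hAm : ∀ e N, MeasurableSet (A e N) := fun e N => by
    have : A e N = ⋃ i ∈ Finset.range (N + 1), {ω | f (W.X (t * (i / N : ℝ)) ω) < e} := by ext; simp [hA]
    rw [this]
    exact Finset.measurableSet_biUnion _ fun i hi => (hf.continuous.measurable.comp (W.measX _)) measurableSet_Iio
  have hAi : ∀ e > 0, ∀ N, ∫ ω in A e N, f (W.X t ω) ∂W.P ≤ e := fun e he N => by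
    refine (grid_ineq W hf hL (u := fun i => t * (i / N : ℝ)) (fun i => by positivity) (fun i j hij => by
      simp only; gcongr) (N + 1) (fun i hi => ?_)).trans (mul_le_of_le_one_right he.le measureReal_le_one)
    refine mul_le_of_le_one_right ht (div_le_one_of_le₀ ?_ (by positivity))
    exact_mod_cast Nat.lt_succ_iff.1 hi
  set Bk : ℝ → ℕ → Set W.Ω := fun e k => ⋂ N, A e (k + N) with hBk
  have hBm : ∀ e k, MeasurableSet (Bk e k) := fun e k => MeasurableSet.iInter fun N => hAm _ _
  have hBmono : ∀ e, Monotone (Bk e) := fun e k l hkl ω hω => mem_iInter.2 fun N => by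
    have := mem_iInter.1 hω (l - k + N)
    rwa [show k + (l - k + N) = l + N by omega] at this
  have hBi : ∀ e > 0, ∫ ω in ⋃ k, Bk e k, f (W.X t ω) ∂W.P ≤ e := fun e he => by
    refine le_of_tendsto (tendsto_setIntegral_of_monotone (hBm e) (hBmono e) hi.integrableOn) (Eventually.of_forall fun k => ?_)
    refine le_trans ?_ (hAi e he k)
    exact setIntegral_mono_set hi.integrableOn (Eventually.of_forall h0)
      (HasSubset.Subset.eventuallyLE fun ω hω => by simpa using mem_iInter.1 hω 0)
  set Q := ⋂ m : ℕ, ⋃ k, Bk (1 / ((m:ℝ) + 1)) k with hQ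
  have hQm : MeasurableSet Q := MeasurableSet.iInter fun m => MeasurableSet.iUnion fun k => hBm _ _
  have hQi : ∫ ω in Q, f (W.X t ω) ∂W.P ≤ 0 := by
    refine ge_of_tendsto' tendsto_one_div_add_atTop_nhds_zero_nat fun m => ?_
    refine le_trans ?_ (hBi (1 / ((m:ℝ) + 1)) (by positivity))
    exact setIntegral_mono_set hi.integrableOn (Eventually.of_forall h0)
      (HasSubset.Subset.eventuallyLE fun ω hω => mem_iInter.1 hω m)
  have hz : ∀ᵐ ω ∂W.P.restrict Q, f (W.X t ω) = 0 :=
    (integral_eq_zero_iff_of_nonneg h0 hi.restrict).1 (le_antisymm hQi (integral_nonneg h0))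
  rw [ae_restrict_iff' hQm] at hz
  filter_upwards [hz] with ω hω ⟨u, hu, hfu⟩
  refine hω (mem_iInter.2 fun m => ?_)
  set e : ℝ := 1 / ((m:ℝ) + 1) with he
  have hep : 0 < e := by positivity
  -- continuity at u
  have hc : ContinuousAt (fun w => f (W.X w ω)) u := (hf.continuous.comp (W.contX ω)).continuousAt
  have hev : ∀ᶠ w in 𝓝 u, f (W.X w ω) < e := hc.eventually_lt continuousAt_const (by rw [hfu]; exact hep)
  obtain ⟨d, hd, hball⟩ := Metric.eventually_nhds_iff.1 hev
  obtain ⟨k, hk⟩ := exists_nat_gt (t / d)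
  refine mem_iUnion.2 ⟨k + 1, mem_iInter.2 fun N => ?_⟩
  rcases ht.eq_or_lt with ht0 | htp
  · refine ⟨0, by omega, hball ?_⟩
    have : u = 0 := le_antisymm (ht0 ▸ hu.2) hu.1
    simp [this, hd]
  set n := k + 1 + N with hn
  have hnp : (0:ℝ) < n := by rw [hn]; positivity
  have hkn : (k:ℝ) ≤ n := by rw [hn]; push_cast; linarith [(Nat.cast_nonneg N : (0:ℝ) ≤ N)]
  have hun : u * n / t ≤ n := by rw [div_le_iff₀ htp]; nlinarith [hu.2]
  refine ⟨⌊u * n / t⌋₊, Nat.lt_succ_of_le (Nat.floor_le_of_le hun), hball ?_⟩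
  have f1 := Nat.floor_le (show 0 ≤ u * n / t from div_nonneg (mul_nonneg hu.1 hnp.le) ht)
  have f2 := Nat.lt_floor_add_one (u * n / t)
  have htd : t / n < d := by
    rw [div_lt_iff₀ hnp]; rw [div_lt_iff₀ hd] at hk; nlinarith
  have g1 : u = t * ((u * n / t) / n) := by field_simp
  have g2 : u - t * ((⌊u * n / t⌋₊ : ℝ) / n) = (u * n / t - ⌊u * n / t⌋₊) * (t / n) := by
    field_simp
  have htn : 0 < t / n := div_pos htp hnp
  rw [dist_comm, Real.dist_eq, g2, abs_of_nonneg (mul_nonneg (by linarith) htn.le)]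
  nlinarith

lemma absorb01 (hs : 0 ≤ s) (hσ : 0 < σ) {t : ℝ} (ht : 0 ≤ t) :
    ∀ᵐ ω ∂W.P, W.X t ω ∈ Ioo (0:ℝ) 1 → ω ∈ W.noHit0 t ∩ W.noHit1 t := by
  have h1 := absorb W (f := fun x => x) contDiff_id (fun x hx => hx.1) (fun x hx => by
    have : deriv (fun x : ℝ => x) = fun _ => 1 := by ext; simp
    simp only [LWF, this, deriv_const]
    nlinarith [mul_nonneg hs (mul_nonneg hx.1 (sub_nonneg.2 hx.2))]) ht
  set θ := 2 * s / σ ^ 2 + 1 with hθ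
  have hθp : 0 < θ := by positivity
  have h2 := absorb W (f := fun x => Real.exp θ - Real.exp (θ * x)) (by fun_prop) (fun x hx => by
      refine sub_nonneg.2 (Real.exp_le_exp.2 (mul_le_of_le_one_right hθp.le hx.2))) (fun x hx => by
    have d0 : ∀ x, HasDerivAt (fun x => Real.exp (θ * x)) (θ * Real.exp (θ * x)) x := fun x => by
      have := ((hasDerivAt_id x).const_mul θ).exp
      simpa [mul_comm] using this
    have d1 : deriv (fun x => Real.exp θ - Real.exp (θ * x)) = fun x => -(θ * Real.exp (θ * x)) := by
      ext x; exact ((d0 x).const_sub _).deriv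
    have d2 : deriv (fun x => -(θ * Real.exp (θ * x))) x = -(θ * (θ * Real.exp (θ * x))) :=
      ((d0 x).const_mul θ).fun_neg.deriv
    simp only [LWF, d1, d2]
    have e1 : σ ^ 2 / 2 * θ = s + σ ^ 2 / 2 := by rw [hθ]; field_simp
    have : -s * x * (1 - x) * -(θ * Real.exp (θ * x)) + σ ^ 2 / 2 * (x * (1 - x)) * -(θ * (θ * Real.exp (θ * x))) =
        (x * (1 - x)) * (θ * Real.exp (θ * x)) * (s - σ ^ 2 / 2 * θ) := by ring
    rw [this, e1]
    have := mul_nonneg (mul_nonneg hx.1 (sub_nonneg.2 hx.2)) (mul_pos hθp (Real.exp_pos (θ * x))).le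
    nlinarith [sq_nonneg σ]) ht
  filter_upwards [h1, h2] with ω a1 a2 hω
  refine ⟨fun u hu h => hω.1.ne' (a1 ⟨u, hu, h⟩), fun u hu h => hω.2.ne ?_⟩
  have := a2 ⟨u, hu, by simp [h]⟩
  have := Real.exp_injective (sub_eq_zero.1 this)
  nlinarith

lemma alive_ae (hs : 0 ≤ s) (hσ : 0 < σ) {t : ℝ} (ht : 0 ≤ t) :
    W.aliveAll t =ᵐ[W.P] (W.aliveSoft t ∩ {ω | W.X t ω ∈ Ioo (0:ℝ) 1} : Set W.Ω) := by
  filter_upwards [absorb01 W hs hσ ht] with ω h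
  refine propext ⟨fun ⟨⟨h1, h2⟩, h3⟩ => ⟨h1, ?_⟩, fun ⟨h1, h2⟩ => ⟨⟨h1, (h h2).1⟩, (h h2).2⟩⟩
  have hr := W.range01 t ω
  exact ⟨lt_of_le_of_ne hr.1 (h2 t ⟨ht, le_rfl⟩).symm, lt_of_le_of_ne hr.2 (h3 t ⟨ht, le_rfl⟩)⟩
end WFA
end

section
namespace WFA
variable {s σ : ℝ} {r : ℝ → ℝ} {μ₀ : Measure ℝ} {M : ℝ} (W : WFKilled s σ r μ₀)

lemma indep_int (H : RH r M) {t : ℝ} (ht : 0 ≤ t) {g : ℝ → ℝ} (hg : Measurable g) {C : ℝ} (hC : ∀ x, |g x| ≤ C) :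
    ∫ ω in W.aliveSoft t, g (W.X t ω) ∂W.P = ∫ ω, ZZ W t ω * g (W.X t ω) ∂W.P := by
  set A : W.Ω → ℝ := fun ω => ∫ u in (0:ℝ)..t, hh r (W.X u ω) with hA
  have hAm : Measurable A := int_meas W.measX W.contX H.hm t
  have hA0 : ∀ ω, 0 ≤ A ω := fun ω => intervalIntegral.integral_nonneg_of_forall ht fun _ => H.h0 _
  have hS : W.aliveSoft t = {ω | A ω < W.Tkill ω} := by
    ext ω
    show (∫ u in Ioc (0:ℝ) t, (-(r (W.X u ω))) < W.Tkill ω) ↔ A ω < W.Tkill ω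
    rw [hA]; simp only [intervalIntegral.integral_of_le ht]
    have : ∀ u, hh r (W.X u ω) = -(r (W.X u ω)) := fun u => indicator_of_mem (W.range01 u ω) _
    simp_rw [this]
  have hSm : MeasurableSet {ω | A ω < W.Tkill ω} := measurableSet_lt hAm W.measT
  set Y : W.Ω → ℝ × ℝ := fun ω => (W.X t ω, A ω) with hY
  have hYm : Measurable Y := (W.measX t).prodMk hAm
  have hind : IndepFun Y W.Tkill W.P := by
    refine indep_of_indep_of_le_left W.indepT ?_
    rw [← measurable_iff_comap_le]
    have hX : ∀ u, Measurable[MeasurableSpace.comap (fun ω t => W.X t ω) inferInstance] (W.X u) := fun u =>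
      (measurable_pi_apply u).comp (comap_measurable (fun ω t => W.X t ω))
    exact (hX t).prodMk (int_meas_F W H.hm ht _ fun u _ => hX u)
  have hprod := (indepFun_iff_map_prod_eq_prod_map_map hYm.aemeasurable W.measT.aemeasurable).1 hind
  set F : (ℝ × ℝ) × ℝ → ℝ := fun z => {z : (ℝ × ℝ) × ℝ | z.1.2 < z.2}.indicator (fun z => g z.1.1) z with hF
  have hFm : Measurable F := (hg.comp (measurable_fst.comp measurable_fst)).indicator
    (measurableSet_lt (measurable_snd.comp measurable_fst) measurable_snd)
  have hFb : ∀ z, |F z| ≤ C := fun z => by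
    simp only [hF]
    by_cases h : z ∈ {z : (ℝ × ℝ) × ℝ | z.1.2 < z.2}
    · rw [indicator_of_mem h]; exact hC _
    · rw [indicator_of_notMem h]; simpa using (abs_nonneg _).trans (hC 0)
  have : IsProbabilityMeasure (W.P.map Y) := Measure.isProbabilityMeasure_map hYm.aemeasurable
  have : IsProbabilityMeasure (W.P.map W.Tkill) := Measure.isProbabilityMeasure_map W.measT.aemeasurable
  have e1 : ∫ ω in W.aliveSoft t, g (W.X t ω) ∂W.P = ∫ z, F z ∂(W.P.map fun ω => (Y ω, W.Tkill ω)) := by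
    rw [integral_map (hYm.prodMk W.measT).aemeasurable hFm.aestronglyMeasurable, hS, ← integral_indicator hSm]
    rfl
  rw [e1, hprod, integral_prod _ (Integrable.of_bound hFm.aestronglyMeasurable C (Eventually.of_forall hFb)),
    integral_map hYm.aemeasurable (hFm.stronglyMeasurable.integral_prod_right).aestronglyMeasurable]
  refine integral_congr_ae (Eventually.of_forall fun ω => ?_)
  have e2 : ∀ τ, F (Y ω, τ) = (Ioi (A ω)).indicator (fun _ => g (W.X t ω)) τ := fun τ => rfl
  simp only [e2]
  rw [integral_indicator measurableSet_Ioi, setIntegral_const, measureReal_def,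
    Measure.map_apply W.measT measurableSet_Ioi]
  have := W.expLaw (A ω) (hA0 ω)
  rw [show W.Tkill ⁻¹' Ioi (A ω) = {ω' | A ω < W.Tkill ω'} from rfl, this,
    ENNReal.toReal_ofReal (Real.exp_pos _).le]
  rfl

lemma alive_int (hs : 0 ≤ s) (hσ : 0 < σ) (H : RH r M) {t : ℝ} (ht : 0 ≤ t) {f : ℝ → ℝ} (hf : Measurable f) {C : ℝ}
    (hC : ∀ x ∈ Ioo (0:ℝ) 1, |f x| ≤ C) :
    ∫ ω in W.aliveAll t, f (W.X t ω) ∂W.P = ∫ ω, ZZ W t ω * (Ioo (0:ℝ) 1).indicator f (W.X t ω) ∂W.P := by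
  rw [← indep_int W H ht (hf.indicator measurableSet_Ioo) (C := C) fun x => by
    by_cases h : x ∈ Ioo (0:ℝ) 1
    · rw [indicator_of_mem h]; exact hC x h
    · rw [indicator_of_notMem h]; simpa using (abs_nonneg _).trans (hC (1/2) (by norm_num))]
  rw [setIntegral_congr_set (alive_ae W hs hσ ht)]
  have hm : MeasurableSet {ω | W.X t ω ∈ Ioo (0:ℝ) 1} := W.measX t measurableSet_Ioo
  rw [Set.inter_comm, ← Measure.restrict_restrict hm, ← integral_indicator hm]
  rfl

end WFA
end

section
namespace WFA

def QQ {Y : Type} [MeasurableSpace Y] (m : Measure Y) (w X : Y → ℝ) : Measure ℝ :=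
  ((m.withDensity fun y => ENNReal.ofReal (w y)).map X).restrict (Ioo 0 1)

lemma QQ_null {Y : Type} [MeasurableSpace Y] (m : Measure Y) (w X : Y → ℝ) : QQ m w X (Ioo 0 1)ᶜ = 0 := by
  unfold QQ; rw [Measure.restrict_apply measurableSet_Ioo.compl]; simp

lemma QQ_fin {Y : Type} [MeasurableSpace Y] {m : Measure Y} [IsFiniteMeasure m] {w X : Y → ℝ} {C : ℝ} (hC : ∀ y, w y ≤ C) :
    IsFiniteMeasure (QQ m w X) := by
  have : IsFiniteMeasure (m.withDensity fun y => ENNReal.ofReal (w y)) := by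
    refine isFiniteMeasure_withDensity ((lintegral_mono (g := fun _ => ENNReal.ofReal C)
      fun y => ENNReal.ofReal_le_ofReal (hC y)).trans_lt ?_).ne
    rw [lintegral_const]; exact ENNReal.mul_lt_top ENNReal.ofReal_lt_top (measure_lt_top _ _)
  unfold QQ; infer_instance

lemma QQ_int {Y : Type} [MeasurableSpace Y] {m : Measure Y} {w X : Y → ℝ} (hw : Measurable w) (hw0 : ∀ y, 0 ≤ w y)
    (hX : Measurable X) {f : ℝ → ℝ} (hf : Measurable f) :
    ∫ x, f x ∂(QQ m w X) = ∫ y, w y * (Ioo (0:ℝ) 1).indicator f (X y) ∂m := by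
  unfold QQ
  rw [← integral_indicator measurableSet_Ioo, integral_map hX.aemeasurable (hf.indicator measurableSet_Ioo).aestronglyMeasurable]
  have := integral_withDensity_eq_integral_smul (μ := m) (f := fun y => (w y).toNNReal) hw.real_toNNReal
    (fun y => (Ioo (0:ℝ) 1).indicator f (X y))
  simpa [ENNReal.ofReal, NNReal.smul_def, Real.coe_toNNReal', max_eq_left (hw0 _)] using this

variable {s σ : ℝ} {r : ℝ → ℝ} {μ₀ : Measure ℝ} {M : ℝ} (W : WFKilled s σ r μ₀)

def wt (κ u : ℝ) (ω : W.Ω) : ℝ := ZZ W (max u 0) ω * Real.exp (κ * W.X u ω)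

lemma wt_nonneg (κ u : ℝ) (ω : W.Ω) : 0 ≤ wt W κ u ω := mul_nonneg (ZZ_pos W _ _).le (Real.exp_pos _).le

lemma wt_le (H : RH r M) {κ : ℝ} (hκ : 0 ≤ κ) (u : ℝ) (ω : W.Ω) : wt W κ u ω ≤ Real.exp κ :=
  (mul_le_of_le_one_left (Real.exp_pos _).le (ZZ_le W H (le_max_right _ _) ω)).trans
    (Real.exp_le_exp.2 (mul_le_of_le_one_right hκ (W.range01 u ω).2))

lemma wt_joint (H : RH r M) (κ : ℝ) : Measurable (Function.uncurry (wt W κ)) := by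
  have h1 : Measurable fun z : ℝ × W.Ω => ZZ W (max z.1 0) z.2 :=
    (ZZ_joint W H).comp ((measurable_fst.max measurable_const).prodMk measurable_snd)
  have h2 : Measurable fun z : ℝ × W.Ω => W.X z.1 z.2 := X_joint W
  exact h1.mul (Real.measurable_exp.comp (h2.const_mul κ))

lemma wt_meas (H : RH r M) (κ u : ℝ) : Measurable (wt W κ u) :=
  (wt_joint W H κ).comp (measurable_const.prodMk measurable_id)

def vv (s σ : ℝ) (r : ℝ → ℝ) : ℝ → ℝ := fun x => (s ^ 2 / (2 * σ ^ 2) * (Icc 0 1).indicator aa x + hh r x) / (σ ^ 2 / 2)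

lemma aaI (x : ℝ) : 0 ≤ (Icc (0:ℝ) 1).indicator aa x ∧ (Icc (0:ℝ) 1).indicator aa x ≤ 1 := by
  by_cases h : x ∈ Icc (0:ℝ) 1
  · rw [indicator_of_mem h]; exact ⟨mul_nonneg h.1 (sub_nonneg.2 h.2), aa_le_one x⟩
  · rw [indicator_of_notMem h]; simp

lemma vv_BV (hσ : 0 < σ) (H : RH r M) : BV (vv s σ r) ((s ^ 2 / (2 * σ ^ 2) * 1 + M) / (σ ^ 2 / 2)) where
  meas := (((continuous_aa.measurable.indicator measurableSet_Icc).const_mul _).add H.hm).div_const _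
  nonneg x := by
    have := (aaI x).1; have := H.h0 x
    unfold vv; positivity
  le x := by
    have := (aaI x).2; have := H.hM x
    unfold vv; gcongr

lemma gen_id (hσ : 0 < σ) {ψ : ℝ → ℝ} (hψ : ContDiff ℝ 2 ψ) (h0 : ψ 0 = 0) (h1 : ψ 1 = 0) {x : ℝ} (hx : x ∈ Icc (0:ℝ) 1) :
    LWF s σ (fun x => Real.exp (s / σ ^ 2 * x) * ψ x) x - hh r x * (Real.exp (s / σ ^ 2 * x) * ψ x) =
    σ ^ 2 / 2 * (Real.exp (s / σ ^ 2 * x) * (Ioo (0:ℝ) 1).indicator (fun x => aa x * deriv (deriv ψ) x - vv s σ r x * ψ x) x) := by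
  set κ := s / σ ^ 2 with hκ
  have d0 : ∀ x, HasDerivAt (fun x => Real.exp (κ * x)) (κ * Real.exp (κ * x)) x := fun x => by
    have := ((hasDerivAt_id x).const_mul κ).exp
    simpa [mul_comm] using this
  have hψ2 : ContDiff ℝ 1 (deriv ψ) := by
    have : ContDiff ℝ (1+1) ψ := by simpa [one_add_one_eq_two] using hψ
    exact (contDiff_succ_iff_deriv.1 this).2.2
  have e1 : ∀ x, HasDerivAt ψ (deriv ψ x) x := fun x => (hψ.differentiable (by norm_num) x).hasDerivAt
  have e2 : ∀ x, HasDerivAt (deriv ψ) (deriv (deriv ψ) x) x := fun x => (hψ2.differentiable (by norm_num) x).hasDerivAt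
  have d1 : deriv (fun x => Real.exp (κ * x) * ψ x) = fun x => κ * Real.exp (κ * x) * ψ x + Real.exp (κ * x) * deriv ψ x := by
    ext x; exact ((d0 x).mul (e1 x)).deriv
  have d2 : deriv (fun x => κ * Real.exp (κ * x) * ψ x + Real.exp (κ * x) * deriv ψ x) x =
      κ * (κ * Real.exp (κ * x)) * ψ x + κ * Real.exp (κ * x) * deriv ψ x + (κ * Real.exp (κ * x) * deriv ψ x +
        Real.exp (κ * x) * deriv (deriv ψ) x) :=
    ((((d0 x).const_mul κ).mul (e1 x)).add ((d0 x).mul (e2 x))).deriv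
  simp only [LWF, d1, d2]
  by_cases hI : x ∈ Ioo (0:ℝ) 1
  · rw [indicator_of_mem hI, vv, indicator_of_mem hx, hκ]
    unfold aa
    field_simp
    ring
  · rw [indicator_of_notMem hI]
    have : x = 0 ∨ x = 1 := by
      by_contra hc
      push Not at hc
      exact hI ⟨lt_of_le_of_ne hx.1 hc.1.symm, lt_of_le_of_ne hx.2 hc.2⟩
    rcases this with rfl | rfl <;> simp [h0, h1]

def pf (κ : ℝ) (t : ℝ) : Measure ℝ := QQ W.P (wt W κ t) (W.X t)
def Of (κ : ℝ) (t : ℝ) : Measure ℝ :=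
  QQ ((volume.restrict (Ioc 0 t)).prod W.P) (Function.uncurry (wt W κ)) (Function.uncurry W.X)

lemma pf_int (H : RH r M) (κ : ℝ) {t : ℝ} (ht : 0 ≤ t) {f : ℝ → ℝ} (hf : Measurable f) :
    ∫ x, f x ∂(pf W κ t) = ∫ ω, ZZ W t ω * (Real.exp (κ * W.X t ω) * (Ioo (0:ℝ) 1).indicator f (W.X t ω)) ∂W.P := by
  rw [pf, QQ_int (wt_meas W H κ t) (wt_nonneg W κ t) (W.measX t) hf]
  simp only [wt, max_eq_left ht, mul_assoc]

lemma ind_bd {f : ℝ → ℝ} {C : ℝ} (hC : ∀ x ∈ Ioo (0:ℝ) 1, |f x| ≤ C) (x : ℝ) : |(Ioo (0:ℝ) 1).indicator f x| ≤ C := by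
  by_cases h : x ∈ Ioo (0:ℝ) 1
  · rw [indicator_of_mem h]; exact hC x h
  · rw [indicator_of_notMem h]; simpa using (abs_nonneg _).trans (hC (1/2) (by norm_num))

lemma ind_zero {ψ : ℝ → ℝ} (h0 : ψ 0 = 0) (h1 : ψ 1 = 0) {x : ℝ} (hx : x ∈ Icc (0:ℝ) 1) : (Ioo (0:ℝ) 1).indicator ψ x = ψ x := by
  by_cases hI : x ∈ Ioo (0:ℝ) 1
  · rw [indicator_of_mem hI]
  · rw [indicator_of_notMem hI]
    have : x = 0 ∨ x = 1 := by
      by_contra hc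
      push Not at hc
      exact hI ⟨lt_of_le_of_ne hx.1 hc.1.symm, lt_of_le_of_ne hx.2 hc.2⟩
    rcases this with rfl | rfl <;> simp [h0, h1]

lemma flow (hs : 0 ≤ s) (hσ : 0 < σ) (H : RH r M) :
    WFlow (vv s σ r) (σ ^ 2 / 2) (pf W (s / σ ^ 2) 0) (pf W (s / σ ^ 2)) (Of W (s / σ ^ 2)) := by
  set κ := s / σ ^ 2 with hκd
  have hκ : 0 ≤ κ := by positivity
  have hocc : ∀ f : ℝ → ℝ, Measurable f → (∃ C, ∀ x ∈ Ioo (0:ℝ) 1, |f x| ≤ C) → ∀ t, 0 ≤ t →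
      IntervalIntegrable (fun u => ∫ x, f x ∂(pf W κ u)) volume 0 t ∧
      ∫ u in (0:ℝ)..t, ∫ x, f x ∂(pf W κ u) = ∫ x, f x ∂(Of W κ t) := by
    rintro f hf ⟨C, hC⟩ t ht
    have e : ∀ u, ∫ x, f x ∂(pf W κ u) = ∫ ω, wt W κ u ω * (Ioo (0:ℝ) 1).indicator f (W.X u ω) ∂W.P := fun u =>
      QQ_int (wt_meas W H κ u) (wt_nonneg W κ u) (W.measX u) hf
    have F := fub (P := W.P) (H := fun u ω => wt W κ u ω * (Ioo (0:ℝ) 1).indicator f (W.X u ω)) (C := Real.exp κ * C)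
      ((wt_joint W H κ).mul ((hf.indicator measurableSet_Ioo).comp (X_joint W))) ht (fun u _ ω => by
        rw [abs_mul, abs_of_nonneg (wt_nonneg W κ u ω)]
        exact mul_le_mul (wt_le W H hκ u ω) (ind_bd hC _) (abs_nonneg _) (Real.exp_pos _).le)
    simp only [e]
    refine ⟨F.2.1, ?_⟩
    rw [Of, QQ_int (wt_joint W H κ) (fun z => wt_nonneg W κ z.1 z.2) (X_joint W) hf, intervalIntegral.integral_of_le ht]
    exact (integral_prod _ F.1).symm
  refine ⟨QQ_fin (wt_le W H hκ 0), QQ_null _ _ _, fun t => QQ_fin (wt_le W H hκ t), fun t => QQ_null _ _ _,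
    fun t => QQ_fin (fun z => wt_le W H hκ z.1 z.2), fun t => QQ_null _ _ _, hocc, ?_⟩
  intro ψ hψ h0 h1 t ht
  have hψ2 : Continuous (deriv (deriv ψ)) := by
    have : ContDiff ℝ 1 (deriv ψ) := by
      have : ContDiff ℝ (1+1) ψ := by simpa [one_add_one_eq_two] using hψ
      exact (contDiff_succ_iff_deriv.1 this).2.2
    exact this.continuous_deriv le_rfl
  have hf : ContDiff ℝ 2 (fun x => Real.exp (κ * x) * ψ x) := by fun_prop
  have hB := vv_BV (s := s) hσ H
  have hgm : Measurable fun x => aa x * deriv (deriv ψ) x - vv s σ r x * ψ x :=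
    (continuous_aa.mul hψ2).measurable.sub (hB.meas.mul hψ.continuous.measurable)
  obtain ⟨C1, hC10, hC1⟩ := bdd_Icc (continuous_aa.mul hψ2)
  obtain ⟨C2, hC20, hC2⟩ := bdd_Icc hψ.continuous
  have hgb : ∃ C, ∀ x ∈ Ioo (0:ℝ) 1, |aa x * deriv (deriv ψ) x - vv s σ r x * ψ x| ≤ C := ⟨C1 + ((s ^ 2 / (2 * σ ^ 2) * 1 + M) / (σ ^ 2 / 2)) * C2, fun x hx => by
    refine (abs_sub _ _).trans (add_le_add (hC1 x (Ioo_subset_Icc_self hx)) ?_)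
    rw [abs_mul]
    exact mul_le_mul (hB.abs_le x) (hC2 x (Ioo_subset_Icc_self hx)) (abs_nonneg _) hB.M_nonneg⟩
  have F := fwd W H hf ht
  rw [← (hocc _ hgm hgb t ht).2, pf_int W H κ ht hψ.continuous.measurable, pf_int W H κ le_rfl hψ.continuous.measurable,
    ← intervalIntegral.integral_const_mul]
  have a1 : ∀ u ω, (Ioo (0:ℝ) 1).indicator ψ (W.X u ω) = ψ (W.X u ω) := fun u ω => ind_zero h0 h1 (W.range01 u ω)
  simp only [a1]
  rw [F]
  congr 1
  · simp [ZZ]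
  · refine intervalIntegral.integral_congr fun u hu => ?_
    rw [uIcc_of_le ht] at hu
    rw [pf_int W H κ hu.1 hgm, ← integral_const_mul]
    refine integral_congr_ae (Eventually.of_forall fun ω => ?_)
    simp only
    rw [gen_id hσ hψ h0 h1 (W.range01 u ω)]
    ring

lemma alive_pf (hs : 0 ≤ s) (hσ : 0 < σ) (H : RH r M) {t : ℝ} (ht : 0 ≤ t) {f : ℝ → ℝ} (hf : Measurable f)
    (hC : ∃ C, ∀ x ∈ Ioo (0:ℝ) 1, |f x| ≤ C) :
    ∫ ω in W.aliveAll t, f (W.X t ω) ∂W.P = ∫ x, Real.exp (-(s / σ ^ 2 * x)) * f x ∂(pf W (s / σ ^ 2) t) := by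
  obtain ⟨C, hC⟩ := hC
  rw [alive_int W hs hσ H ht hf hC, pf_int W H _ ht (by fun_prop)]
  refine integral_congr_ae (Eventually.of_forall fun ω => ?_)
  simp only
  by_cases hI : W.X t ω ∈ Ioo (0:ℝ) 1
  · rw [indicator_of_mem hI, indicator_of_mem hI, ← mul_assoc (Real.exp _), ← Real.exp_add]; simp
  · rw [indicator_of_notMem hI, indicator_of_notMem hI]; simp

lemma pf_zero (H : RH r M) (κ : ℝ) {f : ℝ → ℝ} (hf : Measurable f) :
    ∫ x, f x ∂(pf W κ 0) = ∫ x, Real.exp (κ * x) * (Ioo (0:ℝ) 1).indicator f x ∂μ₀ := by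
  rw [pf_int W H κ le_rfl hf]
  conv_rhs => rw [← W.initLaw]
  rw [integral_map (W.measX 0).aemeasurable
    (by have := hf.indicator (measurableSet_Ioo (a := (0:ℝ)) (b := 1)); fun_prop)]
  simp [ZZ]

lemma WFlow.scale {v : ℝ → ℝ} {D : ℝ} {μ μ' : Measure ℝ} {p O : ℝ → Measure ℝ} (h : WFlow v D μ p O) (c : ℝ≥0)
    (hf : IsFiniteMeasure μ') (hn : μ' (Ioo (0:ℝ) 1)ᶜ = 0)
    (hμ : ∀ ψ : ℝ → ℝ, ContDiff ℝ 2 ψ → ∫ x, ψ x ∂μ' = c * ∫ x, ψ x ∂μ) :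
    WFlow v D μ' (fun t => c • p t) (fun t => c • O t) := by
  have i : ∀ (f : ℝ → ℝ) (m : Measure ℝ), ∫ x, f x ∂(c • m) = c * ∫ x, f x ∂m := fun f m => by
    rw [integral_smul_nnreal_measure, NNReal.smul_def, smul_eq_mul]
  refine ⟨hf, hn, fun t => ?_, fun t => by simp [h.ps t], fun t => ?_, fun t => by simp [h.Os t], ?_, ?_⟩
  · have := h.pf t; infer_instance
  · have := h.Of t; infer_instance
  · intro f hf hC t ht
    obtain ⟨a, b⟩ := h.occ f hf hC t ht
    simp only [i, intervalIntegral.integral_const_mul, b]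
    exact ⟨a.const_mul _, trivial⟩
  · intro ψ hψ h0 h1 t ht
    rw [i, i, hμ ψ hψ, h.eq ψ hψ h0 h1 t ht]; ring

lemma flowEx (hs : 0 ≤ s) (hσ : 0 < σ) (H : RH r M) (hex : WFExists s σ r) : FlowEx (vv s σ r) (σ ^ 2 / 2) := by
  intro x hx
  obtain ⟨W⟩ := hex (Measure.dirac x) inferInstance (by
    rw [Measure.dirac_apply' _ measurableSet_Icc.compl]; simp [hx.1.le, hx.2.le])
  refine ⟨_, _, (flow W hs hσ H).scale (Real.exp (-(s / σ ^ 2 * x))).toNNReal inferInstance (by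
    rw [Measure.dirac_apply' _ measurableSet_Ioo.compl]; simp [hx.1, hx.2]) fun ψ hψ => ?_⟩
  rw [pf_zero W H _ hψ.continuous.measurable, integral_dirac, integral_dirac, indicator_of_mem hx,
    Real.coe_toNNReal _ (Real.exp_pos _).le, ← mul_assoc, ← Real.exp_add]
  simp
end WFA
end

section
namespace WFA
variable {s σ : ℝ} {r : ℝ → ℝ} {μ₀ : Measure ℝ} {M : ℝ}

lemma N_eq (W : WFKilled s σ r μ₀) (hs : 0 ≤ s) (hσ : 0 < σ) (H : RH r M) {t : ℝ} (ht : 0 ≤ t) {A : Set ℝ} (hA : MeasurableSet A) :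
    (W.P ({ω | W.X t ω ∈ A} ∩ W.aliveAll t)).toReal =
      ∫ x, Real.exp (-(s / σ ^ 2 * x)) * A.indicator (fun _ => (1:ℝ)) x ∂(pf W (s / σ ^ 2) t) := by
  have hm : MeasurableSet {ω | W.X t ω ∈ A} := W.measX t hA
  rw [← alive_pf W hs hσ H ht (measurable_const.indicator hA) ⟨1, fun x _ => by by_cases h : x ∈ A <;> simp [h]⟩,
    ← Measure.restrict_apply hm]
  have := integral_indicator_one (μ := W.P.restrict (W.aliveAll t)) hm
  rw [measureReal_def] at this
  rw [← this]; rfl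

/-- the assembled data -/
structure Dat (s σ : ℝ) (r : ℝ → ℝ) (M l₀ l₁ c C : ℝ) (F : ℝ → ℝ) (m0 : ℝ) (α : Measure ℝ) (η : ℝ → ℝ) : Prop where
  hs : 0 ≤ s
  hσ : 0 < σ
  H : RH r M
  ana : Ana (vv s σ r) (σ ^ 2 / 2) l₀ l₁ c C F
  m0pos : 0 < m0
  αp : IsProbabilityMeasure α
  αn : α (Ioo (0:ℝ) 1)ᶜ = 0
  αi : ∀ f : ℝ → ℝ, ∫ x, f x ∂α = m0⁻¹ * ∫ x, F x / aa x * (Real.exp (-(s / σ ^ 2 * x)) * f x) ∂nu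
  ηe : η = (Ioo (0:ℝ) 1).indicator fun x => Real.exp (s / σ ^ 2 * x) * F x * m0

lemma exists_Dat (hs : 0 ≤ s) (hσ : 0 < σ) (H : RH r M) (hex : WFExists s σ r) :
    ∃ l₀ l₁ c C F m0 α η, Dat s σ r M l₀ l₁ c C F m0 α η := by
  have hD : 0 < σ ^ 2 / 2 := by positivity
  obtain ⟨K, k1, k2, k3⟩ := exists_K hD (vv_BV hσ H) (flowEx hs hσ H hex)
  obtain ⟨l₀, l₁, c, C, F, hA⟩ := KOp.ana ⟨hD, vv_BV hσ H, flowEx hs hσ H hex, k1, k2, k3⟩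
  set κ := s / σ ^ 2 with hκd
  have hκ : 0 ≤ κ := by positivity
  set q : ℝ → ℝ := fun x => F x / aa x * Real.exp (-(κ * x)) with hq
  have hqm : Measurable q := by
    have := hA.Fm; have := measurable_aa; fun_prop
  have q1 : ∀ x ∈ Ioo (0:ℝ) 1, c * Real.exp (-κ) ≤ q x := fun x hx => by
    refine mul_le_mul ?_ (Real.exp_le_exp.2 ?_) (Real.exp_pos _).le ?_
    · rw [le_div_iff₀ (aa_pos hx)]; exact hA.low x hx
    · nlinarith [hx.2]
    · exact hA.cpos.le.trans ((le_div_iff₀ (aa_pos hx)).2 (hA.low x hx))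
  have q0 : ∀ x ∈ Ioo (0:ℝ) 1, 0 ≤ q x := fun x hx => (mul_pos hA.cpos (Real.exp_pos _)).le.trans (q1 x hx)
  have q2 : ∀ x ∈ Ioo (0:ℝ) 1, |q x| ≤ C := fun x hx => by
    rw [abs_of_nonneg (q0 x hx)]
    have h1 : F x / aa x ≤ C := (div_le_iff₀ (aa_pos hx)).2 (hA.up x hx)
    have h2 : Real.exp (-(κ * x)) ≤ 1 := Real.exp_le_one_iff.2 (neg_nonpos.2 (mul_nonneg hκ hx.1.le))
    calc q x ≤ C * 1 := mul_le_mul h1 h2 (Real.exp_pos _).le hA.Cpos.le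
      _ = C := mul_one C
  have qi : Integrable q nu := bint nu_null hqm q2
  set m0 := ∫ x, q x ∂nu with hm0
  have m0pos : 0 < m0 := by
    have : ∫ x, c * Real.exp (-κ) ∂nu ≤ m0 := int_mono_Ioo nu_null (integrable_const _) qi q1
    rw [integral_const] at this
    simp only [probReal_univ, one_smul] at this
    exact (mul_pos hA.cpos (Real.exp_pos _)).trans_le this
  set α := nu.withDensity fun x => ENNReal.ofReal (m0⁻¹ * q x) with hα
  have αi : ∀ f : ℝ → ℝ, ∫ x, f x ∂α = m0⁻¹ * ∫ x, F x / aa x * (Real.exp (-(κ * x)) * f x) ∂nu := fun f => by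
    rw [hα, withDens_int (hqm.const_mul _), ← integral_const_mul]
    refine int_congr_Ioo nu_null fun x hx => ?_
    rw [max_eq_left (mul_nonneg (inv_pos.2 m0pos).le (q0 x hx))]; simp only [hq]; ring
  have : IsFiniteMeasure α := withDens_fin (C := m0⁻¹ * C) fun x hx => by
    rw [abs_mul, abs_of_pos (inv_pos.2 m0pos)]; exact mul_le_mul_of_nonneg_left (q2 x hx) (inv_pos.2 m0pos).le
  refine ⟨l₀, l₁, c, C, F, m0, α, _, hs, hσ, H, hA, m0pos, ?_, withDens_null _, αi, rfl⟩
  have h1 := αi fun _ => 1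
  simp only [integral_const, smul_eq_mul, mul_one] at h1
  rw [← hm0, inv_mul_cancel₀ m0pos.ne'] at h1
  refine ⟨?_⟩
  rw [measureReal_def] at h1
  exact (ENNReal.toReal_eq_one_iff _).1 h1

variable {l₀ l₁ c C m0 : ℝ} {F η : ℝ → ℝ} {α : Measure ℝ}

lemma Dat.κ0 (T : Dat s σ r M l₀ l₁ c C F m0 α η) : 0 ≤ s / σ ^ 2 := div_nonneg T.hs (sq_nonneg _)

lemma Dat.wA (T : Dat s σ r M l₀ l₁ c C F m0 α η) {A : Set ℝ} {x : ℝ} (hx : x ∈ Ioo (0:ℝ) 1) :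
    |Real.exp (-(s / σ ^ 2 * x)) * A.indicator (fun _ => (1:ℝ)) x| ≤ 1 := by
  rw [abs_mul, abs_of_pos (Real.exp_pos _)]
  have h2 : Real.exp (-(s / σ ^ 2 * x)) ≤ 1 := Real.exp_le_one_iff.2 (neg_nonpos.2 (mul_nonneg T.κ0 hx.1.le))
  by_cases h : x ∈ A <;> simp [h]
  exact mul_nonneg T.κ0 hx.1.le

lemma Dat.wm {A : Set ℝ} (hA : MeasurableSet A) (κ : ℝ) :
    Measurable fun x : ℝ => Real.exp (-(κ * x)) * A.indicator (fun _ => (1:ℝ)) x := by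
  have : Measurable (A.indicator fun _ => (1:ℝ)) := measurable_const.indicator hA
  fun_prop

lemma Dat.αA (T : Dat s σ r M l₀ l₁ c C F m0 α η) {A : Set ℝ} (hA : MeasurableSet A) :
    ∫ x, F x / aa x * (Real.exp (-(s / σ ^ 2 * x)) * A.indicator (fun _ => (1:ℝ)) x) ∂nu = m0 * (α A).toReal := by
  have h1 := T.αi (A.indicator fun _ => (1:ℝ))
  have h2 := integral_indicator_one (μ := α) hA
  rw [measureReal_def] at h2
  rw [← h2]
  have : ∫ x, A.indicator (1 : ℝ → ℝ) x ∂α = ∫ x, A.indicator (fun _ => (1:ℝ)) x ∂α := rfl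
  rw [this, h1, mul_inv_cancel_left₀ T.m0pos.ne']

lemma Dat.N (T : Dat s σ r M l₀ l₁ c C F m0 α η) (W : WFKilled s σ r μ₀) {t : ℝ} (ht : 1 ≤ t) {A : Set ℝ} (hA : MeasurableSet A) :
    |(W.P ({ω | W.X t ω ∈ A} ∩ W.aliveAll t)).toReal -
      Real.exp (-(σ ^ 2 / 2 * l₀ * t)) * (∫ x, F x ∂(pf W (s / σ ^ 2) 0)) * (m0 * (α A).toReal)| ≤
    C * Real.exp (-(σ ^ 2 / 2 * l₁ * t)) * ∫ x, aa x ∂(pf W (s / σ ^ 2) 0) := by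
  rw [N_eq W T.hs T.hσ T.H (zero_le_one.trans ht) hA, ← T.αA hA]
  exact T.ana.conv _ _ _ (flow W T.hs T.hσ T.H) t ht _ (Dat.wm hA _) fun x hx => T.wA hx

lemma Dat.ab (T : Dat s σ r M l₀ l₁ c C F m0 α η) (W : WFKilled s σ r μ₀) (hμ : IsProbabilityMeasure μ₀)
    (hn : μ₀ (Ioo (0:ℝ) 1)ᶜ = 0) :
    0 < ∫ x, aa x ∂(pf W (s / σ ^ 2) 0) ∧ ∫ x, aa x ∂(pf W (s / σ ^ 2) 0) ≤ Real.exp (s / σ ^ 2) ∧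
    c * ∫ x, aa x ∂(pf W (s / σ ^ 2) 0) ≤ ∫ x, F x ∂(pf W (s / σ ^ 2) 0) ∧
    ∫ x, F x ∂(pf W (s / σ ^ 2) 0) ≤ C * ∫ x, aa x ∂(pf W (s / σ ^ 2) 0) ∧
    ∫ x, η x ∂μ₀ = m0 * ∫ x, F x ∂(pf W (s / σ ^ 2) 0) := by
  have hf := flow W T.hs T.hσ T.H
  have := hf.muf
  have ia : Integrable aa (pf W (s / σ ^ 2) 0) := bint hf.mus measurable_aa (C := 1) fun x hx => aa_abs hx
  have iF : Integrable F (pf W (s / σ ^ 2) 0) := bint hf.mus T.ana.Fm (C := C) fun x hx => by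
    have h1 := T.ana.low x hx; have h2 := T.ana.up x hx; have h3 := aa_pos hx; have h4 := aa_le_one x
    have h5 := T.ana.cpos; have h6 := T.ana.Cpos
    rw [abs_of_nonneg ((mul_pos h5 h3).le.trans h1)]; nlinarith
  have em : Measurable fun x => Real.exp (s / σ ^ 2 * x) := by fun_prop
  have eb : ∀ x ∈ Ioo (0:ℝ) 1, Real.exp (s / σ ^ 2 * x) * aa x ≤ Real.exp (s / σ ^ 2) ∧ 0 < Real.exp (s / σ ^ 2 * x) * aa x := fun x hx => by
    have h3 := aa_pos hx; have h4 := aa_le_one x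
    refine ⟨?_, mul_pos (Real.exp_pos _) h3⟩
    calc _ ≤ Real.exp (s / σ ^ 2) * 1 := mul_le_mul (Real.exp_le_exp.2 (mul_le_of_le_one_right T.κ0 hx.2.le)) h4 h3.le (Real.exp_pos _).le
      _ = _ := mul_one _
  have e1 : ∫ x, aa x ∂(pf W (s / σ ^ 2) 0) = ∫ x, Real.exp (s / σ ^ 2 * x) * aa x ∂μ₀ := by
    rw [pf_zero W T.H _ measurable_aa]
    exact int_congr_Ioo hn fun x hx => by rw [indicator_of_mem hx]
  have ie : Integrable (fun x => Real.exp (s / σ ^ 2 * x) * aa x) μ₀ :=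
    bint hn (em.mul measurable_aa) (C := Real.exp (s / σ ^ 2)) fun x hx => by rw [abs_of_pos (eb x hx).2]; exact (eb x hx).1
  refine ⟨?_, ?_, ?_, ?_, ?_⟩
  · rw [e1]
    have h0 : 0 ≤ᵐ[μ₀] fun x => Real.exp (s / σ ^ 2 * x) * aa x := by
      filter_upwards [ae_of_null hn] with x hx using (eb x hx).2.le
    refine lt_of_le_of_ne (integral_nonneg_of_ae h0) fun h => ?_
    have h1 := (integral_eq_zero_iff_of_nonneg_ae h0 ie).1 h.symm
    have h2 : ∀ᵐ x ∂μ₀, False := by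
      filter_upwards [h1, ae_of_null hn] with x h1 hx using (eb x hx).2.ne' h1
    rw [ae_iff] at h2
    simp at h2
  · rw [e1]
    calc _ ≤ ∫ x, Real.exp (s / σ ^ 2) ∂μ₀ := int_mono_Ioo hn ie (integrable_const _) fun x hx => (eb x hx).1
      _ = _ := by simp
  · rw [← integral_const_mul]; exact int_mono_Ioo hf.mus (ia.const_mul _) iF T.ana.low
  · rw [← integral_const_mul]; exact int_mono_Ioo hf.mus iF (ia.const_mul _) T.ana.up
  · rw [pf_zero W T.H _ T.ana.Fm, ← integral_const_mul, T.ηe]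
    refine int_congr_Ioo hn fun x hx => ?_
    rw [indicator_of_mem hx, indicator_of_mem hx]; ring

lemma Dat.tv (T : Dat s σ r M l₀ l₁ c C F m0 α η) (W : WFKilled s σ r μ₀) (hμ : IsProbabilityMeasure μ₀)
    (hn : μ₀ (Ioo (0:ℝ) 1)ᶜ = 0) {t : ℝ} (ht : 0 ≤ t) {A : Set ℝ} (hA : MeasurableSet A) :
    |(W.P ({ω | W.X t ω ∈ A} ∩ W.aliveAll t)).toReal / (W.P (W.aliveAll t)).toReal - (α A).toReal| ≤
      (4 * C / (c * m0) + Real.exp (σ ^ 2 / 2 * (l₁ - l₀))) * Real.exp (-(σ ^ 2 / 2 * (l₁ - l₀)) * t) := by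
  have := T.αp
  have hNS : (W.P ({ω | W.X t ω ∈ A} ∩ W.aliveAll t)).toReal ≤ (W.P (W.aliveAll t)).toReal :=
    ENNReal.toReal_mono (measure_ne_top _ _) (measure_mono inter_subset_right)
  set N := (W.P ({ω | W.X t ω ∈ A} ∩ W.aliveAll t)).toReal with hN
  set S := (W.P (W.aliveAll t)).toReal with hS
  have hN0 : 0 ≤ N := ENNReal.toReal_nonneg
  have hS0 : 0 ≤ S := ENNReal.toReal_nonneg
  have ha0 : 0 ≤ (α A).toReal := ENNReal.toReal_nonneg
  have ha1 : (α A).toReal ≤ 1 := measureReal_le_one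
  have htriv : |N / S - (α A).toReal| ≤ 1 := by
    have h1 := div_le_one_of_le₀ hNS hS0; have h2 := div_nonneg hN0 hS0
    rw [abs_le]; constructor <;> linarith
  set z := σ ^ 2 / 2 * (l₁ - l₀) with hz
  have hzp : 0 < z := mul_pos (by have := T.hσ; positivity) (sub_pos.2 T.ana.l01)
  have hcm : 0 < c * m0 := mul_pos T.ana.cpos T.m0pos
  have hCp := T.ana.Cpos
  have hE := Real.exp_pos (-z * t)
  rcases lt_or_ge t 1 with h1 | h1
  · refine htriv.trans ?_
    have : 1 ≤ Real.exp z * Real.exp (-z * t) := by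
      rw [← Real.exp_add]; exact Real.one_le_exp (by nlinarith)
    have : 0 ≤ 4 * C / (c * m0) * Real.exp (-z * t) := by positivity
    rw [add_mul]; linarith
  rcases le_or_gt (c * m0 / 2) (C * Real.exp (-z * t)) with h2 | h2
  · refine htriv.trans ?_
    have : 1 ≤ 4 * C / (c * m0) * Real.exp (-z * t) := by
      rw [div_mul_eq_mul_div, le_div_iff₀ hcm]; linarith
    have := mul_pos (Real.exp_pos z) hE
    rw [add_mul]; linarith
  have hA1 := T.N W h1 hA
  have hA2 := T.N W h1 MeasurableSet.univ
  obtain ⟨b0, -, b2, -, -⟩ := T.ab W hμ hn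
  set a := ∫ x, F x ∂(pf W (s / σ ^ 2) 0)
  set b := ∫ x, aa x ∂(pf W (s / σ ^ 2) 0)
  simp only [mem_univ, Set.ofPred_true, univ_inter, measure_univ, ENNReal.toReal_one, mul_one] at hA2
  set R := Real.exp (-(σ ^ 2 / 2 * l₀ * t)) with hR
  have hRp : 0 < R := Real.exp_pos _
  have e1 : Real.exp (-(σ ^ 2 / 2 * l₁ * t)) = R * Real.exp (-z * t) := by
    rw [hR, ← Real.exp_add, hz]; ring_nf
  rw [e1] at hA1 hA2
  set E := Real.exp (-z * t)
  have hSl : R * b * (c * m0 / 2) ≤ S := by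
    have h3 := (abs_le.1 hA2).1
    have h4 : R * b * (c * m0) ≤ R * a * m0 := by
      have := mul_le_mul_of_nonneg_left b2 (mul_pos hRp T.m0pos).le
      nlinarith
    have h5 : R * b * (C * E) ≤ R * b * (c * m0 / 2) := mul_le_mul_of_nonneg_left h2.le (mul_pos hRp b0).le
    nlinarith
  have hSp : 0 < S := lt_of_lt_of_le (by positivity) hSl
  have hnum : |N - (α A).toReal * S| ≤ 2 * (C * (R * E) * b) := by
    have h6 : N - (α A).toReal * S = (N - R * a * (m0 * (α A).toReal)) - (α A).toReal * (S - R * a * m0) := by ring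
    rw [h6]
    refine (abs_sub _ _).trans ?_
    rw [abs_mul, abs_of_nonneg ha0]
    have := mul_le_mul ha1 hA2 (abs_nonneg _) zero_le_one
    linarith
  have h7 : |N / S - (α A).toReal| ≤ 4 * C / (c * m0) * E := by
    rw [show N / S - (α A).toReal = (N - (α A).toReal * S) / S by field_simp, abs_div, abs_of_pos hSp, div_le_iff₀ hSp]
    refine hnum.trans ?_
    have h8 : 4 * C / (c * m0) * E * (R * b * (c * m0 / 2)) = 2 * (C * (R * E) * b) := by
      have := hcm.ne'
      have := T.ana.cpos.ne'; have := T.m0pos.ne'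
      field_simp; ring
    rw [← h8]
    exact mul_le_mul_of_nonneg_left hSl (by positivity)
  have := mul_pos (Real.exp_pos z) hE
  rw [add_mul]; linarith

lemma Dat.mass (T : Dat s σ r M l₀ l₁ c C F m0 α η) (W : WFKilled s σ r μ₀) (hμ : IsProbabilityMeasure μ₀)
    (hn : μ₀ (Ioo (0:ℝ) 1)ᶜ = 0) {t : ℝ} (ht : 0 ≤ t) :
    |Real.exp (σ ^ 2 / 2 * l₀ * t) * (W.P (W.aliveAll t)).toReal - ∫ x, η x ∂μ₀| ≤
      (C * Real.exp (s / σ ^ 2) + (Real.exp (σ ^ 2 / 2 * l₀) + m0 * (C * Real.exp (s / σ ^ 2))) * Real.exp (σ ^ 2 / 2 * (l₁ - l₀))) *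
        Real.exp (-(σ ^ 2 / 2 * (l₁ - l₀)) * t) := by
  have := T.αp
  obtain ⟨b0, b1, b2, b3, b4⟩ := T.ab W hμ hn
  rw [b4]
  set a := ∫ x, F x ∂(pf W (s / σ ^ 2) 0)
  set b := ∫ x, aa x ∂(pf W (s / σ ^ 2) 0)
  have hCp := T.ana.Cpos
  have hm := T.m0pos
  have hD : 0 < σ ^ 2 / 2 := by have := T.hσ; positivity
  set z := σ ^ 2 / 2 * (l₁ - l₀) with hz
  have hzp : 0 < z := mul_pos hD (sub_pos.2 T.ana.l01)
  have hE := Real.exp_pos (-z * t)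
  have ha0 : 0 ≤ a := (mul_pos T.ana.cpos b0).le.trans b2
  have ha1 : a ≤ C * Real.exp (s / σ ^ 2) := b3.trans (mul_le_mul_of_nonneg_left b1 hCp.le)
  rcases lt_or_ge t 1 with h1 | h1
  · have h2 : 1 ≤ Real.exp z * Real.exp (-z * t) := by
      rw [← Real.exp_add]; exact Real.one_le_exp (by nlinarith)
    have h3 : |Real.exp (σ ^ 2 / 2 * l₀ * t) * (W.P (W.aliveAll t)).toReal - m0 * a| ≤
        Real.exp (σ ^ 2 / 2 * l₀) + m0 * (C * Real.exp (s / σ ^ 2)) := by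
      refine (abs_sub _ _).trans (add_le_add ?_ ?_)
      · rw [abs_of_nonneg (by positivity)]
        calc _ ≤ Real.exp (σ ^ 2 / 2 * l₀) * 1 := by
              refine mul_le_mul (Real.exp_le_exp.2 ?_) measureReal_le_one ENNReal.toReal_nonneg (Real.exp_pos _).le
              exact mul_le_of_le_one_right (mul_pos hD T.ana.l0pos).le h1.le
          _ = _ := mul_one _
      · rw [abs_of_nonneg (by positivity)]; gcongr
    refine h3.trans ?_
    have h4 : 0 ≤ C * Real.exp (s / σ ^ 2) * Real.exp (-z * t) := by positivity
    have h5 : 0 ≤ Real.exp (σ ^ 2 / 2 * l₀) + m0 * (C * Real.exp (s / σ ^ 2)) := by positivity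
    rw [add_mul, mul_assoc _ (Real.exp z)]
    nlinarith
  · have hA2 := T.N W h1 MeasurableSet.univ
    simp only [mem_univ, Set.ofPred_true, univ_inter, measure_univ, ENNReal.toReal_one, mul_one] at hA2
    set S := (W.P (W.aliveAll t)).toReal
    have e0 : Real.exp (σ ^ 2 / 2 * l₀ * t) * Real.exp (-(σ ^ 2 / 2 * l₀ * t)) = 1 := by rw [← Real.exp_add]; simp
    have e1 : Real.exp (σ ^ 2 / 2 * l₀ * t) * Real.exp (-(σ ^ 2 / 2 * l₁ * t)) = Real.exp (-z * t) := by
      rw [← Real.exp_add, hz]; ring_nf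
    have h2 : Real.exp (σ ^ 2 / 2 * l₀ * t) * S - m0 * a =
        Real.exp (σ ^ 2 / 2 * l₀ * t) * (S - Real.exp (-(σ ^ 2 / 2 * l₀ * t)) * a * m0) := by
      linear_combination (a * m0) * e0
    rw [h2, abs_mul, abs_of_pos (Real.exp_pos _)]
    refine (mul_le_mul_of_nonneg_left hA2 (Real.exp_pos _).le).trans ?_
    rw [show Real.exp (σ ^ 2 / 2 * l₀ * t) * (C * Real.exp (-(σ ^ 2 / 2 * l₁ * t)) * b) =
      (Real.exp (σ ^ 2 / 2 * l₀ * t) * Real.exp (-(σ ^ 2 / 2 * l₁ * t))) * (C * b) by ring, e1]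
    have h5 : 0 ≤ (Real.exp (σ ^ 2 / 2 * l₀) + m0 * (C * Real.exp (s / σ ^ 2))) * Real.exp z := by positivity
    have h6 : C * b ≤ C * Real.exp (s / σ ^ 2) := mul_le_mul_of_nonneg_left b1 hCp.le
    nlinarith

end WFA
end

section
namespace WFA
variable {s σ : ℝ} {r : ℝ → ℝ} {μ₀ : Measure ℝ} {M : ℝ}
variable {l₀ l₁ c C m0 : ℝ} {F η : ℝ → ℝ} {α : Measure ℝ}

lemma Dat.qsd (T : Dat s σ r M l₀ l₁ c C F m0 α η) : IsQSD s σ r α (σ ^ 2 / 2 * l₀) := by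
  have := T.αp
  refine ⟨T.αp, T.αn, fun W t ht A hA => ?_⟩
  have h0 : ∀ f : ℝ → ℝ, Measurable f → (∃ C, ∀ x ∈ Ioo (0:ℝ) 1, |f x| ≤ C) →
      ∫ x, f x ∂(pf W (s / σ ^ 2) 0) = m0⁻¹ * ∫ x, F x / aa x * f x ∂nu := fun f hf _ => by
    rw [pf_zero W T.H _ hf, T.αi]
    congr 1
    refine int_congr_Ioo nu_null fun x hx => ?_
    rw [indicator_of_mem hx, ← mul_assoc (Real.exp _), ← Real.exp_add]
    simp
  have h1 := T.ana.stat _ _ _ m0⁻¹ (flow W T.hs T.hσ T.H) h0 t ht.le _ (Dat.wm hA (s / σ ^ 2)) ⟨1, fun x hx => T.wA hx⟩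
  rw [h0 _ (Dat.wm hA (s / σ ^ 2)) ⟨1, fun x hx => T.wA hx⟩, T.αA hA, inv_mul_cancel_left₀ T.m0pos.ne',
    ← N_eq W T.hs T.hσ T.H ht.le hA] at h1
  rw [← ENNReal.toReal_eq_toReal_iff' (measure_ne_top _ _) (ENNReal.mul_ne_top ENNReal.ofReal_ne_top (measure_ne_top _ _)),
    ENNReal.toReal_mul, ENNReal.toReal_ofReal (Real.exp_pos _).le, h1]

lemma Dat.zpos (T : Dat s σ r M l₀ l₁ c C F m0 α η) : 0 < σ ^ 2 / 2 * (l₁ - l₀) :=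
  mul_pos (by have := T.hσ; positivity) (sub_pos.2 T.ana.l01)

lemma lim_exp {z : ℝ} (hz : 0 < z) (K : ℝ) : Tendsto (fun t : ℝ => K * Real.exp (-z * t)) atTop (𝓝 0) := by
  have h1 : Tendsto (fun t : ℝ => -z * t) atTop atBot := tendsto_id.const_mul_atTop_of_neg (neg_lt_zero.2 hz)
  simpa using (Real.tendsto_exp_atBot.comp h1).const_mul K

lemma Dat.uniq (T : Dat s σ r M l₀ l₁ c C F m0 α η) (hex : WFExists s σ r) {α' : Measure ℝ} {ρ' : ℝ}
    (h : IsQSD s σ r α' ρ') : α' = α ∧ ρ' = σ ^ 2 / 2 * l₀ := by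
  have hα := T.αp
  obtain ⟨hp, hn, hq⟩ := id h
  obtain ⟨W⟩ := hex α' hp (measure_mono_null (compl_subset_compl.2 Ioo_subset_Icc_self) hn)
  have hS : ∀ t : ℝ, 0 < t → W.P (W.aliveAll t) = ENNReal.ofReal (Real.exp (-(ρ' * t))) := fun t ht => by
    have := hq W t ht univ MeasurableSet.univ
    simpa using this
  have hαα : α' = α := by
    ext A hA
    have key : ∀ t : ℝ, 0 < t → |(α' A).toReal - (α A).toReal| ≤
        (4 * C / (c * m0) + Real.exp (σ ^ 2 / 2 * (l₁ - l₀))) * Real.exp (-(σ ^ 2 / 2 * (l₁ - l₀)) * t) := fun t ht => by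
      have h1 := T.tv W hp hn ht.le hA
      rw [hS t ht, hq W t ht A hA, ENNReal.toReal_mul, mul_div_cancel_left₀] at h1
      · exact h1
      · rw [ENNReal.toReal_ofReal (Real.exp_pos _).le]; exact (Real.exp_pos _).ne'
    have h2 : |(α' A).toReal - (α A).toReal| ≤ 0 :=
      ge_of_tendsto (lim_exp T.zpos _) ((eventually_gt_atTop 0).mono key)
    have h3 := sub_eq_zero.1 (abs_nonpos_iff.1 h2)
    exact (ENNReal.toReal_eq_toReal_iff' (measure_ne_top _ _) (measure_ne_top _ _)).1 h3
  refine ⟨hαα, ?_⟩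
  subst hαα
  have h4 := T.qsd.2.2 W 1 one_pos univ MeasurableSet.univ
  rw [hq W 1 one_pos univ MeasurableSet.univ] at h4
  simp only [measure_univ, mul_one] at h4
  have h5 := congrArg ENNReal.toReal h4
  rw [ENNReal.toReal_ofReal (Real.exp_pos _).le, ENNReal.toReal_ofReal (Real.exp_pos _).le] at h5
  have := Real.exp_injective h5
  linarith

lemma Dat.ηm (T : Dat s σ r M l₀ l₁ c C F m0 α η) : Measurable η := by
  rw [T.ηe]
  have := T.ana.Fm
  exact Measurable.indicator (by fun_prop) measurableSet_Ioo

lemma Dat.ηb (T : Dat s σ r M l₀ l₁ c C F m0 α η) {x : ℝ} (hx : x ∈ Ioo (0:ℝ) 1) :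
    |η x| ≤ Real.exp (s / σ ^ 2) * C * m0 := by
  have h1 := T.ana.low x hx; have h2 := T.ana.up x hx; have h3 := aa_pos hx; have h4 := aa_le_one x
  have h5 := T.ana.cpos; have h6 := T.ana.Cpos; have h7 := T.m0pos
  have hF : 0 ≤ F x := (mul_pos h5 h3).le.trans h1
  have hF' : F x ≤ C := h2.trans (mul_le_of_le_one_right h6.le h4)
  rw [T.ηe, indicator_of_mem hx, abs_of_nonneg (by positivity)]
  gcongr
  exact mul_le_of_le_one_right T.κ0 hx.2.le

lemma Dat.surv (T : Dat s σ r M l₀ l₁ c C F m0 α η) : IsSurvCap s σ r (σ ^ 2 / 2 * l₀) η := by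
  refine ⟨T.ηm, fun x hx W t ht => ?_⟩
  have hD : 0 < σ ^ 2 / 2 := by have := T.hσ; positivity
  have hf := flow W T.hs T.hσ T.H
  rw [alive_pf W T.hs T.hσ T.H ht.le T.ηm ⟨_, fun x hx => T.ηb hx⟩]
  have h1 : ∫ x, Real.exp (-(s / σ ^ 2 * x)) * η x ∂(pf W (s / σ ^ 2) t) = ∫ x, m0 * F x ∂(pf W (s / σ ^ 2) t) := by
    refine int_congr_Ioo (hf.ps t) fun x hx => ?_
    have e : Real.exp (-(s / σ ^ 2 * x)) * Real.exp (s / σ ^ 2 * x) = 1 := by rw [← Real.exp_add]; simp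
    rw [T.ηe, indicator_of_mem hx]
    linear_combination (F x * m0) * e
  rw [h1, integral_const_mul, hf.eig hD (vv_BV T.hσ T.H) T.ana.sol ht.le, pf_zero W T.H _ T.ana.Fm, integral_dirac, T.ηe]
  have e : Real.exp (σ ^ 2 / 2 * l₀ * t) * Real.exp (-(σ ^ 2 / 2 * l₀ * t)) = 1 := by rw [← Real.exp_add]; simp
  by_cases h : x ∈ Ioo (0:ℝ) 1
  · rw [indicator_of_mem h, indicator_of_mem h]
    linear_combination (-(m0 * Real.exp (s / σ ^ 2 * x) * F x)) * e
  · rw [indicator_of_notMem h, indicator_of_notMem h]; simp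

lemma Dat.tvd (T : Dat s σ r M l₀ l₁ c C F m0 α η) (W : WFKilled s σ r μ₀) (hμ : IsProbabilityMeasure μ₀)
    (hn : μ₀ (Ioo (0:ℝ) 1)ᶜ = 0) {t : ℝ} (ht : 0 ≤ t) :
    tvDist (W.condLaw (W.aliveAll t) t) α ≤
      (4 * C / (c * m0) + Real.exp (σ ^ 2 / 2 * (l₁ - l₀))) * Real.exp (-(σ ^ 2 / 2 * (l₁ - l₀)) * t) := by
  refine ciSup_le fun A => ?_
  obtain ⟨B, -, hB, h1, h2⟩ := exists_measurable_superset₂ (W.condLaw (W.aliveAll t) t) α A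
  rw [← h1, ← h2]
  refine le_trans (le_of_eq ?_) (T.tv W hμ hn ht hB)
  congr 2
  rw [WFKilled.condLaw, Measure.smul_apply, Measure.map_apply (W.measX t) hB, Measure.restrict_apply (W.measX t hB),
    smul_eq_mul, ENNReal.toReal_mul, ENNReal.toReal_inv, div_eq_inv_mul]
  rfl

lemma dirac_null {x : ℝ} (hx : x ∈ Ioo (0:ℝ) 1) : Measure.dirac x (Ioo (0:ℝ) 1)ᶜ = 0 := by
  rw [Measure.dirac_apply' _ measurableSet_Ioo.compl]; simp [hx.1, hx.2]

end WFA
end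

/-- For the Wright–Fisher diffusion with selection on `[0,1]`, killed
at the soft killing time associated with the bounded death rate `-r ≥ 0` and at the
hitting times of the absorbing boundaries `0` and `1`, there is a unique
quasi-stationary distribution `α` on `(0,1)` and a survival capacity `η` for
`τ_{0,1,∂}`, with extinction rate `ρ_α`; moreover the conditioned semigroup converges
to `α` in total variation, exponentially fast and uniformly in the initial law, and
`e^{ρ_α t} ℙ_μ(t < τ_{0,1,∂}) → ⟨μ|η⟩` uniformly, whence
`η(x) = lim_t e^{ρ_α t} ℙ_x(t < τ_{0,1,∂})` and
`sup_{x,t} e^{ρ_α t} ℙ_x(t < τ_{0,1,∂}) < ∞`. -/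
theorem wf_qsd_unique_and_exponential_convergence
    (s σ : ℝ) (hs : 0 ≤ s) (hσ : 0 < σ)
    (r : ℝ → ℝ) (hrMeas : Measurable r) (hrBdd : ∃ M, ∀ x ∈ Icc (0:ℝ) 1, |r x| ≤ M)
    (hrNonpos : ∀ x ∈ Icc (0:ℝ) 1, r x ≤ 0)
    (hex : WFExists s σ r) :
    ∃ (α : Measure ℝ) (ρα : ℝ) (η : ℝ → ℝ),
      IsQSD s σ r α ρα ∧
      (∀ (α' : Measure ℝ) (ρ' : ℝ), IsQSD s σ r α' ρ' → α' = α ∧ ρ' = ρα) ∧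
      IsSurvCap s σ r ρα η ∧
      (∃ ζ : ℝ, 0 < ζ ∧
        (∃ C : ℝ, 0 < C ∧ ∀ μ : Measure ℝ, IsProbabilityMeasure μ → μ (Ioo (0:ℝ) 1)ᶜ = 0 →
          ∀ W : WFKilled s σ r μ, ∀ t : ℝ, 0 ≤ t →
            tvDist (W.condLaw (W.aliveAll t) t) α ≤ C * Real.exp (-ζ * t)) ∧
        (∃ C' : ℝ, 0 < C' ∧ ∀ μ : Measure ℝ, IsProbabilityMeasure μ → μ (Ioo (0:ℝ) 1)ᶜ = 0 →
          ∀ W : WFKilled s σ r μ, ∀ t : ℝ, 0 ≤ t →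
            |Real.exp (ρα * t) * (W.P (W.aliveAll t)).toReal - ∫ x, η x ∂μ|
              ≤ C' * Real.exp (-ζ * t))) ∧
      (∀ x ∈ Ioo (0:ℝ) 1, ∀ W : WFKilled s σ r (Measure.dirac x),
        Tendsto (fun t => Real.exp (ρα * t) * (W.P (W.aliveAll t)).toReal)
          atTop (𝓝 (η x))) ∧
      (∃ M : ℝ, ∀ x ∈ Ioo (0:ℝ) 1, ∀ W : WFKilled s σ r (Measure.dirac x), ∀ t : ℝ, 0 < t →
        Real.exp (ρα * t) * (W.P (W.aliveAll t)).toReal ≤ M) := by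
  obtain ⟨M, hM⟩ := hrBdd
  have H : WFA.RH r M := ⟨hrMeas, fun x hx => ⟨neg_nonneg.2 (hrNonpos x hx), (neg_le_abs _).trans (hM x hx)⟩⟩
  obtain ⟨l₀, l₁, c, C, F, m0, α, η, T⟩ := WFA.exists_Dat hs hσ H hex
  have hC := T.ana.Cpos
  have hc := T.ana.cpos
  have hm := T.m0pos
  refine ⟨α, σ ^ 2 / 2 * l₀, η, T.qsd, fun α' ρ' h => T.uniq hex h, T.surv,
    ⟨σ ^ 2 / 2 * (l₁ - l₀), T.zpos, ⟨_, ?_, fun μ hμ hn W t ht => T.tvd W hμ hn ht⟩,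
      ⟨_, ?_, fun μ hμ hn W t ht => T.mass W hμ hn ht⟩⟩, fun x hx W => ?_,
    ⟨(C * Real.exp (s / σ ^ 2) + (Real.exp (σ ^ 2 / 2 * l₀) + m0 * (C * Real.exp (s / σ ^ 2))) * Real.exp (σ ^ 2 / 2 * (l₁ - l₀)))
      + Real.exp (s / σ ^ 2) * C * m0, fun x hx W t ht => ?_⟩⟩
  · positivity
  · positivity
  · rw [tendsto_iff_dist_tendsto_zero]
    refine squeeze_zero' (Eventually.of_forall fun t => dist_nonneg) ?_ (WFA.lim_exp T.zpos (C * Real.exp (s / σ ^ 2) + (Real.exp (σ ^ 2 / 2 * l₀) + m0 * (C * Real.exp (s / σ ^ 2))) * Real.exp (σ ^ 2 / 2 * (l₁ - l₀))))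
    · filter_upwards [eventually_ge_atTop 0] with t ht
      have := T.mass W inferInstance (WFA.dirac_null hx) ht
      rwa [integral_dirac] at this
  · have h1 := T.mass W inferInstance (WFA.dirac_null hx) ht.le
    rw [integral_dirac] at h1
    have h2 := T.ηb hx
    have h3 : Real.exp (-(σ ^ 2 / 2 * (l₁ - l₀)) * t) ≤ 1 :=
      Real.exp_le_one_iff.2 (by nlinarith [T.zpos])
    set K := (C * Real.exp (s / σ ^ 2) + (Real.exp (σ ^ 2 / 2 * l₀) + m0 * (C * Real.exp (s / σ ^ 2))) * Real.exp (σ ^ 2 / 2 * (l₁ - l₀))) with hK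
    have hK0 : 0 ≤ K := by positivity
    have h4 := mul_le_of_le_one_right hK0 h3
    have h5 := (abs_le.1 h1).2
    have h6 := (abs_le.1 h2).2
    linarith

end
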